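/- arXiv:2310.09702 — 3 statements merged into one kernel-verified Lean document; each statement's English description precedes it below -/
import Mathlib

section
/- Suppose Assumptions 1 and 2 hold and set ω̄ = Σ_{r=0}^J ω_r a_r^{−2J−2}. Then, with B_{J+1}(x) the (J+1)-st coefficient of the bias expansion of the non-debiased Mondrian random forest estimator (a real number determined by the derivatives of f and μ at x up to order 2J+2, not depending on n, λ or B), E[μ̂_d(x) | X, T] = μ(x) + 1{2J + 2 < β} · ω̄ B_{J+1}(x)/λ^{2J+2} + O_P(λ^{−2J−4} + λ^{−β} + λ^{−1} B^{−1/2} + (log n/λ) √(λ^d/n)). -/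
open MeasureTheory ProbabilityTheory Filter
open scoped ENNReal NNReal Topology Classical

noncomputable section

/-- A standard Exponential(1) random variable: `P(E > t) = e^{-t}` for all `t ≥ 0`. -/
def IsExpOne {Ω : Type*} [MeasurableSpace Ω] (P : Measure Ω) (E : Ω → ℝ) : Prop :=
  Measurable E ∧ ∀ t : ℝ, 0 ≤ t → P {ω | t < E ω} = ENNReal.ofReal (Real.exp (-t))

/-- The closed unit box `[0,1]^d`. -/
def unitBox (d : ℕ) : Set (Fin d → ℝ) := Set.univ.pi fun _ => Set.Icc (0 : ℝ) 1

/-- Euclidean (ℓ²) distance on `Fin d → ℝ`. -/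
def l2dist {d : ℕ} (x y : Fin d → ℝ) : ℝ := Real.sqrt (∑ j, (x j - y j) ^ 2)

/-- The largest integer strictly smaller than `β` (for `β > 0`). -/
def flbeta (β : ℝ) : ℕ := ⌈β⌉₊ - 1

/-- `g` is `β`-Hölder on the unit box: it is `⌊β⌋` times differentiable there and its
`⌊β⌋`-th derivative is `(β − ⌊β⌋)`-Hölder. -/
def IsHolderOn {d : ℕ} (β : ℝ) (g : (Fin d → ℝ) → ℝ) : Prop :=
  ContDiffOn ℝ (flbeta β) g (unitBox d) ∧
    ∃ C > (0 : ℝ), ∀ x ∈ unitBox d, ∀ x' ∈ unitBox d,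
      ‖iteratedFDerivWithin ℝ (flbeta β) g (unitBox d) x
          - iteratedFDerivWithin ℝ (flbeta β) g (unitBox d) x'‖
        ≤ C * l2dist x x' ^ (β - (flbeta β : ℝ))

/-- `z` lies in the Mondrian cell at `x` with lifetime `lam` generated by the lower
exponentials `lo` and the upper exponentials `hi`, namely in the box
`∏_j [x_j - (lo_j/lam) ⊓ x_j, x_j + (hi_j/lam) ⊓ (1 - x_j)]`. -/
def inMondrianCell {d : ℕ} (x : Fin d → ℝ) (lam : ℝ) (lo hi : Fin d → ℝ)
    (z : Fin d → ℝ) : Prop :=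
  ∀ j, x j - min (lo j / lam) (x j) ≤ z j ∧ z j ≤ x j + min (hi j / lam) (1 - x j)

/-- Indicator `1{X_i ∈ T_b(x)}` as a real number. -/
def mInd {Ω : Type*} {d : ℕ} (x : Fin d → ℝ) (lam : ℝ)
    (Elo Ehi : ℕ → Ω → Fin d → ℝ) (X : ℕ → Ω → Fin d → ℝ) (b i : ℕ) (ω : Ω) : ℝ :=
  if inMondrianCell x lam (Elo b ω) (Ehi b ω) (X i ω) then 1 else 0

/-- `N_b(x)`: the number of the first `n` data points lying in the cell `T_b(x)`. -/
def mN {Ω : Type*} {d : ℕ} (x : Fin d → ℝ) (lam : ℝ)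
    (Elo Ehi : ℕ → Ω → Fin d → ℝ) (X : ℕ → Ω → Fin d → ℝ) (n b : ℕ) (ω : Ω) : ℝ :=
  ∑ i ∈ Finset.range n, mInd x lam Elo Ehi X b i ω

/-- The Mondrian random forest estimator at `x` with `B` trees of lifetime `lam`, whose cells
at `x` are generated by the exponentials `Elo`, `Ehi`, fitted on the data `(X_i, Y_i)`, `i < n`
(with the convention `0/0 = 0`). -/
def forestEst {Ω : Type*} {d : ℕ} (x : Fin d → ℝ) (lam : ℝ) (n B : ℕ)
    (X : ℕ → Ω → Fin d → ℝ) (Y : ℕ → Ω → ℝ) (Elo Ehi : ℕ → Ω → Fin d → ℝ) (ω : Ω) : ℝ :=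
  (B : ℝ)⁻¹ * ∑ b ∈ Finset.range B,
    (∑ i ∈ Finset.range n, Y i ω * mInd x lam Elo Ehi X b i ω) / mN x lam Elo Ehi X n b ω

/-- `Z_n = O_P(r_n)`: for every `ε > 0` there is `M > 0` with `P(|Z_n| > M r_n) ≤ ε`
for all sufficiently large `n`. -/
def BigOP {Ω : Type*} [MeasurableSpace Ω] (P : Measure Ω) (Z : ℕ → Ω → ℝ) (r : ℕ → ℝ) : Prop :=
  ∀ ε : ℝ, 0 < ε → ∃ M : ℝ, 0 < M ∧ ∀ᶠ n in atTop, (P {ω | M * r n < |Z n ω|}).toReal ≤ ε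

lemma lt_iff_flbeta (β : ℝ) (J : ℕ) : 2 * (J : ℝ) + 2 < β ↔ J + 1 ∈ Finset.Icc 1 (flbeta β / 2) := by
  have h : 2 * (J : ℝ) + 2 < β ↔ 2 * J + 2 < ⌈β⌉₊ := by
    rw [Nat.lt_ceil]; push_cast; rfl
  rw [h, Finset.mem_Icc]
  unfold flbeta
  omega

lemma bigOP_combine {Ω : Type*} [MeasurableSpace Ω] (P : Measure Ω) [IsProbabilityMeasure P]
    (k : ℕ) (Z : ℕ → Ω → ℝ) (ρ : ℕ → ℝ) (D : Fin (k + 1) → ℕ → Ω → ℝ)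
    (ρr : Fin (k + 1) → ℕ → ℝ) (w C : Fin (k + 1) → ℝ) (R : ℕ → ℝ) (K : ℝ) (hK : 0 ≤ K)
    (hC : ∀ r, 0 ≤ C r)
    (hZ : ∀ n ω, Z n ω = ∑ r, w r * D r n ω + R n)
    (hR : ∀ᶠ n in atTop, |R n| ≤ K * ρ n)
    (hρ0 : ∀ᶠ n in atTop, 0 ≤ ρ n)
    (hρ : ∀ r, ∀ᶠ n in atTop, ρr r n ≤ C r * ρ n)
    (hD : ∀ r, BigOP P (D r) (ρr r)) : BigOP P Z ρ := by
  intro ε hε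
  have hk : (0 : ℝ) < (k : ℝ) + 1 := by positivity
  choose M hM0 hM using fun r => hD r (ε / (k + 1)) (by positivity)
  refine ⟨∑ r, |w r| * (M r * C r) + K + 1, ?_, ?_⟩
  · have : 0 ≤ ∑ r, |w r| * (M r * C r) := Finset.sum_nonneg fun r _ =>
      mul_nonneg (abs_nonneg _) (mul_nonneg (hM0 r).le (hC r))
    linarith
  · filter_upwards [hR, hρ0, eventually_all.2 hρ, eventually_all.2 hM] with n h1 h2 h3 h4
    have hsub : {ω | (∑ r, |w r| * (M r * C r) + K + 1) * ρ n < |Z n ω|}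
        ⊆ ⋃ r, {ω | M r * ρr r n < |D r n ω|} := by
      intro ω hω
      by_contra hcon
      simp only [Set.mem_iUnion, Set.mem_setOf_eq, not_exists, not_lt] at hcon hω
      have hb : |Z n ω| ≤ ∑ r, |w r| * (M r * C r) * ρ n + K * ρ n := by
        rw [hZ]
        refine (abs_add_le _ _).trans (add_le_add ?_ h1)
        refine (Finset.abs_sum_le_sum_abs _ _).trans (Finset.sum_le_sum fun r _ => ?_)
        rw [abs_mul, mul_assoc, mul_assoc]
        refine mul_le_mul_of_nonneg_left ((hcon r).trans ?_) (abs_nonneg _)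
        exact mul_le_mul_of_nonneg_left (h3 r) (hM0 r).le
      rw [← Finset.sum_mul] at hb
      nlinarith
    calc (P {ω | (∑ r, |w r| * (M r * C r) + K + 1) * ρ n < |Z n ω|}).toReal
        ≤ P.real (⋃ r, {ω | M r * ρr r n < |D r n ω|}) := measureReal_mono hsub
      _ ≤ ∑ r, P.real {ω | M r * ρr r n < |D r n ω|} := measureReal_iUnion_fintype_le _
      _ ≤ ∑ _r : Fin (k + 1), ε / (k + 1) := Finset.sum_le_sum fun r _ => h4 r
      _ = ε := by simp; field_simp

lemma rate_le (a l β b n : ℝ) (d : ℕ) (T : ℝ) (ha : 0 < a) (hl : 0 < l) (hT : 0 ≤ T)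
    (hn : 0 ≤ Real.log n) :
    (a * l) ^ (-β) + 1 / (a * l * Real.sqrt b)
        + Real.log n / (a * l) * Real.sqrt ((a * l) ^ d / n)
      ≤ (a ^ (-β) + a⁻¹ + a⁻¹ * Real.sqrt (a ^ d)) *
        (T + l ^ (-β) + 1 / (l * Real.sqrt b) + Real.log n / l * Real.sqrt (l ^ d / n)) := by
  have e1 : (a * l) ^ (-β) = a ^ (-β) * l ^ (-β) := Real.mul_rpow ha.le hl.le
  have e2 : 1 / (a * l * Real.sqrt b) = a⁻¹ * (1 / (l * Real.sqrt b)) := by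
    rw [mul_assoc, one_div, mul_inv, one_div]
  have e3 : Real.log n / (a * l) * Real.sqrt ((a * l) ^ d / n)
      = (a⁻¹ * Real.sqrt (a ^ d)) * (Real.log n / l * Real.sqrt (l ^ d / n)) := by
    rw [mul_pow, mul_div_assoc, Real.sqrt_mul (by positivity)]
    field_simp
  rw [e1, e2, e3]
  have p1 : 0 ≤ a ^ (-β) := by positivity
  have p2 : 0 ≤ a⁻¹ := by positivity
  have p3 : 0 ≤ a⁻¹ * Real.sqrt (a ^ d) := by positivity
  have q1 : 0 ≤ l ^ (-β) := by positivity
  have q2 : 0 ≤ 1 / (l * Real.sqrt b) := by positivity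
  have q3 : 0 ≤ Real.log n / l * Real.sqrt (l ^ d / n) := by positivity
  generalize a ^ (-β) = u1 at *
  generalize a⁻¹ * Real.sqrt (a ^ d) = u3 at *
  generalize a⁻¹ = u2 at *
  generalize l ^ (-β) = v1 at *
  generalize 1 / (l * Real.sqrt b) = v2 at *
  generalize Real.log n / l * Real.sqrt (l ^ d / n) = v3 at *
  have : (u1 + u2 + u3) * (T + v1 + v2 + v3) - (u1 * v1 + u2 * v2 + u3 * v3)
    = (u1 + u2 + u3) * T + u1 * (v2 + v3) + u2 * (v1 + v3) + u3 * (v1 + v2) := by ring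
  have : 0 ≤ (u1 + u2 + u3) * T + u1 * (v2 + v3) + u2 * (v1 + v3) + u3 * (v1 + v2) := by
    positivity
  linarith

lemma remainder_bound (J m : ℕ) (a w : Fin (J + 1) → ℝ) (Bc : ℕ → ℝ)
    (hw2 : ∀ s : ℕ, 1 ≤ s → s ≤ J → ∑ r, w r / a r ^ (2 * s) = 0)
    (l : ℝ) (hl : 1 ≤ l) :
    |∑ r, w r * (∑ s ∈ Finset.Icc 1 m, Bc s / (a r * l) ^ (2 * s))
      - (if J + 1 ∈ Finset.Icc 1 m then
          (∑ r, w r / a r ^ (2 * J + 2)) * Bc (J + 1) / l ^ (2 * J + 2) else 0)|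
    ≤ (∑ s ∈ Finset.Icc 1 m, |(∑ r, w r / a r ^ (2 * s)) * Bc s|) * (l ^ (2 * J + 4))⁻¹ := by
  have e1 : ∑ r, w r * (∑ s ∈ Finset.Icc 1 m, Bc s / (a r * l) ^ (2 * s))
      = ∑ s ∈ Finset.Icc 1 m, (∑ r, w r / a r ^ (2 * s)) * Bc s / l ^ (2 * s) := by
    simp_rw [Finset.mul_sum]
    rw [Finset.sum_comm]
    refine Finset.sum_congr rfl fun s _ => ?_
    rw [Finset.sum_mul, Finset.sum_div]
    refine Finset.sum_congr rfl fun r _ => ?_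
    rw [mul_pow, div_mul_eq_mul_div, div_div, mul_div_assoc]
  have e2 : (if J + 1 ∈ Finset.Icc 1 m then
          (∑ r, w r / a r ^ (2 * J + 2)) * Bc (J + 1) / l ^ (2 * J + 2) else 0)
      = ∑ s ∈ Finset.Icc 1 m,
        if J + 1 = s then (∑ r, w r / a r ^ (2 * s)) * Bc s / l ^ (2 * s) else 0 := by
    rw [Finset.sum_ite_eq]
    rfl
  rw [e1, e2, ← Finset.sum_sub_distrib, Finset.sum_mul]
  refine (Finset.abs_sum_le_sum_abs _ _).trans (Finset.sum_le_sum fun s hs => ?_)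
  have hs1 := (Finset.mem_Icc.1 hs).1
  have hl0 : 0 < l := by linarith
  split_ifs with h
  · rw [sub_self, abs_zero]; positivity
  · rw [sub_zero]
    by_cases hsJ : s ≤ J
    · rw [hw2 s hs1 hsJ]; simp
    · rw [abs_div, div_eq_mul_inv, abs_of_pos (pow_pos hl0 (2 * s))]
      gcongr
      omega

/-- Theorem 6: bias of the debiased Mondrian random forest estimator.
With `Bc` the coefficients of the bias expansion of the non-debiased Mondrian random forest
estimator (hypothesis `hBc`) and `ω̄ = ∑_r ω_r a_r^{−2J−2}`, the centering of the debiased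
estimator is `μ(x) + 1{2J+2<β} ω̄ B_{J+1}(x)/λ^{2J+2}` up to an
`O_P(λ^{−2J−4} + λ^{−β} + λ^{−1}B^{−1/2} + (log n/λ)√(λ^d/n))` remainder. -/
theorem mondrian_forest_bias_debiased
    {Ω : Type*} [MeasurableSpace Ω] (P : Measure Ω) [IsProbabilityMeasure P]
    (d : ℕ) (hd : 1 ≤ d) (β : ℝ) (hβ : 1 ≤ β)
    -- Assumption 1: the data
    (X : ℕ → Ω → Fin d → ℝ) (Y : ℕ → Ω → ℝ)
    (hXm : ∀ i, Measurable (X i)) (hYm : ∀ i, Measurable (Y i))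
    (hiid : iIndepFun (fun i ω => (X i ω, Y i ω)) P)
    (hident : ∀ i, Measure.map (fun ω => (X i ω, Y i ω)) P
      = Measure.map (fun ω => (X 0 ω, Y 0 ω)) P)
    (f : (Fin d → ℝ) → ℝ)
    (hXd : ∀ i, Measure.map (X i) P = volume.withDensity fun z => ENNReal.ofReal (f z))
    (hf_pos : ∃ c > (0:ℝ), ∀ z ∈ unitBox d, c ≤ f z)
    (hf_supp : ∀ z, z ∉ unitBox d → f z = 0)
    (hf_hol : IsHolderOn β f)
    (μreg : (Fin d → ℝ) → ℝ)
    (hμ : ∀ i, P[Y i|MeasurableSpace.comap (X i) inferInstance]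
      =ᵐ[P] fun ω => μreg (X i ω))
    (hμ_hol : IsHolderOn β μreg)
    (hY2 : ∃ M : ℝ, ∀ i, ∀ᵐ ω ∂P,
      (P[fun ω' => (Y i ω') ^ 2|MeasurableSpace.comap (X i) inferInstance]) ω ≤ M)
    (σ2 : (Fin d → ℝ) → ℝ)
    (hσ : ∀ i, P[fun ω' => (Y i ω' - μreg (X i ω')) ^ 2|MeasurableSpace.comap (X i) inferInstance]
      =ᵐ[P] fun ω => σ2 (X i ω))
    (hσ_lip : ∃ L : ℝ, ∀ z ∈ unitBox d, ∀ z' ∈ unitBox d, |σ2 z - σ2 z'| ≤ L * l2dist z z')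
    (hσ_pos : ∃ c > (0:ℝ), ∀ z ∈ unitBox d, c ≤ σ2 z)
    -- Assumption 2: the design point, the lifetimes and the forest sizes
    (x : Fin d → ℝ) (hx : ∀ j, x j ∈ Set.Ioo (0:ℝ) 1)
    (lam : ℕ → ℝ) (hlam_pos : ∀ n, 0 < lam n)
    (hlam1 : Tendsto (fun n : ℕ => lam n ^ d / n) atTop (𝓝 0))
    (hlam2 : ∃ c₁ > (0:ℝ), ∃ c₂ > (0:ℝ), ∀ᶠ n : ℕ in atTop,
      c₁ * Real.log n ≤ Real.log (lam n) ∧ Real.log (lam n) ≤ c₂ * Real.log n)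
    (Bn : ℕ → ℕ)
    (hBn : ∃ ξ ∈ Set.Ioo (0:ℝ) 1, ∃ c₁ > (0:ℝ), ∃ c₂ > (0:ℝ), ∀ᶠ n : ℕ in atTop,
      c₁ * (n : ℝ) ^ ξ ≤ (Bn n : ℝ) ∧ (Bn n : ℝ) ≤ c₂ * (n : ℝ) ^ ξ)
    -- the debiasing parameters: distinct positive scales a_r and weights ω_r solving the
    -- debiasing linear system
    (J : ℕ) (a : Fin (J + 1) → ℝ) (ha_pos : ∀ r, 0 < a r) (ha_inj : Function.Injective a)
    (w : Fin (J + 1) → ℝ) (hw1 : ∑ r, w r = 1)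
    (hw2 : ∀ s : ℕ, 1 ≤ s → s ≤ J → ∑ r, w r / a r ^ (2 * s) = 0)
    -- the J+1 mutually independent forests: for each sample size n and each 0 ≤ r ≤ J,
    -- i.i.d. Mondrian cells at x with lifetime a_r * lam n, independent of the data
    (Elo Ehi : ℕ → Fin (J + 1) → ℕ → Ω → Fin d → ℝ)
    (hexp : ∀ n r b j, IsExpOne P (fun ω => Elo n r b ω j) ∧
      IsExpOne P (fun ω => Ehi n r b ω j))
    (hindepE : ∀ n, iIndepFun
      (fun p : Fin (J + 1) × ℕ × Fin d × Bool => fun ω =>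
        if p.2.2.2 then Ehi n p.1 p.2.1 ω p.2.2.1 else Elo n p.1 p.2.1 ω p.2.2.1) P)
    (hindepXT : ∀ n, IndepFun
      (fun ω => fun p : Fin (J + 1) × ℕ × Fin d × Bool =>
        if p.2.2.2 then Ehi n p.1 p.2.1 ω p.2.2.1 else Elo n p.1 p.2.1 ω p.2.2.1)
      (fun ω => fun i : ℕ => (X i ω, Y i ω)) P)

    -- the coefficients of the bias expansion of the non-debiased estimator
    (Bc : ℕ → ℝ)
    (hBc : ∀ r : Fin (J + 1), BigOP P
      (fun n ω => forestEst x (a r * lam n) n (Bn n) X (fun i ω' => μreg (X i ω'))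
          (Elo n r) (Ehi n r) ω
        - μreg x - ∑ s ∈ Finset.Icc 1 (flbeta β / 2), Bc s / (a r * lam n) ^ (2 * s))
      (fun n => (a r * lam n) ^ (-β) + 1 / (a r * lam n * Real.sqrt (Bn n))
        + Real.log n / (a r * lam n) * Real.sqrt ((a r * lam n) ^ d / n))) :
    BigOP P
      (fun n ω =>
        (∑ r, w r * forestEst x (a r * lam n) n (Bn n) X (fun i ω' => μreg (X i ω'))
            (Elo n r) (Ehi n r) ω)
          - μreg x
          - (if 2 * (J : ℝ) + 2 < β then
              (∑ r, w r / a r ^ (2 * J + 2)) * Bc (J + 1) / lam n ^ (2 * J + 2) else 0))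
      (fun n => (lam n ^ (2 * J + 4))⁻¹ + lam n ^ (-β) + 1 / (lam n * Real.sqrt (Bn n))
        + Real.log n / lam n * Real.sqrt (lam n ^ d / n)) := by
  have hlam_ge : ∀ᶠ n : ℕ in atTop, 1 ≤ lam n := by
    obtain ⟨c₁, hc₁, c₂, -, h⟩ := hlam2
    filter_upwards [h, eventually_ge_atTop 1] with n hn hn1
    have h0 : 0 ≤ Real.log n := Real.log_nonneg (by exact_mod_cast hn1)
    have h1 : 0 ≤ Real.log (lam n) := (mul_nonneg hc₁.le h0).trans hn.1
    exact (Real.log_nonneg_iff (hlam_pos n)).1 h1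
  have hrate : ∀ n : ℕ, 0 ≤ lam n ^ (-β) + 1 / (lam n * Real.sqrt (Bn n))
        + Real.log n / lam n * Real.sqrt (lam n ^ d / n) := by
    intro n
    have := hlam_pos n
    have := Real.log_natCast_nonneg n
    positivity
  refine bigOP_combine P J _ _ _ _ w
    (fun r => a r ^ (-β) + (a r)⁻¹ + (a r)⁻¹ * Real.sqrt (a r ^ d))
    (fun n => ∑ r, w r * (∑ s ∈ Finset.Icc 1 (flbeta β / 2), Bc s / (a r * lam n) ^ (2 * s))
      - (if J + 1 ∈ Finset.Icc 1 (flbeta β / 2) then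
          (∑ r, w r / a r ^ (2 * J + 2)) * Bc (J + 1) / lam n ^ (2 * J + 2) else 0))
    (∑ s ∈ Finset.Icc 1 (flbeta β / 2), |(∑ r, w r / a r ^ (2 * s)) * Bc s|)
    (Finset.sum_nonneg fun _ _ => abs_nonneg _) ?_ ?_ ?_ ?_ ?_ hBc
  · intro r
    have := ha_pos r
    positivity
  · intro n ω
    simp only [← lt_iff_flbeta, mul_sub, Finset.sum_sub_distrib, ← Finset.sum_mul, hw1]
    ring
  · filter_upwards [hlam_ge] with n hn
    refine (remainder_bound J _ a w Bc hw2 (lam n) hn).trans ?_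
    refine mul_le_mul_of_nonneg_left ?_ (Finset.sum_nonneg fun _ _ => abs_nonneg _)
    linarith [hrate n]
  · refine Eventually.of_forall fun n => ?_
    have h1 := hrate n
    have h2 : 0 ≤ (lam n ^ (2 * J + 4))⁻¹ := by have := hlam_pos n; positivity
    linarith
  · intro r
    refine Eventually.of_forall fun n => ?_
    exact rate_le (a r) (lam n) β (Bn n) n d _ (ha_pos r) (hlam_pos n)
      (by have := hlam_pos n; positivity) (Real.log_natCast_nonneg n)
end
end

section
/- Suppose Assumptions 1 and 2 hold, J ≥ ⌊⌊β⌋/2⌋, λ_n ≍ n^{1/(d+2β)}, and B_n ≥ c n^{(2β−2)/(d+2β)} for some c > 0. Then there exists C > 0 such that for all sufficiently large n, E[(μ̂_d(x) − μ(x))²]^{1/2} ≤ C n^{−β/(d+2β)}; that is, the debiased Mondrian random forest estimator attains the minimax-optimal pointwise rate of convergence for β-Hölder regression functions in dimension d. -/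
open MeasureTheory ProbabilityTheory Filter
open scoped ENNReal NNReal Topology Classical

noncomputable section

/-- Coefficients of the quotient of two formal power series. -/
def qs (α b : ℕ → ℝ) : ℕ → ℝ
  | k => (α k - ∑ j : Fin k, qs α b j.1 * b (k - j.1)) / b 0
decreasing_by exact j.2

lemma qs_eq (α b : ℕ → ℝ) (k : ℕ) :
    qs α b k = (α k - ∑ j ∈ Finset.range k, qs α b j * b (k - j)) / b 0 := by
  rw [qs, Finset.sum_range]

lemma qs_scale (α b : ℕ → ℝ) (ρ : ℝ) (k : ℕ) :
    qs (fun k => ρ ^ k * α k) (fun k => ρ ^ k * b k) k = ρ ^ k * qs α b k := by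
  induction k using Nat.strong_induction_on with
  | _ k ih =>
    rw [qs_eq, qs_eq α b k]
    have : ∑ j ∈ Finset.range k, qs (fun k => ρ ^ k * α k) (fun k => ρ ^ k * b k) j
        * (ρ ^ (k - j) * b (k - j)) = ρ ^ k * ∑ j ∈ Finset.range k, qs α b j * b (k - j) := by
      rw [Finset.mul_sum]
      refine Finset.sum_congr rfl fun j hj => ?_
      have hj' := Finset.mem_range.1 hj
      rw [ih j hj']
      have : ρ ^ k = ρ ^ j * ρ ^ (k - j) := by rw [← pow_add]; congr 1; omega
      rw [this]; ring
    rw [this]; simp only [pow_zero, one_mul]; ring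

lemma qs_conv (α b : ℕ → ℝ) (hb : b 0 ≠ 0) (k : ℕ) :
    ∑ j ∈ Finset.range (k + 1), qs α b j * b (k - j) = α k := by
  rw [Finset.sum_range_succ, qs_eq α b k]
  simp only [Nat.sub_self]
  field_simp
  ring

lemma qs_bound (C c0 : ℝ) (hC : 0 < C) (hc0 : 0 < c0) (l : ℕ) : ∃ K > (0:ℝ), ∀ (α b : ℕ → ℝ) (t : ℝ),
    0 ≤ t → (∀ k ≤ l, |α k| ≤ C * t ^ k) → (∀ k ≤ l, |b k| ≤ C * t ^ k) → c0 ≤ b 0 →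
    ∀ k ≤ l, |qs α b k| ≤ K * t ^ k := by
  induction l with
  | zero =>
    refine ⟨C / c0, by positivity, fun α b t ht hα hb h0 k hk => ?_⟩
    obtain rfl : k = 0 := by omega
    rw [qs_eq]
    have := hα 0 le_rfl
    simp only [Finset.range_zero, Finset.sum_empty, sub_zero, pow_zero, mul_one] at *
    rw [abs_div, abs_of_pos (hc0.trans_le h0)]
    gcongr
  | succ l ih =>
    obtain ⟨K, hK, ih⟩ := ih
    refine ⟨K + (C + (l + 1) * (K * C)) / c0, by positivity, fun α b t ht hα hb h0 k hk => ?_⟩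
    have ih' := ih α b t ht (fun k hk => hα k (by omega)) (fun k hk => hb k (by omega)) h0
    have hpos : 0 ≤ (C + (l + 1) * (K * C)) / c0 := by positivity
    rcases Nat.lt_or_ge l k with h | h
    · obtain rfl : k = l + 1 := by omega
      rw [qs_eq, abs_div, abs_of_pos (hc0.trans_le h0)]
      have h1 : |∑ j ∈ Finset.range (l + 1), qs α b j * b (l + 1 - j)|
          ≤ (l + 1) * (K * C) * t ^ (l + 1) := by
        refine (Finset.abs_sum_le_sum_abs _ _).trans ?_
        refine (Finset.sum_le_card_nsmul _ _ (K * C * t ^ (l + 1)) fun j hj => ?_).trans ?_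
        · have hj' := Finset.mem_range.1 hj
          rw [abs_mul]
          calc |qs α b j| * |b (l + 1 - j)| ≤ (K * t ^ j) * (C * t ^ (l + 1 - j)) := by
                gcongr
                · exact ih' j (by omega)
                · exact hb _ (by omega)
            _ = K * C * (t ^ j * t ^ (l + 1 - j)) := by ring
            _ = K * C * t ^ (l + 1) := by rw [← pow_add]; congr 2; omega
        · simp; ring_nf; rfl
      have h2 : |α (l + 1) - ∑ j ∈ Finset.range (l + 1), qs α b j * b (l + 1 - j)|
          ≤ (C + (l + 1) * (K * C)) * t ^ (l + 1) := by
        refine (abs_sub _ _).trans ?_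
        have := hα (l + 1) le_rfl
        nlinarith
      calc _ ≤ (C + (l + 1) * (K * C)) * t ^ (l + 1) / c0 := by gcongr
        _ = (C + (l + 1) * (K * C)) / c0 * t ^ (l + 1) := by ring
        _ ≤ _ := by gcongr; linarith
    · refine (ih' k h).trans ?_
      gcongr; linarith

lemma trunc_prod (C : ℝ) (α b : ℕ → ℝ) (l : ℕ) (t : ℝ) (ht : 0 ≤ t) (ht1 : t ≤ 1) (hC : 0 < C)
    (hα : ∀ k ≤ l, |α k| ≤ C * t ^ k) (hb : ∀ k ≤ l, |b k| ≤ C * t ^ k) :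
    |(∑ k ∈ Finset.range (l + 1), α k) * (∑ k ∈ Finset.range (l + 1), b k)
      - ∑ k ∈ Finset.range (l + 1), ∑ j ∈ Finset.range (k + 1), α j * b (k - j)|
      ≤ (l + 1) * ((l + 1) * (C * C * t ^ (l + 1))) := by
  rw [Finset.sum_range_diag_flip (l + 1) (fun j i => α j * b i), Finset.sum_mul,
    ← Finset.sum_sub_distrib]
  refine (Finset.abs_sum_le_sum_abs _ _).trans ?_
  refine (Finset.sum_le_card_nsmul _ _ ((l + 1) * (C * C * t ^ (l + 1))) fun j hj => ?_).trans ?_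
  swap
  · simp
  have hj' := Finset.mem_range.1 hj
  rw [Finset.mul_sum, ← Finset.sum_sdiff_eq_sub (Finset.range_mono (by omega))]
  refine (Finset.abs_sum_le_sum_abs _ _).trans ?_
  refine (Finset.sum_le_card_nsmul _ _ (C * C * t ^ (l + 1)) fun i hi => ?_).trans ?_
  · simp only [Finset.mem_sdiff, Finset.mem_range, not_lt] at hi
    rw [abs_mul]
    calc |α j| * |b i| ≤ (C * t ^ j) * (C * t ^ i) := by
          gcongr
          · exact hα j (by omega)
          · exact hb i (by omega)
      _ = C * C * t ^ (i + j) := by ring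
      _ ≤ C * C * t ^ (l + 1) := by
          gcongr C * C * ?_
          exact pow_le_pow_of_le_one ht ht1 (by omega)
  · rw [nsmul_eq_mul]
    gcongr
    have : (Finset.range (l + 1) \ Finset.range (l + 1 - j)).card ≤ l + 1 := by
      refine (Finset.card_le_card Finset.sdiff_subset).trans (by simp)
    exact_mod_cast this

lemma sum_bound (C : ℝ) (α : ℕ → ℝ) (l : ℕ) (t : ℝ) (ht : 0 ≤ t) (ht1 : t ≤ 1) (hC : 0 < C)
    (hα : ∀ k ≤ l, |α k| ≤ C * t ^ k) :
    |∑ k ∈ Finset.range (l + 1), α k| ≤ (l + 1) * C := by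
  refine (Finset.abs_sum_le_sum_abs _ _).trans ?_
  refine (Finset.sum_le_card_nsmul _ _ C fun j hj => ?_).trans ?_
  · have hj' := Finset.mem_range.1 hj
    refine (hα j (by omega)).trans ?_
    have := pow_le_one₀ ht ht1 (n := j)
    nlinarith
  · simp

lemma prod_expansion (C : ℝ) (hC : 0 < C) (l : ℕ) (β : ℝ) (hβ0 : 0 < β) (hβ : β ≤ l + 1) :
    ∃ K > (0:ℝ), ∀ (u v : ℝ) (α b : ℕ → ℝ) (t : ℝ), 0 ≤ t → t ≤ 1 →
      (∀ k ≤ l, |α k| ≤ C * t ^ k) → (∀ k ≤ l, |b k| ≤ C * t ^ k) →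
      |u - ∑ k ∈ Finset.range (l + 1), α k| ≤ C * t ^ β →
      |v - ∑ k ∈ Finset.range (l + 1), b k| ≤ C * t ^ β →
      |u * v - ∑ k ∈ Finset.range (l + 1), ∑ j ∈ Finset.range (k + 1), α j * b (k - j)|
        ≤ K * t ^ β := by
  refine ⟨C * ((l + 1) * C + C) + (l + 1) * C * C + (l + 1) * ((l + 1) * (C * C)), by positivity, ?_⟩
  intro u v α b t ht ht1 hα hb hu hv
  set A := ∑ k ∈ Finset.range (l + 1), α k
  set Bs := ∑ k ∈ Finset.range (l + 1), b k
  have h1 := trunc_prod C α b l t ht ht1 hC hα hb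
  have hA : |A| ≤ (l + 1) * C := sum_bound C α l t ht ht1 hC hα
  have hB : |Bs| ≤ (l + 1) * C := sum_bound C b l t ht ht1 hC hb
  have htβ : t ^ β ≤ 1 := Real.rpow_le_one ht ht1 hβ0.le
  have htβ0 : 0 ≤ t ^ β := Real.rpow_nonneg ht _
  have hp : t ^ (l + 1) ≤ t ^ β := by
    rcases ht.eq_or_lt with h | h
    · rw [← h, Real.zero_rpow hβ0.ne']; simp
    · rw [← Real.rpow_natCast]
      exact Real.rpow_le_rpow_of_exponent_ge h ht1 (by push_cast; exact hβ)
  have hvb : |v| ≤ (l + 1) * C + C := by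
    have : v = Bs + (v - Bs) := by ring
    rw [this]
    refine (abs_add_le _ _).trans (add_le_add hB (hv.trans ?_))
    nlinarith
  set S := ∑ k ∈ Finset.range (l + 1), ∑ j ∈ Finset.range (k + 1), α j * b (k - j)
  have e : u * v - S = (u - A) * v + A * (v - Bs) + (A * Bs - S) := by ring
  rw [e]
  refine (abs_add_le _ _).trans ?_
  refine (add_le_add (abs_add_le _ _) h1).trans ?_
  rw [abs_mul, abs_mul]
  have i1 : |u - A| * |v| ≤ (C * t ^ β) * ((l + 1) * C + C) := by gcongr
  have i2 : |A| * |v - Bs| ≤ ((l + 1) * C) * (C * t ^ β) := by gcongr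
  have i3 : (l + 1) * ((l + 1) * (C * C * t ^ (l + 1))) ≤ ((l:ℝ) + 1) * ((l + 1) * (C * C * t ^ β)) := by
    gcongr
  linarith

lemma quot_expansion (C c0 : ℝ) (hC : 0 < C) (hc0 : 0 < c0) (l : ℕ) (β : ℝ) (hβ0 : 0 < β)
    (hβ : β ≤ l + 1) :
    ∃ K > (0:ℝ), ∀ (u v : ℝ) (α b : ℕ → ℝ) (t : ℝ), 0 ≤ t → t ≤ 1 →
      (∀ k ≤ l, |α k| ≤ C * t ^ k) → (∀ k ≤ l, |b k| ≤ C * t ^ k) → c0 ≤ b 0 → c0 ≤ v →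
      |u - ∑ k ∈ Finset.range (l + 1), α k| ≤ C * t ^ β →
      |v - ∑ k ∈ Finset.range (l + 1), b k| ≤ C * t ^ β →
      (∀ k ≤ l, |qs α b k| ≤ K * t ^ k) ∧
      |u / v - ∑ k ∈ Finset.range (l + 1), qs α b k| ≤ K * t ^ β := by
  obtain ⟨K1, hK1, h1⟩ := qs_bound C c0 hC hc0 l
  obtain ⟨K2, hK2, h2⟩ := prod_expansion (max C K1) (by positivity) l β hβ0 hβ
  refine ⟨K1 + (C + K2) / c0, by positivity, ?_⟩
  intro u v α b t ht ht1 hα hb hb0 hv hu hvb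
  have hq := h1 α b t ht hα hb hb0
  have hdiv : 0 ≤ (C + K2) / c0 := by positivity
  have htβ0 : 0 ≤ t ^ β := Real.rpow_nonneg ht _
  refine ⟨fun k hk => (hq k hk).trans (by gcongr; linarith), ?_⟩
  set Q := ∑ k ∈ Finset.range (l + 1), qs α b k with hQ
  have h3 := h2 Q v (qs α b) b t ht ht1
    (fun k hk => (hq k hk).trans (by gcongr; exact le_max_right _ _))
    (fun k hk => (hb k hk).trans (by gcongr; exact le_max_left _ _))
    (by rw [hQ, sub_self, abs_zero]; positivity)
    (hvb.trans (by gcongr; exact le_max_left _ _))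
  have e : ∑ k ∈ Finset.range (l + 1), ∑ j ∈ Finset.range (k + 1), qs α b j * b (k - j)
      = ∑ k ∈ Finset.range (l + 1), α k :=
    Finset.sum_congr rfl fun k _ => qs_conv α b (hc0.trans_le hb0).ne' k
  rw [e] at h3
  have hv0 : 0 < v := hc0.trans_le hv
  have e2 : u / v - Q = (u - Q * v) / v := by field_simp
  rw [e2, abs_div, abs_of_pos hv0]
  have i : |u - Q * v| ≤ (C + K2) * t ^ β := by
    have : u - Q * v = (u - ∑ k ∈ Finset.range (l + 1), α k)
      - (Q * v - ∑ k ∈ Finset.range (l + 1), α k) := by ring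
    rw [this]
    refine (abs_sub _ _).trans ?_
    linarith
  calc |u - Q * v| / v ≤ (C + K2) * t ^ β / c0 := by gcongr
    _ = (C + K2) / c0 * t ^ β := by ring
    _ ≤ _ := by gcongr; linarith


lemma taylor_exists {E : Type} [NormedAddCommGroup E] [NormedSpace ℝ E] (x : E) (δ C γ : ℝ)
    (hδ : 0 < δ) (hγ : 0 < γ) (hC : 0 < C) (l : ℕ) :
    ∀ (F : Type) [NormedAddCommGroup F] [NormedSpace ℝ F] (g : E → F),
    ContDiffOn ℝ l g (Metric.ball x δ) →
    (∀ y ∈ Metric.ball x δ, ∀ y' ∈ Metric.ball x δ,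
      ‖iteratedFDeriv ℝ l g y - iteratedFDeriv ℝ l g y'‖ ≤ C * ‖y - y'‖ ^ γ) →
    ∃ (q : ℕ → E → F) (K : ℝ), 0 < K ∧ (∀ k, Continuous (q k)) ∧
      (∀ k (c : ℝ) u, q k (c • u) = c ^ k • q k u) ∧ (∀ k u, ‖q k u‖ ≤ K * ‖u‖ ^ k) ∧
      (∀ u, q 0 u = g x) ∧
      ∀ u, ‖u‖ < δ → ‖g (x + u) - ∑ k ∈ Finset.range (l + 1), q k u‖ ≤ K * ‖u‖ ^ (l + γ) := by
  induction l with
  | zero =>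
    intro F _ _ g hg hh
    refine ⟨fun k _ => if k = 0 then g x else 0, ‖g x‖ + C, by positivity,
      fun k => continuous_const, ?_, ?_, by simp, ?_⟩
    · intro k c u
      by_cases h : k = 0 <;> simp [h]
    · intro k u
      by_cases h : k = 0
      · simp [h, hC.le]
      · simp only [h, if_false, norm_zero]; positivity
    · intro u hu
      have hxu : x + u ∈ Metric.ball x δ := by simpa using hu
      have h := hh (x + u) hxu x (Metric.mem_ball_self hδ)
      rw [iteratedFDeriv_zero_eq_comp] at h
      simp only [Function.comp_apply, ← map_sub, LinearIsometryEquiv.norm_map, add_sub_cancel_left] at h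
      simp only [zero_add, Finset.range_one, Finset.sum_singleton, if_true, Nat.cast_zero]
      refine h.trans ?_
      gcongr
      simp
  | succ l ih =>
    intro F _ _ g hg hh
    have hg' : ContDiffOn ℝ l (fderiv ℝ g) (Metric.ball x δ) :=
      hg.fderiv_of_isOpen Metric.isOpen_ball (by norm_cast)
    obtain ⟨q, K, hK, hqc, hqh, hqb, hq0, hqr⟩ := ih (E →L[ℝ] F) (fderiv ℝ g) hg' (by
      intro y hy y' hy'
      have h := hh y hy y' hy'
      rw [iteratedFDeriv_succ_eq_comp_right, iteratedFDeriv_succ_eq_comp_right] at h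
      have e := (continuousMultilinearCurryRightEquiv' ℝ l E F).symm.dist_map
        (iteratedFDeriv ℝ l (fderiv ℝ g) y) (iteratedFDeriv ℝ l (fderiv ℝ g) y')
      rw [dist_eq_norm, dist_eq_norm] at e
      rw [← e]
      exact h)
    let p : ℕ → E → F := fun k => Nat.rec (motive := fun _ => E → F) (fun _ => g x)
      (fun k _ u => ((k : ℝ) + 1)⁻¹ • (q k u) u) k
    have hp0 : ∀ u, p 0 u = g x := fun u => rfl
    have hps : ∀ k u, p (k + 1) u = ((k : ℝ) + 1)⁻¹ • (q k u) u := fun k u => rfl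
    refine ⟨p, ‖g x‖ + K, by positivity, ?_, ?_, ?_, hp0, ?_⟩
    · intro k
      cases k with
      | zero => exact continuous_const
      | succ k =>
        have : p (k + 1) = fun u => ((k : ℝ) + 1)⁻¹ • (q k u) u := rfl
        rw [this]
        exact continuous_const.smul ((hqc k).clm_apply continuous_id)
    · intro k c u
      cases k with
      | zero => simp [hp0]
      | succ k =>
        rw [hps, hps, hqh]
        simp only [smul_apply, map_smul, smul_smul]
        congr 1; ring
    · intro k u
      cases k with
      | zero => simp [hp0, hK.le]
      | succ k =>
        rw [hps, norm_smul]
        have h1 : ‖((k : ℝ) + 1)⁻¹‖ ≤ 1 := by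
          rw [norm_inv, Real.norm_of_nonneg (by positivity)]
          exact inv_le_one_of_one_le₀ (by linarith [(Nat.cast_nonneg k : (0:ℝ) ≤ k)])
        have h2 : ‖q k u u‖ ≤ K * ‖u‖ ^ (k + 1) := by
          refine ((q k u).le_opNorm u).trans ?_
          rw [pow_succ, ← mul_assoc]
          gcongr
          exact hqb k u
        calc _ ≤ 1 * (K * ‖u‖ ^ (k + 1)) := by gcongr
          _ ≤ _ := by rw [one_mul]; gcongr; linarith [norm_nonneg (g x)]
    · intro u hu
      have key : ‖(g (x + (1:ℝ) • u) - ∑ k ∈ Finset.range (l + 1), (1:ℝ) ^ (k + 1) • p (k + 1) u)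
          - (g (x + (0:ℝ) • u) - ∑ k ∈ Finset.range (l + 1), (0:ℝ) ^ (k + 1) • p (k + 1) u)‖
          ≤ K * ‖u‖ ^ ((l + 1 : ℝ) + γ) := by
        have hmem : ∀ t ∈ Set.Icc (0:ℝ) 1, x + t • u ∈ Metric.ball x δ := by
          intro t ht
          simp only [mem_ball_iff_norm, add_sub_cancel_left, norm_smul, Real.norm_of_nonneg ht.1]
          nlinarith [norm_nonneg u, ht.1, ht.2]
        refine norm_image_sub_le_of_norm_deriv_le_segment_01'
          (f := fun t : ℝ => g (x + t • u) - ∑ k ∈ Finset.range (l + 1), t ^ (k + 1) • p (k + 1) u)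
          (f' := fun t => (fderiv ℝ g (x + t • u)) u - ∑ k ∈ Finset.range (l + 1), t ^ k • (q k u) u)
          ?_ ?_
        · intro t ht
          apply HasDerivAt.hasDerivWithinAt
          apply HasDerivAt.sub
          · have hd : DifferentiableAt ℝ g (x + t • u) :=
              (hg.contDiffAt (Metric.isOpen_ball.mem_nhds (hmem t ht))).differentiableAt (by norm_cast)
            have hl : HasDerivAt (fun t : ℝ => x + t • u) u t := by
              simpa using ((hasDerivAt_id t).smul_const u).const_add x
            exact hd.hasFDerivAt.comp_hasDerivAt t hl
          · refine HasDerivAt.fun_sum fun k _ => ?_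
            have := (hasDerivAt_pow (k + 1) t).smul_const (p (k + 1) u)
            convert this using 1
            rw [hps, smul_smul]
            congr 1
            push_cast
            field_simp
        · intro t ht
          have ht' : t ∈ Set.Icc (0:ℝ) 1 := ⟨ht.1, ht.2.le⟩
          have htu : ‖t • u‖ ≤ ‖u‖ := by
            rw [norm_smul, Real.norm_of_nonneg ht.1]
            nlinarith [norm_nonneg u, ht.1, ht.2]
          have e : (fderiv ℝ g (x + t • u)) u - ∑ k ∈ Finset.range (l + 1), t ^ k • (q k u) u
              = (fderiv ℝ g (x + t • u) - ∑ k ∈ Finset.range (l + 1), q k (t • u)) u := by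
            simp [hqh]
          rw [e]
          refine (ContinuousLinearMap.le_opNorm _ _).trans ?_
          have h3 := hqr (t • u) (htu.trans_lt hu)
          rcases (norm_nonneg u).eq_or_lt with h0 | h0
          · rw [← h0]; simp only [mul_zero]; positivity
          calc _ ≤ (K * ‖t • u‖ ^ ((l:ℝ) + γ)) * ‖u‖ := by gcongr
            _ ≤ (K * ‖u‖ ^ ((l:ℝ) + γ)) * ‖u‖ := by gcongr
            _ = K * ‖u‖ ^ ((l + 1 : ℝ) + γ) := by
              rw [show (l + 1 : ℝ) + γ = ((l:ℝ) + γ) + 1 by ring, Real.rpow_add_one h0.ne']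
              ring
      simp only [one_smul, one_pow, zero_smul, add_zero, ne_eq, Nat.add_eq_zero_iff, one_ne_zero,
        and_false, not_false_eq_true, zero_pow, Finset.sum_const_zero, sub_zero] at key
      rw [Finset.sum_range_succ', hp0]
      have : g (x + u) - (∑ k ∈ Finset.range (l + 1), p (k + 1) u + g x)
        = g (x + u) - ∑ k ∈ Finset.range (l + 1), p (k + 1) u - g x := by abel
      rw [this]
      push_cast
      refine key.trans ?_
      gcongr
      linarith [norm_nonneg (g x)]

/-- a ball around an interior point contained in the box -/
lemma exists_delta {d : ℕ} (x : Fin d → ℝ) (hx : ∀ j, x j ∈ Set.Ioo (0:ℝ) 1) :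
    ∃ δ > (0:ℝ), δ ≤ 1 ∧ ∀ j, δ ≤ x j ∧ δ ≤ 1 - x j := by
  rcases isEmpty_or_nonempty (Fin d) with h | h
  · exact ⟨1, one_pos, le_rfl, fun j => (h.false j).elim⟩
  obtain ⟨j0, hj0⟩ := Finite.exists_min (fun j => min (x j) (1 - x j))
  refine ⟨min 1 (min (x j0) (1 - x j0)), ?_, min_le_left _ _, fun j => ?_⟩
  · have := hx j0
    exact lt_min one_pos (lt_min this.1 (by linarith [this.2]))
  · have := hj0 j
    exact ⟨(min_le_right _ _).trans (this.trans (min_le_left _ _)),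
      (min_le_right _ _).trans (this.trans (min_le_right _ _))⟩

lemma ball_subset_unitBox {d : ℕ} (x : Fin d → ℝ) (δ : ℝ) (h : ∀ j, δ ≤ x j ∧ δ ≤ 1 - x j) :
    Metric.ball x δ ⊆ unitBox d := by
  intro y hy j _
  have h1 : |y j - x j| < δ := by
    rw [← Real.dist_eq]
    exact (dist_le_pi_dist y x j).trans_lt hy
  rw [abs_lt] at h1
  have := h j
  constructor <;> linarith

lemma l2dist_le {d : ℕ} (x y : Fin d → ℝ) : l2dist x y ≤ Real.sqrt d * ‖x - y‖ := by
  unfold l2dist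
  rw [← Real.sqrt_sq (norm_nonneg (x - y)), ← Real.sqrt_mul (by positivity)]
  apply Real.sqrt_le_sqrt
  have : ∀ j ∈ Finset.univ, (x j - y j) ^ 2 ≤ ‖x - y‖ ^ 2 := by
    intro j _
    have := norm_le_pi_norm (x - y) j
    rw [Pi.sub_apply, Real.norm_eq_abs] at this
    rw [← sq_abs]
    gcongr
  refine (Finset.sum_le_card_nsmul _ _ _ this).trans ?_
  simp

lemma flbeta_spec {β : ℝ} (hβ : 1 ≤ β) : (flbeta β : ℝ) < β ∧ β ≤ flbeta β + 1 := by
  unfold flbeta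
  have h1 : 0 < ⌈β⌉₊ := Nat.ceil_pos.2 (by linarith)
  have h2 := Nat.ceil_lt_add_one (show (0:ℝ) ≤ β by linarith)
  have h3 := Nat.le_ceil β
  rw [Nat.cast_sub (by omega)]
  push_cast
  constructor <;> linarith

lemma holder_taylor {d : ℕ} {β : ℝ} (hβ : 1 ≤ β) (g : (Fin d → ℝ) → ℝ) (hg : IsHolderOn β g)
    (x : Fin d → ℝ) (δ : ℝ) (hδ : 0 < δ) (h : ∀ j, δ ≤ x j ∧ δ ≤ 1 - x j) :
    ∃ (q : ℕ → (Fin d → ℝ) → ℝ) (K : ℝ), 0 < K ∧ (∀ k, Continuous (q k)) ∧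
      (∀ k (c : ℝ) u, q k (c • u) = c ^ k * q k u) ∧ (∀ k u, |q k u| ≤ K * ‖u‖ ^ k) ∧
      (∀ u, q 0 u = g x) ∧
      ∀ u, ‖u‖ < δ → |g (x + u) - ∑ k ∈ Finset.range (flbeta β + 1), q k u| ≤ K * ‖u‖ ^ β := by
  obtain ⟨hc, C, hC, hh⟩ := hg
  obtain ⟨hs1, hs2⟩ := flbeta_spec hβ
  have hsub := ball_subset_unitBox x δ h
  have hγ : 0 < β - flbeta β := by linarith
  obtain ⟨q, K, hK, h1, h2, h3, h4, h5⟩ := taylor_exists x δ (C * Real.sqrt d ^ (β - flbeta β) + 1)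
    (β - flbeta β) hδ hγ (by positivity) (flbeta β) ℝ g (hc.mono hsub) (by
      intro y hy y' hy'
      have e : ∀ y ∈ Metric.ball x δ, iteratedFDerivWithin ℝ (flbeta β) g (unitBox d) y
          = iteratedFDeriv ℝ (flbeta β) g y := by
        intro y hy
        rw [← iteratedFDerivWithin_univ]
        apply iteratedFDerivWithin_congr_set
        rw [Filter.eventuallyEq_univ]
        exact Filter.mem_of_superset (Metric.isOpen_ball.mem_nhds hy) hsub
      have h := hh y (hsub hy) y' (hsub hy')
      rw [e y hy, e y' hy'] at h
      refine h.trans ?_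
      have h0 : 0 ≤ l2dist y y' := Real.sqrt_nonneg _
      calc C * l2dist y y' ^ (β - flbeta β) ≤ C * (Real.sqrt d * ‖y - y'‖) ^ (β - flbeta β) := by
            gcongr
            exact l2dist_le y y'
        _ = C * Real.sqrt d ^ (β - flbeta β) * ‖y - y'‖ ^ (β - flbeta β) := by
            rw [Real.mul_rpow (by positivity) (by positivity)]; ring
        _ ≤ _ := by gcongr; linarith)
  refine ⟨q, K, hK, h1, fun k c u => by simpa using h2 k c u, fun k u => by simpa using h3 k u, h4, ?_⟩
  intro u hu
  have := h5 u hu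
  rwa [add_sub_cancel, Real.norm_eq_abs] at this


/-- average of `φ` over `Q` -/
def avg {d : ℕ} (Q : Set (Fin d → ℝ)) (φ : (Fin d → ℝ) → ℝ) : ℝ :=
  (∫ u in Q, φ u) / volume.real Q

lemma avg_le {d : ℕ} (Q : Set (Fin d → ℝ)) (hQm : MeasurableSet Q) (hQ0 : 0 < volume.real Q)
    (φ : (Fin d → ℝ) → ℝ) (c : ℝ) (h : ∀ u ∈ Q, |φ u| ≤ c) : |avg Q φ| ≤ c := by
  unfold avg
  rw [abs_div, abs_of_pos hQ0, div_le_iff₀ hQ0]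
  have hfin : volume Q < ⊤ := by
    by_contra hh
    rw [not_lt, top_le_iff] at hh
    simp [Measure.real, hh] at hQ0
  exact norm_setIntegral_le_of_norm_le_const (f := φ) hfin h

lemma avg_ge {d : ℕ} (Q : Set (Fin d → ℝ)) (hQm : MeasurableSet Q) (hQ0 : 0 < volume.real Q)
    (φ : (Fin d → ℝ) → ℝ) (hφ : IntegrableOn φ Q) (c : ℝ) (h : ∀ u ∈ Q, c ≤ φ u) : c ≤ avg Q φ := by
  unfold avg
  rw [le_div_iff₀ hQ0]
  have hfin : volume Q ≠ ⊤ := by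
    intro hh
    simp [Measure.real, hh] at hQ0
  exact setIntegral_ge_of_const_le_real hQm hfin h hφ

lemma avg_const {d : ℕ} (Q : Set (Fin d → ℝ)) (hQ0 : 0 < volume.real Q) (c : ℝ) :
    avg Q (fun _ => c) = c := by
  unfold avg
  rw [setIntegral_const, smul_eq_mul]
  field_simp

open scoped Pointwise in
lemma avg_scale {d : ℕ} (Q : Set (Fin d → ℝ)) (φ : (Fin d → ℝ) → ℝ) (k : ℕ)
    (hφ : ∀ (c : ℝ) u, φ (c • u) = c ^ k * φ u) (ρ : ℝ) (hρ : ρ ≠ 0) :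
    avg (ρ • Q) φ = ρ ^ k * avg Q φ := by
  unfold avg
  have h := Measure.setIntegral_comp_smul volume φ Q hρ
  simp only [hφ] at h
  rw [integral_const_mul] at h
  have hv : volume.real (ρ • Q) = |ρ ^ d| * volume.real Q := by
    rw [Measure.real, Measure.addHaar_smul, ENNReal.toReal_mul, ENNReal.toReal_ofReal (abs_nonneg _)]
    simp [Measure.real]
  have hd : Module.finrank ℝ (Fin d → ℝ) = d := by simp
  rw [hd, smul_eq_mul, abs_inv] at h
  rw [hv, ← mul_div_assoc, h]
  have : |ρ ^ d| ≠ 0 := by positivity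
  field_simp

/-- expansion coefficients of the cell mean -/
def cf {d : ℕ} (F G : ℕ → (Fin d → ℝ) → ℝ) (Q : Set (Fin d → ℝ)) (k : ℕ) : ℝ :=
  qs (fun k => avg Q (F k)) (fun k => avg Q (G k)) k

open scoped Pointwise in
lemma cf_scale {d : ℕ} (F G : ℕ → (Fin d → ℝ) → ℝ) (hF : ∀ k (c : ℝ) u, F k (c • u) = c ^ k * F k u)
    (hG : ∀ k (c : ℝ) u, G k (c • u) = c ^ k * G k u) (Q : Set (Fin d → ℝ)) (k : ℕ) (ρ : ℝ)
    (hρ : ρ ≠ 0) : cf F G (ρ • Q) k = ρ ^ k * cf F G Q k := by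
  unfold cf
  rw [← qs_scale]
  congr 1
  · ext k; exact avg_scale Q (F k) k (hF k) ρ hρ
  · ext k; exact avg_scale Q (G k) k (hG k) ρ hρ

lemma cell_expansion {d : ℕ} {β : ℝ} (hβ : 1 ≤ β) (f μ : (Fin d → ℝ) → ℝ) (hf : IsHolderOn β f)
    (hμ : IsHolderOn β μ) (hfpos : ∃ c > (0:ℝ), ∀ z ∈ unitBox d, c ≤ f z)
    (x : Fin d → ℝ) (δ : ℝ) (hδ : 0 < δ) (hδ1 : δ ≤ 1) (h : ∀ j, δ ≤ x j ∧ δ ≤ 1 - x j) :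
    ∃ (F G : ℕ → (Fin d → ℝ) → ℝ) (K : ℝ), 0 < K ∧ (∀ k, Continuous (F k)) ∧ (∀ k, Continuous (G k)) ∧
      (∀ k (c : ℝ) u, F k (c • u) = c ^ k * F k u) ∧ (∀ k (c : ℝ) u, G k (c • u) = c ^ k * G k u) ∧
      ∀ (Q : Set (Fin d → ℝ)) (t : ℝ), 0 ≤ t → t < δ → MeasurableSet Q → 0 < volume.real Q →
        Q ⊆ Metric.closedBall 0 t →
        (∀ k ≤ flbeta β, |cf F G Q k| ≤ K * t ^ k) ∧ cf F G Q 0 = μ x ∧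
        |(∫ u in Q, μ (x + u) * f (x + u)) / (∫ u in Q, f (x + u))
          - ∑ k ∈ Finset.range (flbeta β + 1), cf F G Q k| ≤ K * t ^ β := by
  obtain ⟨p, K1, hK1, hp1, hp2, hp3, hp4, hp5⟩ := holder_taylor hβ μ hμ x δ hδ h
  obtain ⟨g, K2, hK2, hg1, hg2, hg3, hg4, hg5⟩ := holder_taylor hβ f hf x δ hδ h
  obtain ⟨c0, hc0, hfc⟩ := hfpos
  obtain ⟨hs1, hs2⟩ := flbeta_spec hβ
  set l := flbeta β
  have hxbox : x ∈ unitBox d := ball_subset_unitBox x δ h (Metric.mem_ball_self hδ)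
  let F : ℕ → (Fin d → ℝ) → ℝ := fun k u => ∑ j ∈ Finset.range (k + 1), p j u * g (k - j) u
  have hFc : ∀ k, Continuous (F k) := fun k =>
    continuous_finsetSum _ fun j _ => (hp1 j).mul (hg1 _)
  have hFh : ∀ k (c : ℝ) u, F k (c • u) = c ^ k * F k u := by
    intro k c u
    simp only [F, hp2, hg2, Finset.mul_sum]
    refine Finset.sum_congr rfl fun j hj => ?_
    have hj' := Finset.mem_range.1 hj
    have : c ^ k = c ^ j * c ^ (k - j) := by rw [← pow_add]; congr 1; omega
    rw [this]; ring
  obtain ⟨K3, hK3, hprod⟩ := prod_expansion (max K1 K2) (by positivity) l β (by linarith) hs2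
  have hFb : ∀ k ≤ l, ∀ u, |F k u| ≤ (l + 1) * (K1 * K2) * ‖u‖ ^ k := by
    intro k hk u
    refine (Finset.abs_sum_le_sum_abs _ _).trans ?_
    refine (Finset.sum_le_card_nsmul _ _ (K1 * K2 * ‖u‖ ^ k) fun j hj => ?_).trans ?_
    · have hj' := Finset.mem_range.1 hj
      rw [abs_mul]
      calc |p j u| * |g (k - j) u| ≤ (K1 * ‖u‖ ^ j) * (K2 * ‖u‖ ^ (k - j)) := by
            gcongr
            · exact hp3 j u
            · exact hg3 _ u
        _ = K1 * K2 * (‖u‖ ^ j * ‖u‖ ^ (k - j)) := by ring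
        _ = K1 * K2 * ‖u‖ ^ k := by rw [← pow_add]; congr 2; omega
    · rw [nsmul_eq_mul, Finset.card_range, mul_assoc ((l:ℝ) + 1)]
      gcongr
      push_cast
      have : (k:ℝ) ≤ l := by exact_mod_cast hk
      linarith
  let C : ℝ := max (max K2 K3) ((l + 1) * (K1 * K2))
  obtain ⟨K, hK, hquot⟩ := quot_expansion C c0 (by positivity) hc0 l β (by linarith) hs2
  refine ⟨F, g, K, hK, hFc, hg1, hFh, hg2, ?_⟩
  intro Q t ht htδ hQm hQ0 hQt
  have hnorm : ∀ u ∈ Q, ‖u‖ ≤ t := fun u hu => by simpa using hQt hu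
  have hCK2 : K2 ≤ C := (le_max_left _ _).trans (le_max_left _ _)
  have hCK3 : K3 ≤ C := (le_max_right _ _).trans (le_max_left _ _)
  have hCK4 : (l + 1) * (K1 * K2) ≤ C := le_max_right _ _
  -- integrability
  have hitg : ∀ φ : (Fin d → ℝ) → ℝ, ContinuousOn φ (Metric.closedBall 0 t) → IntegrableOn φ Q :=
    fun φ hφ => (hφ.integrableOn_compact (isCompact_closedBall 0 t)).mono_set hQt
  have hmaps : Set.MapsTo (fun u => x + u) (Metric.closedBall 0 t) (unitBox d) := by
    intro u hu
    apply ball_subset_unitBox x δ h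
    simp only [mem_ball_iff_norm, add_sub_cancel_left]
    exact (by simpa using hu : ‖u‖ ≤ t).trans_lt htδ
  have hfcont : ContinuousOn (fun u => f (x + u)) (Metric.closedBall 0 t) :=
    hf.1.continuousOn.comp (by fun_prop) hmaps
  have hμcont : ContinuousOn (fun u => μ (x + u)) (Metric.closedBall 0 t) :=
    hμ.1.continuousOn.comp (by fun_prop) hmaps
  have hexp : ∀ (φ : (Fin d → ℝ) → ℝ) (q : ℕ → (Fin d → ℝ) → ℝ) (K' : ℝ), 0 ≤ K' →
      ContinuousOn φ (Metric.closedBall 0 t) → (∀ k, Continuous (q k)) →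
      (∀ u ∈ Q, |φ u - ∑ k ∈ Finset.range (l + 1), q k u| ≤ K' * ‖u‖ ^ β) →
      |avg Q φ - ∑ k ∈ Finset.range (l + 1), avg Q (q k)| ≤ K' * t ^ β := by
    intro φ q K' hK' hφ hq hh
    have e : avg Q φ - ∑ k ∈ Finset.range (l + 1), avg Q (q k)
        = avg Q (fun u => φ u - ∑ k ∈ Finset.range (l + 1), q k u) := by
      unfold avg
      rw [integral_sub (hitg φ hφ) (integrable_finsetSum _ fun k _ => hitg _ (hq k).continuousOn),
        integral_finsetSum _ fun k _ => hitg _ (hq k).continuousOn, sub_div, Finset.sum_div]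
    rw [e]
    refine avg_le Q hQm hQ0 _ _ fun u hu => (hh u hu).trans ?_
    gcongr
    exact hnorm u hu
  have hq := hquot (avg Q (fun u => μ (x + u) * f (x + u))) (avg Q (fun u => f (x + u)))
    (fun k => avg Q (F k)) (fun k => avg Q (g k)) t ht (htδ.le.trans hδ1)
    (fun k hk => avg_le Q hQm hQ0 _ _ fun u hu => (hFb k hk u).trans (by
      gcongr; exact hnorm u hu))
    (fun k hk => avg_le Q hQm hQ0 _ _ fun u hu => (hg3 k u).trans (by
      gcongr; exact hnorm u hu))
    (by
      have : g 0 = fun _ => f x := funext hg4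
      rw [this, avg_const Q hQ0]
      exact hfc x hxbox)
    (avg_ge Q hQm hQ0 _ (hitg _ hfcont) c0 fun u hu => hfc _ (hmaps (hQt hu)))
    ((hexp _ F K3 hK3.le (hμcont.mul hfcont) hFc (fun u hu => by
      have hu' := hnorm u hu
      exact hprod (μ (x + u)) (f (x + u)) (fun k => p k u) (fun k => g k u) ‖u‖ (norm_nonneg u)
        (by linarith)
        (fun k _ => (hp3 k u).trans (by gcongr; exact le_max_left _ _))
        (fun k _ => (hg3 k u).trans (by gcongr; exact le_max_right _ _))
        ((hp5 u (by linarith)).trans (by gcongr; exact le_max_left _ _))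
        ((hg5 u (by linarith)).trans (by gcongr; exact le_max_right _ _)))).trans (by gcongr))
    ((hexp _ g K2 hK2.le hfcont hg1 (fun u hu => hg5 u ((hnorm u hu).trans_lt htδ))).trans
      (by gcongr))
  refine ⟨hq.1, ?_, ?_⟩
  · unfold cf
    rw [qs_eq]
    have e1 : g 0 = fun _ => f x := funext hg4
    have e2 : F 0 = fun _ => μ x * f x := by
      ext u; simp [F, hp4, hg4]
    have : f x ≠ 0 := (hc0.trans_le (hfc x hxbox)).ne'
    simp only [Finset.range_zero, Finset.sum_empty, sub_zero, e1, e2, avg_const Q hQ0]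
    field_simp
  · have := hq.2
    unfold avg at this
    rw [div_div_div_cancel_right₀ hQ0.ne'] at this
    exact this


lemma IsExpOne.map_eq {Ω : Type*} [MeasurableSpace Ω] {P : Measure Ω} [IsProbabilityMeasure P]
    {E : Ω → ℝ} (h : IsExpOne P E) : Measure.map E P = expMeasure 1 := by
  have := isProbabilityMeasure_expMeasure (r := 1) one_pos
  have : IsProbabilityMeasure (Measure.map E P) := Measure.isProbabilityMeasure_map h.1.aemeasurable
  apply Measure.eq_of_cdf
  ext t
  rw [cdf_expMeasure_eq one_pos, cdf_eq_real, map_measureReal_apply h.1 measurableSet_Iic]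
  have hc : ∀ s : ℝ, 0 ≤ s → P.real (E ⁻¹' Set.Iic s) = 1 - Real.exp (-s) := by
    intro s hs
    have e : E ⁻¹' Set.Iic s = {ω | s < E ω}ᶜ := by ext; simp
    rw [e, probReal_compl_eq_one_sub (measurableSet_lt measurable_const h.1), Measure.real, h.2 s hs,
      ENNReal.toReal_ofReal (Real.exp_pos _).le]
  split_ifs with ht
  · rw [hc t ht]; simp
  · push Not at ht
    have h0 := hc 0 le_rfl
    simp only [neg_zero, Real.exp_zero, sub_self] at h0
    refine le_antisymm ?_ measureReal_nonneg
    rw [← h0]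
    exact measureReal_mono (Set.preimage_mono (Set.Iic_subset_Iic.2 ht.le))

lemma expMeasure_pos : ∀ᵐ y ∂(expMeasure 1), 0 < y := by
  have := isProbabilityMeasure_expMeasure (r := 1) one_pos
  rw [ae_iff]
  have e : {a : ℝ | ¬ 0 < a} = Set.Iic 0 := by ext; simp
  have h := cdf_expMeasure_eq (r := 1) one_pos 0
  rw [cdf_eq_real] at h
  simp only [le_refl, if_true, mul_zero, neg_zero, Real.exp_zero, sub_self] at h
  rw [e]
  exact (measureReal_eq_zero_iff (by finiteness)).1 h

lemma expMeasure_integrable (s : ℝ) (hs : -1 < s) :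
    Integrable (fun y : ℝ => |y| ^ s) (expMeasure 1) := by
  unfold expMeasure gammaMeasure
  rw [integrable_withDensity_iff (by unfold gammaPDF; fun_prop) (by
    refine Filter.Eventually.of_forall fun y => ?_
    simp [gammaPDF])]
  have h := Real.GammaIntegral_convergent (s := s + 1) (by linarith)
  rw [← integrable_indicator_iff measurableSet_Ioi] at h
  refine h.congr ?_
  have h0 : ∀ᵐ y : ℝ, y ≠ 0 := by
    rw [ae_iff]; simp
  filter_upwards [h0] with y hy
  by_cases hy' : 0 < y
  · rw [Set.indicator_of_mem (by exact hy')]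
    rw [gammaPDF, ENNReal.toReal_ofReal (gammaPDFReal_nonneg one_pos one_pos y), gammaPDFReal,
      if_pos hy'.le, abs_of_pos hy']
    simp
    ring
  · rw [Set.indicator_of_notMem (by exact hy')]
    have : y < 0 := lt_of_le_of_ne (not_lt.1 hy') hy
    rw [gammaPDF_of_neg this]
    simp

/-- the law of the independent exponentials -/
def expPi (d : ℕ) : Measure (Fin d × Bool → ℝ) := Measure.pi (fun _ => expMeasure 1)

instance : IsProbabilityMeasure (expMeasure 1) := isProbabilityMeasure_expMeasure one_pos

instance (d : ℕ) : IsProbabilityMeasure (expPi d) := by unfold expPi; infer_instance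

lemma expPi_pos (d : ℕ) : ∀ᵐ e ∂(expPi d), ∀ p, 0 < e p := by
  rw [ae_all_iff]
  intro p
  exact (measurePreserving_eval (fun _ : Fin d × Bool => expMeasure 1) p).quasiMeasurePreserving.ae
    expMeasure_pos

lemma expPi_integrable (d : ℕ) (s : ℝ) (hs : 0 < s) : Integrable (fun e => ‖e‖ ^ s) (expPi d) := by
  have h : Integrable (fun e : Fin d × Bool → ℝ => ∑ p, |e p| ^ s) (expPi d) := by
    refine integrable_finsetSum _ fun p _ => ?_
    exact integrable_comp_eval (μ := fun _ : Fin d × Bool => expMeasure 1) (i := p)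
      (expMeasure_integrable s (by linarith))
  refine h.mono' ?_ ?_
  · exact (continuous_norm.measurable.pow_const s).aestronglyMeasurable
  · refine Filter.Eventually.of_forall fun e => ?_
    rw [Real.norm_of_nonneg (by positivity)]
    have hnn : 0 ≤ ∑ p, |e p| ^ s := Finset.sum_nonneg fun p _ => by positivity
    have : ‖e‖ ≤ (∑ p, |e p| ^ s) ^ s⁻¹ := by
      rw [pi_norm_le_iff_of_nonneg (by positivity)]
      intro p
      rw [Real.norm_eq_abs, Real.le_rpow_inv_iff_of_pos (abs_nonneg _) hnn hs]
      exact Finset.single_le_sum (f := fun p => |e p| ^ s) (fun p _ => by positivity)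
        (Finset.mem_univ p)
    calc ‖e‖ ^ s ≤ ((∑ p, |e p| ^ s) ^ s⁻¹) ^ s := by gcongr
      _ = _ := Real.rpow_inv_rpow hnn hs.ne'

/-- swap the lower and upper exponentials -/
def swp {d : ℕ} (e : Fin d × Bool → ℝ) : Fin d × Bool → ℝ := fun p => e (p.1, !p.2)

lemma swp_mp (d : ℕ) : MeasurePreserving (swp (d := d)) (expPi d) (expPi d) := by
  let σ : Fin d × Bool ≃ Fin d × Bool := Equiv.prodCongr (Equiv.refl _) Equiv.boolNot
  have h := measurePreserving_piCongrLeft (fun _ : Fin d × Bool => expMeasure 1) σ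
  unfold expPi
  convert h using 1
  ext e p
  have := Equiv.piCongrLeft_apply_apply (fun _ : Fin d × Bool => ℝ) σ e (σ.symm p)
  rw [Equiv.apply_symm_apply] at this
  rw [MeasurableEquiv.coe_piCongrLeft, this]
  rfl

lemma law_expPi {Ω ι : Type*} [MeasurableSpace Ω] (P : Measure Ω) [IsProbabilityMeasure P]
    (d : ℕ) (V : ι × Fin d × Bool → Ω → ℝ) (hV : iIndepFun V P) (hE : ∀ p, IsExpOne P (V p)) (i : ι) :
    Measure.map (fun ω => fun q : Fin d × Bool => V (i, q) ω) P = expPi d := by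
  have h := hV.precomp (g := fun q : Fin d × Bool => (i, q)) (fun a b hab => by simpa using hab)
  rw [iIndepFun_iff_map_fun_eq_pi_map (fun q => (hE _).1.aemeasurable)] at h
  rw [h]
  unfold expPi
  congr 1
  ext1 q
  exact (hE (i, q)).map_eq


/-- the Mondrian cell at `x`, as a set -/
def cell {d : ℕ} (x : Fin d → ℝ) (lam : ℝ) (e : Fin d × Bool → ℝ) : Set (Fin d → ℝ) :=
  {z | inMondrianCell x lam (fun j => e (j, false)) (fun j => e (j, true)) z}

/-- the unscaled, untruncated cell centred at zero -/
def qcell {d : ℕ} (e : Fin d × Bool → ℝ) : Set (Fin d → ℝ) :=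
  Set.Icc (fun j => - e (j, false)) (fun j => e (j, true))

lemma cell_eq_Icc {d : ℕ} (x : Fin d → ℝ) (lam : ℝ) (e : Fin d × Bool → ℝ) :
    cell x lam e = Set.Icc (fun j => x j - min (e (j, false) / lam) (x j))
      (fun j => x j + min (e (j, true) / lam) (1 - x j)) := by
  ext z
  simp only [cell, inMondrianCell, Set.mem_ofPred_eq, Set.mem_Icc, Pi.le_def, forall_and]

lemma cell_meas {d : ℕ} (x : Fin d → ℝ) (lam : ℝ) (e : Fin d × Bool → ℝ) :
    MeasurableSet (cell x lam e) := by rw [cell_eq_Icc]; exact measurableSet_Icc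

lemma qcell_meas {d : ℕ} (e : Fin d × Bool → ℝ) : MeasurableSet (qcell e) := measurableSet_Icc

lemma cell_joint_meas {d : ℕ} (x : Fin d → ℝ) (lam : ℝ) :
    MeasurableSet {q : (Fin d × Bool → ℝ) × (Fin d → ℝ) | q.2 ∈ cell x lam q.1} := by
  have e : {q : (Fin d × Bool → ℝ) × (Fin d → ℝ) | q.2 ∈ cell x lam q.1}
      = ⋂ j, ({q : (Fin d × Bool → ℝ) × (Fin d → ℝ) | x j - min (q.1 (j, false) / lam) (x j) ≤ q.2 j}
        ∩ {q | q.2 j ≤ x j + min (q.1 (j, true) / lam) (1 - x j)}) := by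
    ext q
    simp [cell, inMondrianCell]
  rw [e]
  refine MeasurableSet.iInter fun j => ?_
  refine MeasurableSet.inter (measurableSet_le ?_ ?_) (measurableSet_le ?_ ?_) <;> fun_prop

lemma qcell_joint_meas {d : ℕ} :
    MeasurableSet {q : (Fin d × Bool → ℝ) × (Fin d → ℝ) | q.2 ∈ qcell q.1} := by
  have e : {q : (Fin d × Bool → ℝ) × (Fin d → ℝ) | q.2 ∈ qcell q.1}
      = ⋂ j, ({q : (Fin d × Bool → ℝ) × (Fin d → ℝ) | - q.1 (j, false) ≤ q.2 j}
        ∩ {q | q.2 j ≤ q.1 (j, true)}) := by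
    ext q
    simp [qcell, Pi.le_def, forall_and]
  rw [e]
  refine MeasurableSet.iInter fun j => ?_
  refine MeasurableSet.inter (measurableSet_le ?_ ?_) (measurableSet_le ?_ ?_) <;> fun_prop

lemma qcell_int_meas {d : ℕ} (φ : (Fin d → ℝ) → ℝ) (hφ : Measurable φ) :
    Measurable (fun e : Fin d × Bool → ℝ => ∫ u in qcell e, φ u) := by
  have e1 : (fun e : Fin d × Bool → ℝ => ∫ u in qcell e, φ u)
      = fun e => ∫ u, ({q : (Fin d × Bool → ℝ) × (Fin d → ℝ) | q.2 ∈ qcell q.1}.indicator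
          (fun q => φ q.2)) (e, u) := by
    ext e
    rw [← integral_indicator (qcell_meas e)]
    rfl
  rw [e1]
  have hm : StronglyMeasurable ({q : (Fin d × Bool → ℝ) × (Fin d → ℝ) | q.2 ∈ qcell q.1}.indicator
          (fun q => φ q.2)) :=
    ((hφ.comp measurable_snd).indicator qcell_joint_meas).stronglyMeasurable
  exact hm.integral_prod_right'.measurable

lemma avg_qcell_meas {d : ℕ} (φ : (Fin d → ℝ) → ℝ) (hφ : Measurable φ) :
    Measurable (fun e : Fin d × Bool → ℝ => avg (qcell e) φ) := by
  unfold avg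
  refine (qcell_int_meas φ hφ).div ?_
  have := qcell_int_meas (d := d) (fun _ => 1) measurable_const
  simpa using this

lemma cf_qcell_meas {d : ℕ} (F G : ℕ → (Fin d → ℝ) → ℝ) (hF : ∀ k, Continuous (F k))
    (hG : ∀ k, Continuous (G k)) (k : ℕ) :
    Measurable (fun e : Fin d × Bool → ℝ => cf F G (qcell e) k) := by
  unfold cf
  induction k using Nat.strong_induction_on with
  | _ k ih =>
    simp only [qs_eq _ _ k]
    refine Measurable.div ?_ (avg_qcell_meas _ (hG 0).measurable)
    refine (avg_qcell_meas _ (hF k).measurable).sub ?_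
    exact Finset.measurable_fun_sum _ fun j hj =>
      (ih j (Finset.mem_range.1 hj)).mul (avg_qcell_meas _ (hG _).measurable)

lemma abs_le_enorm {d : ℕ} (e : Fin d × Bool → ℝ) (p) : e p ≤ ‖e‖ :=
  (le_abs_self _).trans (norm_le_pi_norm e p)

open scoped Pointwise in
lemma smul_qcell {d : ℕ} (e : Fin d × Bool → ℝ) (h : ℝ) (hh : 0 < h) :
    h • qcell e = Set.Icc (fun j => - (h * e (j, false))) (fun j => h * e (j, true)) := by
  ext z
  rw [Set.mem_smul_set_iff_inv_smul_mem₀ hh.ne']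
  simp only [qcell, Set.mem_Icc, Pi.le_def, Pi.smul_apply, smul_eq_mul]
  refine and_congr (forall_congr' fun j => ?_) (forall_congr' fun j => ?_)
  · rw [le_inv_mul_iff₀ hh]; simp
  · rw [inv_mul_le_iff₀ hh]

open scoped Pointwise in
lemma swp_qcell {d : ℕ} (e : Fin d × Bool → ℝ) : qcell (swp e) = (-1 : ℝ) • qcell e := by
  ext z
  rw [Set.mem_smul_set_iff_inv_smul_mem₀ (by norm_num)]
  simp only [qcell, swp, Set.mem_Icc, Pi.le_def, Pi.smul_apply, smul_eq_mul, Bool.not_false,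
    Bool.not_true]
  constructor
  · rintro ⟨h1, h2⟩
    exact ⟨fun j => by have := h2 j; linarith, fun j => by have := h1 j; linarith⟩
  · rintro ⟨h1, h2⟩
    exact ⟨fun j => by have := h2 j; linarith, fun j => by have := h1 j; linarith⟩

lemma vol_Icc_pos {d : ℕ} (u v : Fin d → ℝ) (h : ∀ j, u j < v j) :
    0 < volume.real (Set.Icc u v) := by
  rw [Measure.real, Real.volume_Icc_pi, ENNReal.toReal_prod]
  refine Finset.prod_pos fun j _ => ?_
  rw [ENNReal.toReal_ofReal (by linarith [h j])]
  linarith [h j]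

open scoped Pointwise in
lemma cell_int_eq {d : ℕ} (x : Fin d → ℝ) (δ : ℝ) (h : ∀ j, δ ≤ x j ∧ δ ≤ 1 - x j) (lam : ℝ)
    (hlam : 0 < lam) (e : Fin d × Bool → ℝ) (hs : lam⁻¹ * ‖e‖ < δ) (φ : (Fin d → ℝ) → ℝ) :
    ∫ z in cell x lam e, φ z = ∫ u in lam⁻¹ • qcell e, φ (x + u) := by
  have hle : ∀ p, e p / lam ≤ δ := by
    intro p
    rw [div_eq_inv_mul]
    refine le_trans ?_ hs.le
    gcongr
    exact abs_le_enorm e p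
  have e1 : (fun u => x + u) ⁻¹' (cell x lam e) = lam⁻¹ • qcell e := by
    rw [smul_qcell e lam⁻¹ (by positivity), cell_eq_Icc]
    ext u
    simp only [Set.mem_preimage, Set.mem_Icc, Pi.le_def, Pi.add_apply]
    refine and_congr (forall_congr' fun j => ?_) (forall_congr' fun j => ?_)
    · rw [min_eq_left ((hle _).trans (h j).1), div_eq_inv_mul]
      constructor <;> intro h <;> linarith
    · rw [min_eq_left ((hle _).trans (h j).2), div_eq_inv_mul]
      constructor <;> intro h <;> linarith
  rw [← e1]
  exact ((measurePreserving_add_left volume x).setIntegral_preimage_emb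
    (measurableEmbedding_addLeft x) φ _).symm

/-- cell mean -/
def Mc {d : ℕ} (f μ : (Fin d → ℝ) → ℝ) (x : Fin d → ℝ) (lam : ℝ) (e : Fin d × Bool → ℝ) : ℝ :=
  (∫ z in cell x lam e, μ z * f z) / (∫ z in cell x lam e, f z)

open scoped Pointwise in
lemma cell_mean_expansion {d : ℕ} {β : ℝ} (hβ : 1 ≤ β) (f μ : (Fin d → ℝ) → ℝ) (hf : IsHolderOn β f)
    (hμ : IsHolderOn β μ) (hfpos : ∃ c > (0:ℝ), ∀ z ∈ unitBox d, c ≤ f z)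
    (x : Fin d → ℝ) (hx : ∀ j, x j ∈ Set.Ioo (0:ℝ) 1)
    (M : ℝ) (hM : ∀ lam, 0 < lam → ∀ e : Fin d × Bool → ℝ, (∀ p, 0 < e p) → |Mc f μ x lam e| ≤ M) :
    ∃ (F G : ℕ → (Fin d → ℝ) → ℝ) (K : ℝ), 0 < K ∧ (∀ k, Continuous (F k)) ∧ (∀ k, Continuous (G k)) ∧
      (∀ k (c : ℝ) u, F k (c • u) = c ^ k * F k u) ∧ (∀ k (c : ℝ) u, G k (c • u) = c ^ k * G k u) ∧
      ∀ e : Fin d × Bool → ℝ, (∀ p, 0 < e p) →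
        (∀ k ≤ flbeta β, |cf F G (qcell e) k| ≤ K * ‖e‖ ^ k) ∧ cf F G (qcell e) 0 = μ x ∧
        ∀ lam, 0 < lam →
        |Mc f μ x lam e - ∑ k ∈ Finset.range (flbeta β + 1), lam⁻¹ ^ k * cf F G (qcell e) k|
          ≤ K * (lam⁻¹ * ‖e‖) ^ β ∧
        |Mc f μ x lam e - μ x| ≤ K * (lam⁻¹ * ‖e‖) := by
  obtain ⟨δ, hδ, hδ1, hδx⟩ := exists_delta x hx
  obtain ⟨F, G, K, hK, hFc, hGc, hFh, hGh, hexp⟩ :=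
    cell_expansion hβ f μ hf hμ hfpos x δ hδ hδ1 hδx
  obtain ⟨hs1, hs2⟩ := flbeta_spec hβ
  set l := flbeta β
  have hqv : ∀ e : Fin d × Bool → ℝ, (∀ p, 0 < e p) → ∀ h : ℝ, 0 < h → 0 < volume.real (h • qcell e) := by
    intro e he h hh
    rw [smul_qcell e h hh]
    apply vol_Icc_pos
    intro j
    have h1 := mul_pos hh (he (j, false))
    have h2 := mul_pos hh (he (j, true))
    linarith
  have hqs : ∀ (e : Fin d × Bool → ℝ), ∀ h : ℝ, 0 < h →
      h • qcell e ⊆ Metric.closedBall 0 (h * ‖e‖) := by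
    intro e h hh z hz
    rw [smul_qcell e h hh] at hz
    rw [mem_closedBall_zero_iff, pi_norm_le_iff_of_nonneg (by positivity)]
    intro j
    have h1 := hz.1 j
    have h2 := hz.2 j
    simp only at h1 h2
    have h3 := abs_le_enorm e (j, false)
    have h4 := abs_le_enorm e (j, true)
    rw [Real.norm_eq_abs, abs_le]
    constructor <;> nlinarith
  have hqm : ∀ (e : Fin d × Bool → ℝ), ∀ h : ℝ, 0 < h → MeasurableSet (h • qcell e) := by
    intro e h hh
    rw [smul_qcell e h hh]; exact measurableSet_Icc
  -- all-scale coefficient facts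
  have hco : ∀ e : Fin d × Bool → ℝ, (∀ p, 0 < e p) →
      (∀ k ≤ l, |cf F G (qcell e) k| ≤ K * ‖e‖ ^ k) ∧ cf F G (qcell e) 0 = μ x := by
    intro e he
    let h : ℝ := δ / (2 * (‖e‖ + 1))
    have hh : 0 < h := by positivity
    have ht : h * ‖e‖ < δ := by
      have : h * ‖e‖ = δ * (‖e‖ / (2 * (‖e‖ + 1))) := by simp only [h]; ring
      rw [this]
      have h2 : ‖e‖ / (2 * (‖e‖ + 1)) < 1 := by
        rw [div_lt_one (by positivity)]
        linarith [norm_nonneg e]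
      nlinarith
    obtain ⟨a1, a2, _⟩ := hexp (h • qcell e) (h * ‖e‖) (by positivity) ht (hqm e h hh)
      (hqv e he h hh) (hqs e h hh)
    constructor
    · intro k hk
      have := a1 k hk
      rw [cf_scale F G hFh hGh _ _ _ hh.ne', abs_mul, abs_of_pos (pow_pos hh k), mul_pow] at this
      have hp := pow_pos hh k
      refine le_of_mul_le_mul_left ?_ hp
      linarith
    · rw [cf_scale F G hFh hGh _ _ _ hh.ne'] at a2
      simpa using a2
  have hM0 : 0 ≤ M := (abs_nonneg _).trans (hM 1 one_pos (fun _ => 1) (fun _ => one_pos))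
  have hμM : |μ x| ≤ M + K := by
    obtain ⟨b1, b2⟩ := hco (fun _ => 1) (fun _ => one_pos)
    have := b1 0 (Nat.zero_le _)
    rw [b2] at this
    simp at this
    linarith
  let K' : ℝ := (l + 2) * K + (M + (l + 1) * K) * (1 / δ) ^ β + (2 * M + K) / δ
  have hK'1 : (l + 2) * K ≤ K' := by
    have : 0 ≤ (M + (l + 1) * K) * (1 / δ) ^ β + (2 * M + K) / δ := by positivity
    simp only [K']; linarith
  have hK'2 : (M + (l + 1) * K) * (1 / δ) ^ β ≤ K' := by
    have : 0 ≤ (l + 2) * K + (2 * M + K) / δ := by positivity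
    simp only [K']; linarith
  have hK'3 : (2 * M + K) / δ ≤ K' := by
    have : 0 ≤ (l + 2) * K + (M + (l + 1) * K) * (1 / δ) ^ β := by positivity
    simp only [K']; linarith
  have hKK' : K ≤ K' := by
    refine le_trans ?_ hK'1
    have : (0:ℝ) ≤ l := Nat.cast_nonneg l
    nlinarith
  refine ⟨F, G, K', lt_of_lt_of_le hK hKK', hFc, hGc, hFh, hGh, ?_⟩
  intro e he
  obtain ⟨b1, b2⟩ := hco e he
  refine ⟨fun k hk => (b1 k hk).trans (by gcongr), b2, ?_⟩
  intro lam hlam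
  have hh : 0 < lam⁻¹ := by positivity
  set t := lam⁻¹ * ‖e‖ with ht
  have ht0 : 0 ≤ t := by positivity
  have hterm : ∀ k ≤ l, |lam⁻¹ ^ k * cf F G (qcell e) k| ≤ K * t ^ k := by
    intro k hk
    rw [abs_mul, abs_of_pos (pow_pos hh k), ht, mul_pow]
    have := b1 k hk
    have hp := pow_pos hh k
    nlinarith
  rcases lt_or_ge t δ with hcase | hcase
  · obtain ⟨a1, a2, a3⟩ := hexp (lam⁻¹ • qcell e) t ht0 hcase (hqm e _ hh)
      (hqv e he _ hh) (hqs e _ hh)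
    simp only [cf_scale F G hFh hGh _ _ _ hh.ne'] at a3
    have e1 : Mc f μ x lam e = (∫ u in lam⁻¹ • qcell e, μ (x + u) * f (x + u)) /
        (∫ u in lam⁻¹ • qcell e, f (x + u)) := by
      unfold Mc
      rw [cell_int_eq x δ hδx lam hlam e hcase, cell_int_eq x δ hδx lam hlam e hcase]
    rw [← e1] at a3
    refine ⟨a3.trans (by gcongr), ?_⟩
    have htβ : t ^ β ≤ t := by
      calc t ^ β ≤ t ^ (1:ℝ) := Real.rpow_le_rpow_of_exponent_ge_of_imp ht0 (by linarith) hβ (by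
            intro _ h; linarith)
        _ = t := Real.rpow_one t
    rw [Finset.sum_range_succ', b2, pow_zero, one_mul] at a3
    have hrest : |∑ k ∈ Finset.range l, lam⁻¹ ^ (k + 1) * cf F G (qcell e) (k + 1)| ≤ l * (K * t) := by
      refine (Finset.abs_sum_le_sum_abs _ _).trans ?_
      refine (Finset.sum_le_card_nsmul _ _ (K * t) fun k hk => ?_).trans ?_
      · have hk' := Finset.mem_range.1 hk
        refine (hterm (k + 1) (by omega)).trans ?_
        gcongr
        exact pow_le_of_le_one ht0 (by linarith) (by omega)
      · simp
    set S := ∑ k ∈ Finset.range l, lam⁻¹ ^ (k + 1) * cf F G (qcell e) (k + 1)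
    have e2 : Mc f μ x lam e - μ x = (Mc f μ x lam e - (S + μ x)) + S := by ring
    rw [e2]
    refine (abs_add_le _ _).trans ((add_le_add a3 hrest).trans ?_)
    have : K * t ^ β ≤ K * t := by gcongr
    have h5 : (l + 2) * K * t ≤ K' * t := by gcongr
    nlinarith [mul_nonneg hK.le ht0]
  · have hr : 1 ≤ t / δ := by rwa [one_le_div hδ]
    have hbig : ∀ k ≤ l, t ^ k ≤ (t / δ) ^ β := by
      intro k hk
      have h1 : t ≤ t / δ := by rw [le_div_iff₀ hδ]; nlinarith
      calc t ^ k ≤ (t / δ) ^ k := by gcongr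
        _ = (t / δ) ^ (k : ℝ) := (Real.rpow_natCast _ _).symm
        _ ≤ (t / δ) ^ β := Real.rpow_le_rpow_of_exponent_le hr (by
            have : (k:ℝ) ≤ l := by exact_mod_cast hk
            linarith)
    have hone : 1 ≤ (t / δ) ^ β := by simpa using hbig 0 (Nat.zero_le _)
    have hMc := hM lam hlam e he
    constructor
    · have hS : |∑ k ∈ Finset.range (l + 1), lam⁻¹ ^ k * cf F G (qcell e) k|
          ≤ (l + 1) * (K * (t / δ) ^ β) := by
        refine (Finset.abs_sum_le_sum_abs _ _).trans ?_
        refine (Finset.sum_le_card_nsmul _ _ (K * (t / δ) ^ β) fun k hk => ?_).trans ?_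
        · have hk' := Finset.mem_range.1 hk
          refine (hterm k (by omega)).trans ?_
          gcongr
          exact hbig k (by omega)
        · simp
      calc _ ≤ M + (l + 1) * (K * (t / δ) ^ β) := (abs_sub _ _).trans (add_le_add hMc hS)
        _ ≤ M * (t / δ) ^ β + (l + 1) * (K * (t / δ) ^ β) := by nlinarith
        _ = (M + (l + 1) * K) * (1 / δ) ^ β * t ^ β := by
            rw [show t / δ = (1 / δ) * t by ring, Real.mul_rpow (by positivity) ht0]; ring
        _ ≤ _ := by gcongr
    · calc _ ≤ M + (M + K) := (abs_sub _ _).trans (add_le_add hMc hμM)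
        _ = (2 * M + K) * 1 := by ring
        _ ≤ (2 * M + K) * (t / δ) := by gcongr
        _ = (2 * M + K) / δ * t := by ring
        _ ≤ _ := by gcongr


open scoped Pointwise in
lemma bias_single {d : ℕ} {β : ℝ} (hβ : 1 ≤ β) (f μ : (Fin d → ℝ) → ℝ) (hf : IsHolderOn β f)
    (hμ : IsHolderOn β μ) (hfpos : ∃ c > (0:ℝ), ∀ z ∈ unitBox d, c ≤ f z)
    (x : Fin d → ℝ) (hx : ∀ j, x j ∈ Set.Ioo (0:ℝ) 1)
    (M : ℝ) (hM : ∀ lam, 0 < lam → ∀ e : Fin d × Bool → ℝ, (∀ p, 0 < e p) → |Mc f μ x lam e| ≤ M)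
    (hmeas : ∀ lam, 0 < lam → Measurable (Mc f μ x lam)) :
    ∃ (c : ℕ → ℝ) (K : ℝ), 0 < K ∧ c 0 = μ x ∧ (∀ k ≤ flbeta β, Odd k → c k = 0) ∧
      ∀ lam, 0 < lam →
        |(∫ e, Mc f μ x lam e ∂(expPi d)) - ∑ k ∈ Finset.range (flbeta β + 1), lam⁻¹ ^ k * c k|
          ≤ K * lam⁻¹ ^ β ∧
        Integrable (fun e => (Mc f μ x lam e - μ x) ^ 2) (expPi d) ∧
        ∫ e, (Mc f μ x lam e - μ x) ^ 2 ∂(expPi d) ≤ K * lam⁻¹ ^ 2 := by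
  obtain ⟨F, G, K, hK, hFc, hGc, hFh, hGh, hexp⟩ :=
    cell_mean_expansion hβ f μ hf hμ hfpos x hx M hM
  set l := flbeta β
  have hpos := expPi_pos d
  have hIpow : ∀ k : ℕ, Integrable (fun e : Fin d × Bool → ℝ => ‖e‖ ^ k) (expPi d) := by
    intro k
    rcases Nat.eq_zero_or_pos k with rfl | hk
    · simp
    · have := expPi_integrable d k (by exact_mod_cast hk)
      simpa using this
  have hci : ∀ k ≤ l, Integrable (fun e => cf F G (qcell e) k) (expPi d) := by
    intro k hk
    refine ((hIpow k).const_mul K).mono' (cf_qcell_meas F G hFc hGc k).aestronglyMeasurable ?_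
    filter_upwards [hpos] with e he
    exact (hexp e he).1 k hk
  have hIβ := expPi_integrable d β (by linarith)
  let Iβ : ℝ := ∫ e, ‖e‖ ^ β ∂(expPi d)
  let I2 : ℝ := ∫ e, ‖e‖ ^ 2 ∂(expPi d)
  have hIβ0 : 0 ≤ Iβ := integral_nonneg fun e => by positivity
  have hI20 : 0 ≤ I2 := integral_nonneg fun e => by positivity
  refine ⟨fun k => ∫ e, cf F G (qcell e) k ∂(expPi d), K * Iβ + K ^ 2 * I2 + 1, by positivity, ?_, ?_, ?_⟩
  · have : (fun e => cf F G (qcell e) 0) =ᵐ[expPi d] fun _ => μ x := by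
      filter_upwards [hpos] with e he
      exact (hexp e he).2.1
    simp only [integral_congr_ae this]
    simp
  · intro k hk hodd
    have h1 : ∫ e, cf F G (qcell e) k ∂(expPi d) = ∫ e, cf F G (qcell (swp e)) k ∂(expPi d) := by
      have := integral_map (μ := expPi d) (φ := swp) (f := fun e => cf F G (qcell e) k)
        (swp_mp d).measurable.aemeasurable
        (cf_qcell_meas F G hFc hGc k).aestronglyMeasurable
      rw [(swp_mp d).map_eq] at this
      exact this
    simp only [swp_qcell, cf_scale F G hFh hGh _ _ (-1) (by norm_num), hodd.neg_one_pow,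
      integral_const_mul] at h1
    simp only
    linarith
  · intro lam hlam
    have hh : 0 < lam⁻¹ := by positivity
    have hMi : Integrable (Mc f μ x lam) (expPi d) := by
      refine (integrable_const M).mono' (hmeas lam hlam).aestronglyMeasurable ?_
      filter_upwards [hpos] with e he
      exact hM lam hlam e he
    have hSi : Integrable (fun e => ∑ k ∈ Finset.range (l + 1), lam⁻¹ ^ k * cf F G (qcell e) k)
        (expPi d) :=
      integrable_finsetSum _ fun k hk => (hci k (by have := Finset.mem_range.1 hk; omega)).const_mul _
    refine ⟨?_, ?_⟩
    · have e1 : ∑ k ∈ Finset.range (l + 1), lam⁻¹ ^ k * ∫ e, cf F G (qcell e) k ∂(expPi d)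
          = ∫ e, ∑ k ∈ Finset.range (l + 1), lam⁻¹ ^ k * cf F G (qcell e) k ∂(expPi d) := by
        rw [integral_finsetSum _ fun k hk =>
          (hci k (by have := Finset.mem_range.1 hk; omega)).const_mul _]
        simp only [integral_const_mul]
      rw [e1, ← integral_sub hMi hSi]
      have hb : ∀ᵐ e ∂(expPi d), ‖Mc f μ x lam e - ∑ k ∈ Finset.range (l + 1),
          lam⁻¹ ^ k * cf F G (qcell e) k‖ ≤ K * lam⁻¹ ^ β * ‖e‖ ^ β := by
        filter_upwards [hpos] with e he
        refine ((hexp e he).2.2 lam hlam).1.trans (le_of_eq ?_)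
        rw [Real.mul_rpow hh.le (norm_nonneg e)]; ring
      refine (norm_integral_le_of_norm_le (hIβ.const_mul _) hb).trans ?_
      rw [integral_const_mul]
      have : 0 ≤ lam⁻¹ ^ β := by positivity
      nlinarith [mul_nonneg (by positivity : 0 ≤ K ^ 2 * I2 + 1) this]
    · have hb : ∀ᵐ e ∂(expPi d), (Mc f μ x lam e - μ x) ^ 2 ≤ K ^ 2 * lam⁻¹ ^ 2 * ‖e‖ ^ 2 := by
        filter_upwards [hpos] with e he
        have h1 := ((hexp e he).2.2 lam hlam).2
        rw [← sq_abs]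
        calc |Mc f μ x lam e - μ x| ^ 2 ≤ (K * (lam⁻¹ * ‖e‖)) ^ 2 := by gcongr
          _ = _ := by ring
      have hi : Integrable (fun e => (Mc f μ x lam e - μ x) ^ 2) (expPi d) := by
        refine ((hIpow 2).const_mul (K ^ 2 * lam⁻¹ ^ 2)).mono'
          (((hmeas lam hlam).sub measurable_const).pow_const 2).aestronglyMeasurable ?_
        filter_upwards [hb] with e he
        rw [Real.norm_of_nonneg (by positivity)]
        exact he
      refine ⟨hi, ?_⟩
      refine (integral_mono_ae hi ((hIpow 2).const_mul _) hb).trans ?_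
      rw [integral_const_mul]
      have : 0 ≤ lam⁻¹ ^ 2 := by positivity
      nlinarith [mul_nonneg (by positivity : 0 ≤ K * Iβ + 1) this]

lemma debias_sum {J l : ℕ} (a w : Fin (J + 1) → ℝ) (ha : ∀ r, 0 < a r)
    (hw1 : ∑ r, w r = 1)
    (hw2 : ∀ s : ℕ, 1 ≤ s → s ≤ J → ∑ r, w r / a r ^ (2 * s) = 0) (hJ : l / 2 ≤ J)
    (c : ℕ → ℝ) (hc : ∀ k ≤ l, Odd k → c k = 0) (lam : ℝ) (hlam : 0 < lam) :
    ∑ r, w r * ∑ k ∈ Finset.range (l + 1), (a r * lam)⁻¹ ^ k * c k = c 0 := by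
  have e1 : ∑ r, w r * ∑ k ∈ Finset.range (l + 1), (a r * lam)⁻¹ ^ k * c k
      = ∑ k ∈ Finset.range (l + 1), (∑ r, w r / a r ^ k) * (lam⁻¹ ^ k * c k) := by
    simp only [Finset.mul_sum, Finset.sum_mul]
    rw [Finset.sum_comm]
    refine Finset.sum_congr rfl fun k _ => Finset.sum_congr rfl fun r _ => ?_
    rw [mul_inv, mul_pow, inv_pow (a r), div_eq_mul_inv]
    ring
  rw [e1, Finset.sum_eq_single 0]
  · simp [hw1]
  · intro k hk hk0
    have hk' := Finset.mem_range.1 hk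
    rcases Nat.even_or_odd' k with ⟨s, rfl | rfl⟩
    · rw [hw2 s (by omega) (by omega), zero_mul]
    · rw [hc _ (by omega) (by exact ⟨s, rfl⟩)]; simp
  · simp

lemma bias_debiased {d : ℕ} {β : ℝ} (f μ : (Fin d → ℝ) → ℝ)
    (x : Fin d → ℝ) {J : ℕ} (a w : Fin (J + 1) → ℝ) (ha : ∀ r, 0 < a r)
    (hw1 : ∑ r, w r = 1)
    (hw2 : ∀ s : ℕ, 1 ≤ s → s ≤ J → ∑ r, w r / a r ^ (2 * s) = 0) (hJ : flbeta β / 2 ≤ J)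
    (c : ℕ → ℝ) (K : ℝ) (hK : 0 < K) (hc0 : c 0 = μ x) (hc : ∀ k ≤ flbeta β, Odd k → c k = 0)
    (h : ∀ lam, 0 < lam →
        |(∫ e, Mc f μ x lam e ∂(expPi d)) - ∑ k ∈ Finset.range (flbeta β + 1), lam⁻¹ ^ k * c k|
          ≤ K * lam⁻¹ ^ β) :
    ∃ K' > (0:ℝ), ∀ lam, 0 < lam →
      |(∑ r, w r * ∫ e, Mc f μ x (a r * lam) e ∂(expPi d)) - μ x| ≤ K' * lam⁻¹ ^ β := by
  refine ⟨∑ r, |w r| * (K * (a r)⁻¹ ^ β) + 1, ?_, ?_⟩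
  · have : 0 ≤ ∑ r, |w r| * (K * (a r)⁻¹ ^ β) := Finset.sum_nonneg fun r _ => by
      have := ha r; positivity
    linarith
  intro lam hlam
  have e := debias_sum a w ha hw1 hw2 hJ c hc lam hlam
  rw [← hc0, ← e, ← Finset.sum_sub_distrib]
  refine (Finset.abs_sum_le_sum_abs _ _).trans ?_
  rw [add_mul, Finset.sum_mul, one_mul]
  have h0 : 0 ≤ lam⁻¹ ^ β := by positivity
  refine le_add_of_le_of_nonneg (Finset.sum_le_sum fun r _ => ?_) h0
  rw [← mul_sub, abs_mul, mul_assoc, mul_assoc]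
  gcongr
  refine (h (a r * lam) (mul_pos (ha r) hlam)).trans (le_of_eq ?_)
  have := ha r
  rw [mul_inv, Real.mul_rpow (by positivity) (by positivity)]


/-- ratio estimator, abstract version -/
lemma ratio_var {Ω : Type*} [MeasurableSpace Ω] (P : Measure Ω) [IsProbabilityMeasure P]
    (U V : ℕ → Ω → ℝ) (hU : ∀ i, Measurable (U i)) (hV : ∀ i, Measurable (V i))
    (hind : iIndepFun (fun i ω => (U i ω, V i ω)) P)
    (hU01 : ∀ i ω, U i ω = 0 ∨ U i ω = 1) (hUV : ∀ i ω, U i ω = 0 → V i ω = 0)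
    (M p : ℝ) (hp : 0 < p) (hM : 0 ≤ M) (hEU : ∀ i, ∫ ω, U i ω ∂P = p)
    (hEV : ∀ i, ∫ ω, V i ω ∂P = 0) (hV2 : ∀ i, Integrable (fun ω => V i ω ^ 2) P)
    (hEV2 : ∀ i, ∫ ω, V i ω ^ 2 ∂P ≤ M * p) (n : ℕ) (hn : 0 < n) :
    Integrable (fun ω => ((∑ i ∈ Finset.range n, V i ω) / (∑ i ∈ Finset.range n, U i ω)) ^ 2
      + M * (if ∑ i ∈ Finset.range n, U i ω = 0 then 1 else 0)) P ∧
    ∫ ω, (((∑ i ∈ Finset.range n, V i ω) / (∑ i ∈ Finset.range n, U i ω)) ^ 2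
      + M * (if ∑ i ∈ Finset.range n, U i ω = 0 then 1 else 0)) ∂P ≤ 12 * M / (n * p) := by
  have hU0 : ∀ i ω, 0 ≤ U i ω := fun i ω => by rcases hU01 i ω with h | h <;> simp [h]
  have hU1 : ∀ i ω, U i ω ≤ 1 := fun i ω => by rcases hU01 i ω with h | h <;> simp [h]
  have hUi : ∀ i, Integrable (U i) P := fun i =>
    (integrable_const (1:ℝ)).mono' (hU i).aestronglyMeasurable (Eventually.of_forall fun ω => by
      rw [Real.norm_of_nonneg (hU0 i ω)]; exact hU1 i ω)
  let N : Finset ℕ → Ω → ℝ := fun s ω => ∑ i ∈ s, U i ω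
  have hNm : ∀ s, Measurable (N s) := fun s => Finset.measurable_fun_sum _ fun i _ => hU i
  have hN0 : ∀ s ω, 0 ≤ N s ω := fun s ω => Finset.sum_nonneg fun i _ => hU0 i ω
  set R := Finset.range n with hR
  -- independence of one point from the others
  have hI : ∀ i ∈ R, ∀ (φ : ℝ × ℝ → ℝ) (ψ : (↥(R.erase i) → ℝ × ℝ) → ℝ), Measurable φ → Measurable ψ →
      ∫ ω, φ (U i ω, V i ω) * ψ (fun k => (U k ω, V k ω)) ∂P
        = (∫ ω, φ (U i ω, V i ω) ∂P) * ∫ ω, ψ (fun k => (U k ω, V k ω)) ∂P := by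
    intro i hi φ ψ hφ hψ
    have h := hind.indepFun_finset {i} (R.erase i) (by simp) (fun i => (hU i).prodMk (hV i))
    have h2 := h.comp (φ := fun g : ↥({i} : Finset ℕ) → ℝ × ℝ => φ (g ⟨i, by simp⟩)) (ψ := ψ)
      (hφ.comp (measurable_pi_apply _)) hψ
    refine h2.integral_fun_mul_eq_mul_integral ?_ ?_
    · exact (hφ.comp ((hU i).prodMk (hV i))).aestronglyMeasurable
    · refine (hψ.comp ?_).aestronglyMeasurable
      exact measurable_pi_lambda _ fun k => (hU k).prodMk (hV k)
  -- cross terms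
  have hVV : ∀ i j, Integrable (fun ω => V i ω * V j ω) P := by
    intro i j
    refine ((hV2 i).add (hV2 j)).mono' ((hV i).mul (hV j)).aestronglyMeasurable ?_
    refine Eventually.of_forall fun ω => ?_
    rw [Real.norm_eq_abs, abs_le]
    simp only [Pi.add_apply]
    constructor <;> nlinarith [sq_nonneg (V i ω + V j ω), sq_nonneg (V i ω - V j ω), sq_nonneg (V i ω), sq_nonneg (V j ω)]
  have hNN : ∀ i ∈ R, ∀ ω, N R ω = U i ω + N (R.erase i) ω := fun i hi ω =>
    (Finset.add_sum_erase R (fun k => U k ω) hi).symm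
  have hitg : ∀ i ∈ R, ∀ j ∈ R, Integrable (fun ω => V i ω * V j ω / N R ω ^ 2) P := by
    intro i hi j hj
    refine (hVV i j).norm.mono' (((hV i).mul (hV j)).div ((hNm R).pow_const 2)).aestronglyMeasurable ?_
    refine Eventually.of_forall fun ω => ?_
    rcases hU01 i ω with h | h
    · simp [hUV i ω h]
    · rw [norm_div]
      apply div_le_self (norm_nonneg _)
      rw [norm_pow, Real.norm_of_nonneg (hN0 R ω)]
      apply one_le_pow₀
      rw [hNN i hi ω, h]
      linarith [hN0 (R.erase i) ω]
  have hcross : ∀ i ∈ R, ∀ j ∈ R, i ≠ j → ∫ ω, V i ω * V j ω / N R ω ^ 2 ∂P = 0 := by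
    intro i hi j hj hij
    have hji : j ∈ R.erase i := Finset.mem_erase.2 ⟨hij.symm, hj⟩
    have h := hI i hi (fun z => z.2) (fun g => (g ⟨j, hji⟩).2 / (1 + ∑ k, (g k).1) ^ 2)
      (by fun_prop) (by fun_prop)
    rw [hEV i, zero_mul] at h
    rw [← h]
    refine integral_congr_ae (Eventually.of_forall fun ω => ?_)
    simp only
    rcases hU01 i ω with h | h
    · simp [hUV i ω h]
    · rw [hNN i hi ω, h, mul_div_assoc]
      congr 4
      exact (Finset.sum_coe_sort (R.erase i) (fun k => U k ω)).symm
  have hUint : ∀ i ∈ R, Integrable (fun ω => U i ω / N R ω ^ 2) P := by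
    intro i hi
    refine (hUi i).mono' ((hU i).div ((hNm R).pow_const 2)).aestronglyMeasurable ?_
    refine Eventually.of_forall fun ω => ?_
    rw [Real.norm_of_nonneg (div_nonneg (hU0 i ω) (by positivity))]
    rcases hU01 i ω with h | h
    · simp [h]
    · apply div_le_self (hU0 i ω)
      apply one_le_pow₀
      rw [hNN i hi ω, h]
      linarith [hN0 (R.erase i) ω]
  have hdiag : ∀ i ∈ R, ∫ ω, V i ω * V i ω / N R ω ^ 2 ∂P ≤ M * ∫ ω, U i ω / N R ω ^ 2 ∂P := by
    intro i hi
    have h1 := hI i hi (fun z => z.2 ^ 2) (fun g => 1 / (1 + ∑ k, (g k).1) ^ 2)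
      (by fun_prop) (by fun_prop)
    have h2 := hI i hi (fun z => z.1) (fun g => 1 / (1 + ∑ k, (g k).1) ^ 2)
      (by fun_prop) (by fun_prop)
    have e1 : ∫ ω, V i ω * V i ω / N R ω ^ 2 ∂P = ∫ ω, V i ω ^ 2 * (1 / (1 + ∑ k : ↥(R.erase i), U k ω) ^ 2) ∂P := by
      refine integral_congr_ae (Eventually.of_forall fun ω => ?_)
      simp only
      rcases hU01 i ω with h | h
      · simp [hUV i ω h]
      · rw [hNN i hi ω, h, Finset.sum_coe_sort (R.erase i) (fun k => U k ω)]
        ring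
    have e2 : ∫ ω, U i ω / N R ω ^ 2 ∂P = ∫ ω, U i ω * (1 / (1 + ∑ k : ↥(R.erase i), U k ω) ^ 2) ∂P := by
      refine integral_congr_ae (Eventually.of_forall fun ω => ?_)
      simp only
      rcases hU01 i ω with h | h
      · simp [h]
      · rw [hNN i hi ω, h, Finset.sum_coe_sort (R.erase i) (fun k => U k ω)]
        ring
    rw [e1, e2, h1, h2, hEU i, ← mul_assoc]
    refine mul_le_mul_of_nonneg_right (hEV2 i) (integral_nonneg fun ω => ?_)
    positivity
  have eS : ∀ ω, ((∑ i ∈ R, V i ω) / (∑ i ∈ R, U i ω)) ^ 2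
      = ∑ i ∈ R, ∑ j ∈ R, V i ω * V j ω / N R ω ^ 2 := by
    intro ω
    rw [div_pow, sq (∑ i ∈ R, V i ω), Finset.sum_mul_sum, Finset.sum_div]
    refine Finset.sum_congr rfl fun i _ => ?_
    rw [Finset.sum_div]
  have hSint : Integrable (fun ω => ((∑ i ∈ R, V i ω) / (∑ i ∈ R, U i ω)) ^ 2) P := by
    simp only [eS]
    exact integrable_finsetSum _ fun i hi => integrable_finsetSum _ fun j hj => hitg i hi j hj
  have hSle : ∫ ω, ((∑ i ∈ R, V i ω) / (∑ i ∈ R, U i ω)) ^ 2 ∂P ≤ ∫ ω, M * ∑ i ∈ R, U i ω / N R ω ^ 2 ∂P := by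
    simp only [eS]
    rw [integral_finsetSum _ fun i hi => integrable_finsetSum _ fun j hj => hitg i hi j hj,
      integral_const_mul, integral_finsetSum _ hUint, Finset.mul_sum]
    refine Finset.sum_le_sum fun i hi => ?_
    rw [integral_finsetSum _ fun j hj => hitg i hi j hj,
      Finset.sum_eq_single i (fun j hj hji => hcross i hi j hj hji.symm) (fun h => absurd hi h)]
    exact hdiag i hi
  have hZint : Integrable (fun ω => M * (if ∑ i ∈ R, U i ω = 0 then (1:ℝ) else 0)) P := by
    refine Integrable.const_mul ?_ _
    refine (integrable_const (1:ℝ)).mono' (Measurable.ite (hNm R (measurableSet_singleton 0))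
      measurable_const measurable_const).aestronglyMeasurable (Eventually.of_forall fun ω => ?_)
    split_ifs <;> simp
  refine ⟨hSint.add hZint, ?_⟩
  rw [integral_add hSint hZint]
  have hMint : Integrable (fun ω => M * ∑ i ∈ R, U i ω / N R ω ^ 2) P :=
    (integrable_finsetSum _ hUint).const_mul _
  refine (add_le_add_left hSle _).trans ?_
  rw [← integral_add hMint hZint]
  -- Chebyshev
  have hs : (0:ℝ) < n * p := by positivity
  have hvar : ∫ ω, (N R ω - n * p) ^ 2 ∂P ≤ n * p := by
    have hL2 : ∀ i, MemLp (U i) 2 P := fun i => by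
      refine MemLp.of_bound (hU i).aestronglyMeasurable 1 (Eventually.of_forall fun ω => ?_)
      rw [Real.norm_of_nonneg (hU0 i ω)]; exact hU1 i ω
    have h := IndepFun.variance_sum (s := R) (X := U) (μ := P) (fun i _ => hL2 i) (by
      intro i _ j _ hij
      exact (hind.indepFun hij).comp measurable_fst measurable_fst)
    have hEN : ∫ ω, (∑ i ∈ R, U i) ω ∂P = n * p := by
      simp only [Finset.sum_apply]
      rw [integral_finsetSum _ fun i _ => hUi i]
      simp [hEU, hR]
    rw [variance_eq_integral (by exact (Finset.aemeasurable_sum _ fun i _ => (hU i).aemeasurable)), hEN] at h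
    simp only [Finset.sum_apply] at h
    rw [show (∫ ω, (N R ω - n * p) ^ 2 ∂P) = _ from h]
    have : ∀ i ∈ R, Var[U i; P] ≤ p := by
      intro i _
      refine (variance_le_expectation_sq (hU i).aestronglyMeasurable).trans ?_
      rw [← hEU i]
      refine le_of_eq (integral_congr_ae (Eventually.of_forall fun ω => ?_))
      rcases hU01 i ω with h | h <;> simp [h]
    refine (Finset.sum_le_card_nsmul _ _ _ this).trans ?_
    simp [hR]
  have hN2int : Integrable (fun ω => (N R ω - n * p) ^ 2) P := by
    have : MemLp (fun ω => N R ω - n * p) 2 P := by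
      refine MemLp.of_bound ((hNm R).sub measurable_const).aestronglyMeasurable (n + n * p) (Eventually.of_forall fun ω => ?_)
      refine (norm_sub_le _ _).trans ?_
      rw [Real.norm_of_nonneg hs.le, Real.norm_of_nonneg (hN0 R ω)]
      gcongr
      calc N R ω ≤ ∑ i ∈ R, 1 := Finset.sum_le_sum fun i _ => hU1 i ω
        _ = n := by simp [hR]
    exact this.integrable_sq
  have hpt : ∀ ω, M * (∑ i ∈ R, U i ω / N R ω ^ 2) + M * (if ∑ i ∈ R, U i ω = 0 then (1:ℝ) else 0)
      ≤ M * (4 / (n * p) + 8 / (n * p) ^ 2 * (N R ω - n * p) ^ 2) := by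
    intro ω
    rw [← mul_add]
    refine mul_le_mul_of_nonneg_left ?_ hM
    rw [← Finset.sum_div]
    change N R ω / N R ω ^ 2 + (if N R ω = 0 then (1:ℝ) else 0) ≤ _
    have hNge : N R ω = 0 ∨ 1 ≤ N R ω := by
      by_cases hz : ∀ i ∈ R, U i ω = 0
      · left; exact Finset.sum_eq_zero hz
      · right
        push Not at hz
        obtain ⟨i, hi, h⟩ := hz
        rw [hNN i hi ω, (hU01 i ω).resolve_left h]
        linarith [hN0 (R.erase i) ω]
    set y := N R ω
    set s : ℝ := n * p
    rcases hNge with h | h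
    · rw [h]
      simp
      have : 8 / s ^ 2 * s ^ 2 = 8 := by field_simp
      have h4 : 0 ≤ 4 / s := by positivity
      linarith
    · rw [if_neg (by linarith), add_zero, show y / y ^ 2 = 1 / y by field_simp]
      have h4 : 0 ≤ 4 / s := by positivity
      have h8 : 0 ≤ 8 / s ^ 2 * (y - s) ^ 2 := by positivity
      by_cases hc : s / 2 ≤ y
      · have : 1 / y ≤ 4 / s := by
          rw [div_le_div_iff₀ (by linarith) hs]; linarith
        linarith
      · push Not at hc
        have h1 : 1 / y ≤ 1 := by rw [div_le_one (by linarith)]; exact h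
        have h2 : 1 ≤ 8 / s ^ 2 * (y - s) ^ 2 := by
          rw [div_mul_eq_mul_div, le_div_iff₀ (by positivity)]
          nlinarith
        linarith
  refine (integral_mono (hMint.add hZint) (((integrable_const _).add (hN2int.const_mul _)).const_mul M) hpt).trans ?_
  rw [integral_const_mul, integral_add' (integrable_const _) (hN2int.const_mul _), integral_const_mul]
  simp only [integral_const, probReal_univ, one_smul]
  have : 8 / (n * p) ^ 2 * ∫ ω, (N R ω - n * p) ^ 2 ∂P ≤ 8 / (n * p) := by
    calc _ ≤ 8 / (n * p) ^ 2 * (n * p) := by gcongr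
      _ = _ := by field_simp
  calc _ ≤ M * (4 / (n * p) + 8 / (n * p)) := by gcongr
    _ = _ := by ring

lemma unitBox_compact (d : ℕ) : IsCompact (unitBox d) :=
  isCompact_univ_pi fun _ => isCompact_Icc

lemma ind_box_meas {d : ℕ} (g : (Fin d → ℝ) → ℝ) (hg : ContinuousOn g (unitBox d)) :
    Measurable ((unitBox d).indicator g) := by
  have hm := (unitBox_compact d).measurableSet
  have h := ContinuousOn.measurable_piecewise (g := fun _ : Fin d → ℝ => (0:ℝ)) hg continuousOn_const hm
  convert h using 1
  ext z
  by_cases hz : z ∈ unitBox d <;> simp [hz]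

lemma holder_cont {d : ℕ} {β : ℝ} (g : (Fin d → ℝ) → ℝ) (hg : IsHolderOn β g) :
    ContinuousOn g (unitBox d) := hg.1.continuousOn

lemma data_facts {Ω : Type*} [MeasurableSpace Ω] (P : Measure Ω) [IsProbabilityMeasure P]
    {d : ℕ} (X : Ω → Fin d → ℝ) (Y : Ω → ℝ) (hXm : Measurable X) (hYm : Measurable Y)
    (f : (Fin d → ℝ) → ℝ)
    (hXd : Measure.map X P = volume.withDensity fun z => ENNReal.ofReal (f z))
    (hf_pos : ∃ c > (0:ℝ), ∀ z ∈ unitBox d, c ≤ f z)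
    (hf_supp : ∀ z, z ∉ unitBox d → f z = 0)
    (hfc : ContinuousOn f (unitBox d))
    (μreg : (Fin d → ℝ) → ℝ)
    (hμ : P[Y|MeasurableSpace.comap X inferInstance] =ᵐ[P] fun ω => μreg (X ω))
    (hμc : ContinuousOn μreg (unitBox d))
    (M : ℝ) (hY2 : ∀ᵐ ω ∂P,
      (P[fun ω' => (Y ω') ^ 2|MeasurableSpace.comap X inferInstance]) ω ≤ M)
    (σ2 : (Fin d → ℝ) → ℝ)
    (hσ : P[fun ω' => (Y ω' - μreg (X ω')) ^ 2|MeasurableSpace.comap X inferInstance]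
      =ᵐ[P] fun ω => σ2 (X ω))
    (hσ_pos : ∃ c > (0:ℝ), ∀ z ∈ unitBox d, c ≤ σ2 z) :
    MemLp Y 2 P ∧ ∀ T : Set (Fin d → ℝ), MeasurableSet T →
      ∫ ω, T.indicator (fun _ => (1:ℝ)) (X ω) ∂P = ∫ z in T, f z ∧
      ∫ ω, Y ω * T.indicator (fun _ => (1:ℝ)) (X ω) ∂P = ∫ z in T, μreg z * f z ∧
      ∫ ω, Y ω ^ 2 * T.indicator (fun _ => (1:ℝ)) (X ω) ∂P ≤ M * ∫ z in T, f z := by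
  have hbm := (unitBox_compact d).measurableSet
  have hf0 : ∀ z, 0 ≤ f z := by
    intro z
    by_cases hz : z ∈ unitBox d
    · obtain ⟨c, hc, h⟩ := hf_pos
      exact hc.le.trans (h z hz)
    · rw [hf_supp z hz]
  have hfm : Measurable f := by
    have : f = (unitBox d).indicator f := by
      ext z
      by_cases hz : z ∈ unitBox d
      · simp [hz]
      · simp [hz, hf_supp z hz]
    rw [this]; exact ind_box_meas f hfc
  have hXbox : ∀ᵐ ω ∂P, X ω ∈ unitBox d := by
    have h : ∀ᵐ z ∂(Measure.map X P), z ∈ unitBox d := by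
      rw [hXd, ae_withDensity_iff (by fun_prop)]
      refine Eventually.of_forall fun z hz => ?_
      by_contra h
      exact hz (by simp [hf_supp z h])
    exact ae_of_ae_map hXm.aemeasurable h
  set μ' := (unitBox d).indicator μreg with hμ'
  have hμ'm : Measurable μ' := ind_box_meas μreg hμc
  have hμeq : (fun ω => μreg (X ω)) =ᵐ[P] fun ω => μ' (X ω) := by
    filter_upwards [hXbox] with ω hω
    simp [hμ', hω]
  obtain ⟨K, hK⟩ := (unitBox_compact d).exists_bound_of_continuousOn hμc
  have hsub : MeasurableSpace.comap X inferInstance ≤ (inferInstance : MeasurableSpace Ω) := hXm.comap_le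
  have hμL : MemLp (fun ω => μ' (X ω)) 2 P := by
    refine MemLp.of_bound (hμ'm.comp hXm).aestronglyMeasurable K ?_
    filter_upwards [hXbox] with ω hω
    simp only [hμ', Set.indicator_of_mem hω]
    exact hK _ hω
  have hYL : MemLp Y 2 P := by
    have h1 : Integrable (fun ω => (Y ω - μreg (X ω)) ^ 2) P := by
      by_contra hni
      rw [condExp_of_not_integrable hni] at hσ
      obtain ⟨c, hc, h⟩ := hσ_pos
      have : ∀ᵐ ω ∂P, False := by
        filter_upwards [hσ, hXbox] with ω h1 h2
        have := h _ h2
        simp at h1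
        linarith
      simp only [eventually_false_iff_eq_bot, ae_eq_bot] at this
      exact IsProbabilityMeasure.ne_zero P this
    have h2 : Integrable (fun ω => (Y ω - μ' (X ω)) ^ 2) P := by
      refine h1.congr ?_
      filter_upwards [hμeq] with ω hω
      rw [hω]
    have h3 : MemLp (fun ω => Y ω - μ' (X ω)) 2 P :=
      (memLp_two_iff_integrable_sq (hYm.sub (hμ'm.comp hXm)).aestronglyMeasurable).2 h2
    have := h3.add hμL
    refine this.ae_eq (Eventually.of_forall fun ω => ?_)
    simp
  refine ⟨hYL, ?_⟩
  intro T hT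
  have hTm : MeasurableSet[MeasurableSpace.comap X inferInstance] (X ⁻¹' T) := ⟨T, hT, rfl⟩
  have hind : ∀ (g : Ω → ℝ), ∫ ω, g ω * T.indicator (fun _ => (1:ℝ)) (X ω) ∂P = ∫ ω in X ⁻¹' T, g ω ∂P := by
    intro g
    rw [← integral_indicator (hXm hT)]
    refine integral_congr_ae (Eventually.of_forall fun ω => ?_)
    by_cases h : X ω ∈ T
    · simp [h]
    · simp [h]
  have key : ∀ g : (Fin d → ℝ) → ℝ, Measurable g → ∫ ω in X ⁻¹' T, g (X ω) ∂P = ∫ z in T, g z * f z := by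
    intro g hg
    rw [← setIntegral_map hT hg.aestronglyMeasurable hXm.aemeasurable, hXd,
      setIntegral_withDensity_eq_setIntegral_toReal_smul (by fun_prop)
        (Eventually.of_forall fun z => by simp) _ hT]
    refine integral_congr_ae (Eventually.of_forall fun z => ?_)
    simp [ENNReal.toReal_ofReal (hf0 z), mul_comm]
  have k1 := key (fun _ => 1) measurable_const
  simp only [one_mul] at k1
  refine ⟨?_, ?_, ?_⟩
  · rw [← k1, ← hind]; simp
  · rw [hind, ← setIntegral_condExp hsub (hYL.integrable one_le_two) hTm,
      setIntegral_congr_ae (g := fun ω => μ' (X ω)) (hXm hT) (by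
        filter_upwards [hμ, hμeq] with ω h1 h2 _
        rw [h1]; exact h2), key μ' hμ'm]
    refine integral_congr_ae (Eventually.of_forall fun z => ?_)
    by_cases h : z ∈ unitBox d
    · simp [hμ', h]
    · simp [hf_supp z h]
  · rw [hind, ← setIntegral_condExp hsub hYL.integrable_sq hTm, ← k1, ← integral_const_mul]
    refine integral_mono_ae integrable_condExp.integrableOn (integrable_const _) ?_
    filter_upwards [ae_restrict_of_ae hY2] with ω h
    simpa using h

/-- ratio estimate on the set `T` from the first `n` data points -/
def ratioEst {d : ℕ} (T : Set (Fin d → ℝ)) (n : ℕ) (D : ℕ → (Fin d → ℝ) × ℝ) : ℝ :=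
  (∑ i ∈ Finset.range n, (D i).2 * T.indicator (fun _ => (1:ℝ)) (D i).1) /
    (∑ i ∈ Finset.range n, T.indicator (fun _ => (1:ℝ)) (D i).1)

lemma tree_var {Ω : Type*} [MeasurableSpace Ω] (P : Measure Ω) [IsProbabilityMeasure P]
    {d : ℕ} (X : ℕ → Ω → Fin d → ℝ) (Y : ℕ → Ω → ℝ) (hXm : ∀ i, Measurable (X i))
    (hYm : ∀ i, Measurable (Y i)) (hiid : iIndepFun (fun i ω => (X i ω, Y i ω)) P)
    (hYL : ∀ i, MemLp (Y i) 2 P) (T : Set (Fin d → ℝ)) (hT : MeasurableSet T)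
    (p q M : ℝ) (hp : 0 < p)
    (h1 : ∀ i, ∫ ω, T.indicator (fun _ => (1:ℝ)) (X i ω) ∂P = p)
    (h2 : ∀ i, ∫ ω, Y i ω * T.indicator (fun _ => (1:ℝ)) (X i ω) ∂P = q)
    (h3 : ∀ i, ∫ ω, Y i ω ^ 2 * T.indicator (fun _ => (1:ℝ)) (X i ω) ∂P ≤ M * p) :
    (q / p) ^ 2 ≤ M ∧ ∀ n : ℕ, 0 < n →
    ∫⁻ ω, ENNReal.ofReal ((ratioEst T n (fun i => (X i ω, Y i ω)) - q / p) ^ 2) ∂P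
      ≤ ENNReal.ofReal (12 * M / (n * p)) := by
  set m := q / p with hm
  have hq : q = m * p := by rw [hm]; field_simp
  set U : ℕ → Ω → ℝ := fun i ω => T.indicator (fun _ => (1:ℝ)) (X i ω) with hUdef
  have hUm : ∀ i, Measurable (U i) := fun i => (measurable_const.indicator hT).comp (hXm i)
  have hU01 : ∀ i ω, U i ω = 0 ∨ U i ω = 1 := by
    intro i ω
    by_cases h : X i ω ∈ T
    · right; simp [hUdef, h]
    · left; simp [hUdef, h]
  have hUb : ∀ i, ∀ᵐ ω ∂P, ‖U i ω‖ ≤ 1 := fun i => Eventually.of_forall fun ω => by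
    rcases hU01 i ω with h | h <;> simp [h]
  have hUi : ∀ i, Integrable (U i) P := fun i =>
    (integrable_const (1:ℝ)).mono' (hUm i).aestronglyMeasurable (hUb i)
  have hYU : ∀ i, Integrable (fun ω => Y i ω * U i ω) P := fun i =>
    ((hYL i).integrable one_le_two).mul_bdd (c := 1) (hUm i).aestronglyMeasurable (hUb i)
  have hY2U : ∀ i, Integrable (fun ω => Y i ω ^ 2 * U i ω) P := fun i =>
    ((hYL i).integrable_sq).mul_bdd (c := 1) (hUm i).aestronglyMeasurable (hUb i)
  set V : ℕ → Ω → ℝ := fun i ω => (Y i ω - m) * U i ω with hVdef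
  have hVm : ∀ i, Measurable (V i) := fun i => ((hYm i).sub measurable_const).mul (hUm i)
  have hEV : ∀ i, ∫ ω, V i ω ∂P = 0 := by
    intro i
    have : ∀ ω, V i ω = Y i ω * U i ω - m * U i ω := fun ω => by simp only [hVdef]; ring
    simp only [this]
    rw [integral_sub (hYU i) ((hUi i).const_mul m), integral_const_mul, h1 i, h2 i, hq]
    ring
  have eV2 : ∀ i ω, V i ω ^ 2 = Y i ω ^ 2 * U i ω - 2 * m * (Y i ω * U i ω) + m ^ 2 * U i ω := by
    intro i ω
    simp only [hVdef]
    rcases hU01 i ω with h | h <;> rw [h] <;> ring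
  have hV2 : ∀ i, Integrable (fun ω => V i ω ^ 2) P := by
    intro i
    simp only [eV2]
    exact ((hY2U i).sub ((hYU i).const_mul _)).add ((hUi i).const_mul _)
  have hEV2' : ∀ i, ∫ ω, V i ω ^ 2 ∂P ≤ M * p - m ^ 2 * p := by
    intro i
    simp only [eV2]
    have hA : Integrable (fun ω => Y i ω ^ 2 * U i ω - 2 * m * (Y i ω * U i ω)) P :=
      (hY2U i).sub ((hYU i).const_mul _)
    rw [integral_add hA ((hUi i).const_mul _),
      integral_sub (hY2U i) ((hYU i).const_mul _), integral_const_mul, integral_const_mul, h1 i, h2 i]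
    have := h3 i
    rw [hq]
    nlinarith
  have hmM : m ^ 2 ≤ M := by
    have : 0 ≤ ∫ ω, V 0 ω ^ 2 ∂P := integral_nonneg fun ω => sq_nonneg _
    have h := this.trans (hEV2' 0)
    nlinarith
  have hEV2 : ∀ i, ∫ ω, V i ω ^ 2 ∂P ≤ M * p := fun i => (hEV2' i).trans (by nlinarith [mul_nonneg (sq_nonneg m) hp.le])
  refine ⟨hmM, fun n hn => ?_⟩
  have hind : iIndepFun (fun i ω => (U i ω, V i ω)) P := by
    have := hiid.comp (fun _ => fun z : (Fin d → ℝ) × ℝ =>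
      (T.indicator (fun _ => (1:ℝ)) z.1, (z.2 - m) * T.indicator (fun _ => (1:ℝ)) z.1)) (fun _ => by
        have : Measurable fun z : (Fin d → ℝ) × ℝ => T.indicator (fun _ => (1:ℝ)) z.1 :=
          (measurable_const.indicator hT).comp measurable_fst
        fun_prop)
    exact this
  obtain ⟨g1, g2⟩ := ratio_var P U V hUm hVm hind hU01 (fun i ω h => by simp [hVdef, h]) M p hp
    ((sq_nonneg _).trans hmM) h1 hEV hV2 hEV2 n hn
  have hM0 : 0 ≤ M := (sq_nonneg _).trans hmM
  refine le_trans ?_ (ENNReal.ofReal_le_ofReal g2)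
  rw [ofReal_integral_eq_lintegral_ofReal g1 (Eventually.of_forall fun ω => by
    simp only [Pi.zero_apply]; split_ifs <;> positivity)]
  refine lintegral_mono fun ω => ENNReal.ofReal_le_ofReal ?_
  change ((∑ i ∈ Finset.range n, Y i ω * U i ω) / (∑ i ∈ Finset.range n, U i ω) - m) ^ 2 ≤ _
  have eS : ∑ i ∈ Finset.range n, V i ω = ∑ i ∈ Finset.range n, Y i ω * U i ω - m * ∑ i ∈ Finset.range n, U i ω := by
    rw [Finset.mul_sum, ← Finset.sum_sub_distrib]
    exact Finset.sum_congr rfl fun i _ => by simp only [hVdef]; ring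
  by_cases hN : ∑ i ∈ Finset.range n, U i ω = 0
  · rw [if_pos hN, hN]
    simpa using hmM
  · rw [if_neg hN, eS, sub_div, mul_div_assoc, div_self hN]
    simp

lemma cell_subset_box {d : ℕ} (x : Fin d → ℝ) (lam : ℝ)
    (e : Fin d × Bool → ℝ) : cell x lam e ⊆ unitBox d := by
  intro z hz j _
  obtain ⟨h1, h2⟩ := hz j
  constructor
  · have := min_le_right (e (j, false) / lam) (x j)
    linarith
  · have := min_le_right (e (j, true) / lam) (1 - x j)
    linarith

lemma cell_vol {d : ℕ} (x : Fin d → ℝ) (hx : ∀ j, x j ∈ Set.Ioo (0:ℝ) 1) (lam : ℝ) (hlam : 0 < lam)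
    (e : Fin d × Bool → ℝ) (he : ∀ p, 0 < e p) :
    volume.real (cell x lam e)
      = ∏ j, (min (e (j, false) / lam) (x j) + min (e (j, true) / lam) (1 - x j)) ∧
    ∀ j, 0 < min (e (j, false) / lam) (x j) + min (e (j, true) / lam) (1 - x j) := by
  have hpos : ∀ j, 0 < min (e (j, false) / lam) (x j) + min (e (j, true) / lam) (1 - x j) := by
    intro j
    have h1 : 0 < min (e (j, false) / lam) (x j) := lt_min (div_pos (he _) hlam) (hx j).1
    have h2 : 0 < min (e (j, true) / lam) (1 - x j) := lt_min (div_pos (he _) hlam) (by linarith [(hx j).2])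
    linarith
  refine ⟨?_, hpos⟩
  rw [cell_eq_Icc, Measure.real, Real.volume_Icc_pi, ENNReal.toReal_prod]
  refine Finset.prod_congr rfl fun j _ => ?_
  have e1 : x j + min (e (j, true) / lam) (1 - x j) - (x j - min (e (j, false) / lam) (x j))
    = min (e (j, false) / lam) (x j) + min (e (j, true) / lam) (1 - x j) := by ring
  rw [e1, ENNReal.toReal_ofReal (hpos j).le]

lemma side_bound (δ : ℝ) (hδ : 0 < δ) (lam : ℝ) (hlam : 1 ≤ lam) (s t u v : ℝ) (hs : 0 < s) (ht : 0 < t)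
    (hu : δ ≤ u) (hv : δ ≤ v) :
    (min (s / lam) u + min (t / lam) v)⁻¹
      ≤ lam * ((|s| ^ (-(1/2) : ℝ) + δ ^ (-(1/2) : ℝ)) * (|t| ^ (-(1/2) : ℝ) + δ ^ (-(1/2) : ℝ))) := by
  have key : ∀ s u : ℝ, 0 < s → δ ≤ u →
      0 < |s| ^ (-(1/2) : ℝ) + δ ^ (-(1/2) : ℝ) ∧
      lam⁻¹ * (|s| ^ (-(1/2) : ℝ) + δ ^ (-(1/2) : ℝ))⁻¹ ^ 2 ≤ min (s / lam) u := by
    intro s u hs hu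
    rw [abs_of_pos hs]
    have p1 : 0 < s ^ (-(1/2) : ℝ) := Real.rpow_pos_of_pos hs _
    have p2 : 0 < δ ^ (-(1/2) : ℝ) := Real.rpow_pos_of_pos hδ _
    have q1 : (s ^ (-(1/2) : ℝ))⁻¹ ^ 2 = s := by
      rw [← Real.rpow_neg hs.le, ← Real.rpow_natCast, ← Real.rpow_mul hs.le]; norm_num
    have q2 : (δ ^ (-(1/2) : ℝ))⁻¹ ^ 2 = δ := by
      rw [← Real.rpow_neg hδ.le, ← Real.rpow_natCast, ← Real.rpow_mul hδ.le]; norm_num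
    refine ⟨by positivity, le_min ?_ ?_⟩
    · rw [div_eq_inv_mul s lam]
      refine mul_le_mul_of_nonneg_left ?_ (by positivity)
      calc (s ^ (-(1/2) : ℝ) + δ ^ (-(1/2) : ℝ))⁻¹ ^ 2 ≤ (s ^ (-(1/2) : ℝ))⁻¹ ^ 2 := by
            gcongr; linarith
        _ = s := q1
    · calc lam⁻¹ * (s ^ (-(1/2) : ℝ) + δ ^ (-(1/2) : ℝ))⁻¹ ^ 2 ≤ 1 * (δ ^ (-(1/2) : ℝ))⁻¹ ^ 2 := by
            gcongr
            · exact inv_le_one_of_one_le₀ hlam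
            · linarith
        _ ≤ u := by rw [one_mul, q2]; exact hu
  obtain ⟨h1, h2⟩ := key s u hs hu
  obtain ⟨h3, h4⟩ := key t v ht hv
  set A := |s| ^ (-(1/2) : ℝ) + δ ^ (-(1/2) : ℝ)
  set B := |t| ^ (-(1/2) : ℝ) + δ ^ (-(1/2) : ℝ)
  have hl : 0 < lam := by linarith
  rw [show lam * (A * B) = (lam⁻¹ * (A⁻¹ * B⁻¹))⁻¹ by
    rw [mul_inv, mul_inv, inv_inv, inv_inv, inv_inv]]
  refine inv_anti₀ (by positivity) ?_
  calc lam⁻¹ * (A⁻¹ * B⁻¹) ≤ lam⁻¹ * (A⁻¹ ^ 2 + B⁻¹ ^ 2) := by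
        gcongr
        have : 0 < A⁻¹ * B⁻¹ := by positivity
        nlinarith [sq_nonneg (A⁻¹ - B⁻¹)]
    _ = lam⁻¹ * A⁻¹ ^ 2 + lam⁻¹ * B⁻¹ ^ 2 := by ring
    _ ≤ _ := add_le_add h2 h4

lemma inv_vol_bound {d : ℕ} (x : Fin d → ℝ) (hx : ∀ j, x j ∈ Set.Ioo (0:ℝ) 1) :
    ∃ H : (Fin d × Bool → ℝ) → ℝ, Integrable H (expPi d) ∧ ∀ lam, 1 ≤ lam → ∀ e, (∀ p, 0 < e p) →
      0 < volume.real (cell x lam e) ∧ (volume.real (cell x lam e))⁻¹ ≤ lam ^ d * H e := by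
  obtain ⟨δ, hδ, hδ1, hδx⟩ := exists_delta x hx
  refine ⟨fun e => ∏ p, (|e p| ^ (-(1/2) : ℝ) + δ ^ (-(1/2) : ℝ)), ?_, ?_⟩
  · exact Integrable.fintype_prod (f := fun _ : Fin d × Bool => fun t : ℝ => (|t| ^ (-(1/2) : ℝ) + δ ^ (-(1/2) : ℝ)))
      (fun _ => (expMeasure_integrable _ (by norm_num)).add (integrable_const _))
  · intro lam hlam e he
    obtain ⟨h1, h2⟩ := cell_vol x hx lam (by linarith) e he
    rw [h1]
    refine ⟨Finset.prod_pos fun j _ => h2 j, ?_⟩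
    rw [← Finset.prod_inv_distrib]
    simp only [Fintype.prod_prod_type]
    have e1 : lam ^ d = ∏ _j : Fin d, lam := by simp
    rw [e1, ← Finset.prod_mul_distrib]
    refine Finset.prod_le_prod (fun j _ => (inv_pos.2 (h2 j)).le) fun j _ => ?_
    rw [Fintype.prod_bool, mul_comm (|e (j, true)| ^ (-(1/2) : ℝ) + δ ^ (-(1/2) : ℝ))]
    exact side_bound δ hδ lam hlam _ _ _ _ (he _) (he _) (hδx j).1 (hδx j).2

lemma cell_prob_lower {d : ℕ} (f : (Fin d → ℝ) → ℝ) (c : ℝ) (hf : ∀ z ∈ unitBox d, c ≤ f z)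
    (hfc : ContinuousOn f (unitBox d)) (x : Fin d → ℝ) (lam : ℝ) (e : Fin d × Bool → ℝ) :
    c * volume.real (cell x lam e) ≤ ∫ z in cell x lam e, f z := by
  have hsub := cell_subset_box x lam e
  have hitg : IntegrableOn f (cell x lam e) :=
    (hfc.integrableOn_compact (unitBox_compact d)).mono_set hsub
  have hfin : volume (cell x lam e) ≠ ⊤ :=
    ((measure_mono hsub).trans_lt (unitBox_compact d).measure_lt_top).ne
  have h := setIntegral_mono_on (f := fun _ => c) (integrableOn_const hfin) hitg (cell_meas x lam e)
    fun z hz => hf z (hsub hz)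
  rw [setIntegral_const, smul_eq_mul] at h
  linarith

lemma cell_int_meas {d : ℕ} (x : Fin d → ℝ) (lam : ℝ) (φ : (Fin d → ℝ) → ℝ)
    (hφ : ContinuousOn φ (unitBox d)) :
    Measurable (fun e : Fin d × Bool → ℝ => ∫ u in cell x lam e, φ u) := by
  have e1 : (fun e : Fin d × Bool → ℝ => ∫ u in cell x lam e, φ u)
      = fun e => ∫ u, ({q : (Fin d × Bool → ℝ) × (Fin d → ℝ) | q.2 ∈ cell x lam q.1}.indicator
          (fun q => (unitBox d).indicator φ q.2)) (e, u) := by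
    ext e
    rw [← integral_indicator (cell_meas x lam e)]
    refine integral_congr_ae (Eventually.of_forall fun z => ?_)
    by_cases hz : z ∈ cell x lam e
    · have := cell_subset_box x lam e hz
      simp [Set.indicator, hz, this]
    · simp [Set.indicator, hz]
  rw [e1]
  have hm : StronglyMeasurable ({q : (Fin d × Bool → ℝ) × (Fin d → ℝ) | q.2 ∈ cell x lam q.1}.indicator
          (fun q => (unitBox d).indicator φ q.2)) :=
    (((ind_box_meas φ hφ).comp measurable_snd).indicator (cell_joint_meas x lam)).stronglyMeasurable
  exact hm.integral_prod_right'.measurable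

lemma Mc_meas {d : ℕ} (f μ : (Fin d → ℝ) → ℝ) (hf : ContinuousOn f (unitBox d))
    (hμ : ContinuousOn μ (unitBox d)) (x : Fin d → ℝ) (lam : ℝ) : Measurable (Mc f μ x lam) :=
  (cell_int_meas x lam _ (hμ.mul hf)).div (cell_int_meas x lam _ hf)

lemma ratioEst_meas {d : ℕ} (x : Fin d → ℝ) (lam : ℝ) (n : ℕ) :
    Measurable (fun q : (Fin d × Bool → ℝ) × (ℕ → (Fin d → ℝ) × ℝ) =>
      ratioEst (cell x lam q.1) n q.2) := by
  unfold ratioEst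
  have h : ∀ i : ℕ, Measurable (fun q : (Fin d × Bool → ℝ) × (ℕ → (Fin d → ℝ) × ℝ) =>
      (cell x lam q.1).indicator (fun _ => (1:ℝ)) (q.2 i).1) := by
    intro i
    have h0 : Measurable ({q : (Fin d × Bool → ℝ) × (Fin d → ℝ) | q.2 ∈ cell x lam q.1}.indicator
        (fun _ => (1:ℝ))) := measurable_const.indicator (cell_joint_meas x lam)
    have h1 : Measurable (fun q : (Fin d × Bool → ℝ) × (ℕ → (Fin d → ℝ) × ℝ) => (q.1, (q.2 i).1)) := by
      fun_prop
    exact h0.comp h1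
  refine Measurable.div ?_ ?_
  · exact Finset.measurable_fun_sum _ fun i _ => Measurable.mul (by fun_prop) (h i)
  · exact Finset.measurable_fun_sum _ fun i _ => h i

lemma tree_noise {Ω : Type*} [MeasurableSpace Ω] (P : Measure Ω) [IsProbabilityMeasure P]
    {d : ℕ} (X : ℕ → Ω → Fin d → ℝ) (Y : ℕ → Ω → ℝ) (hXm : ∀ i, Measurable (X i))
    (hYm : ∀ i, Measurable (Y i)) (hiid : iIndepFun (fun i ω => (X i ω, Y i ω)) P)
    (hYL : ∀ i, MemLp (Y i) 2 P) (f μ : (Fin d → ℝ) → ℝ) (c M : ℝ) (hc : 0 < c)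
    (hf : ∀ z ∈ unitBox d, c ≤ f z)
    (hfc : ContinuousOn f (unitBox d)) (hμc : ContinuousOn μ (unitBox d))
    (hT : ∀ i, ∀ T : Set (Fin d → ℝ), MeasurableSet T →
      ∫ ω, T.indicator (fun _ => (1:ℝ)) (X i ω) ∂P = ∫ z in T, f z ∧
      ∫ ω, Y i ω * T.indicator (fun _ => (1:ℝ)) (X i ω) ∂P = ∫ z in T, μ z * f z ∧
      ∫ ω, Y i ω ^ 2 * T.indicator (fun _ => (1:ℝ)) (X i ω) ∂P ≤ M * ∫ z in T, f z)
    (x : Fin d → ℝ) (hx : ∀ j, x j ∈ Set.Ioo (0:ℝ) 1) :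
    (∀ lam, 0 < lam → ∀ e : Fin d × Bool → ℝ, (∀ p, 0 < e p) → |Mc f μ x lam e| ≤ Real.sqrt M) ∧
    ∃ K > (0:ℝ), ∀ lam, 1 ≤ lam → ∀ n : ℕ, 0 < n → ∀ E : Ω → Fin d × Bool → ℝ, Measurable E →
      Measure.map E P = expPi d → IndepFun E (fun ω i => (X i ω, Y i ω)) P →
      Integrable (fun ω => (ratioEst (cell x lam (E ω)) n (fun i => (X i ω, Y i ω))
          - Mc f μ x lam (E ω)) ^ 2) P ∧
      ∫ ω, (ratioEst (cell x lam (E ω)) n (fun i => (X i ω, Y i ω)) - Mc f μ x lam (E ω)) ^ 2 ∂P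
        ≤ K * lam ^ d / n := by
  have hpp : ∀ lam, 0 < lam → ∀ e : Fin d × Bool → ℝ, (∀ p, 0 < e p) → 0 < ∫ z in cell x lam e, f z := by
    intro lam hlam e he
    refine lt_of_lt_of_le ?_ (cell_prob_lower f c hf hfc x lam e)
    obtain ⟨h1, h2⟩ := cell_vol x hx lam hlam e he
    rw [h1]
    exact mul_pos hc (Finset.prod_pos fun j _ => h2 j)
  have htv : ∀ lam : ℝ, 0 < lam → ∀ e : Fin d × Bool → ℝ, (∀ p, 0 < e p) → _ := fun lam hlam e he =>
    tree_var P X Y hXm hYm hiid hYL (cell x lam e) (cell_meas x lam e) _ _ M (hpp lam hlam e he)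
      (fun i => (hT i _ (cell_meas x lam e)).1) (fun i => (hT i _ (cell_meas x lam e)).2.1)
      (fun i => (hT i _ (cell_meas x lam e)).2.2)
  refine ⟨fun lam hlam e he => Real.abs_le_sqrt (htv lam hlam e he).1, ?_⟩
  have hM0 : 0 ≤ M := (sq_nonneg _).trans (htv 1 one_pos (fun _ => 1) (fun _ => one_pos)).1
  obtain ⟨H, hHi, hH⟩ := inv_vol_bound x hx
  have hHpos : ∀ e : Fin d × Bool → ℝ, (∀ p, 0 < e p) → 0 ≤ H e := by
    intro e he
    obtain ⟨h1, h2⟩ := hH 1 le_rfl e he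
    have := (inv_pos.2 h1).le.trans h2
    simpa using this
  have hIH : 0 ≤ ∫ e, H e ∂(expPi d) := integral_nonneg_of_ae (by
    filter_upwards [expPi_pos d] with e he using hHpos e he)
  refine ⟨12 * M / c * (∫ e, H e ∂(expPi d)) + 1, by positivity, ?_⟩
  intro lam hlam n hn E hE hEl hEi
  have hl0 : 0 < lam := by linarith
  set D : Ω → ℕ → (Fin d → ℝ) × ℝ := fun ω i => (X i ω, Y i ω) with hD
  have hDm : Measurable D := measurable_pi_lambda _ fun i => (hXm i).prodMk (hYm i)
  have hG : Measurable (fun q : (Fin d × Bool → ℝ) × (ℕ → (Fin d → ℝ) × ℝ) =>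
      (ratioEst (cell x lam q.1) n q.2 - Mc f μ x lam q.1) ^ 2) :=
    ((ratioEst_meas x lam n).sub ((Mc_meas f μ hfc hμc x lam).comp measurable_fst)).pow_const 2
  have hn' : (0:ℝ) < n := by exact_mod_cast hn
  have hL : ∫⁻ ω, ENNReal.ofReal ((ratioEst (cell x lam (E ω)) n (D ω) - Mc f μ x lam (E ω)) ^ 2) ∂P
      ≤ ENNReal.ofReal (12 * M / c * (∫ e, H e ∂(expPi d)) * lam ^ d / n) := by
    have e1 := lintegral_map (μ := P) (g := fun ω => (E ω, D ω)) hG.ennreal_ofReal (hE.prodMk hDm)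
    simp only at e1
    rw [← e1, (indepFun_iff_map_prod_eq_prod_map_map hE.aemeasurable hDm.aemeasurable).1 hEi, hEl,
      lintegral_prod _ hG.ennreal_ofReal.aemeasurable]
    have e2 : 12 * M / c * (∫ e, H e ∂(expPi d)) * lam ^ d / n
        = ∫ e, (12 * M / c * lam ^ d / n) * H e ∂(expPi d) := by
      rw [integral_const_mul]; ring
    rw [e2, ofReal_integral_eq_lintegral_ofReal (hHi.const_mul _) (by
      filter_upwards [expPi_pos d] with e he
      have := hHpos e he
      simp only [Pi.zero_apply]
      positivity)]
    refine lintegral_mono_ae ?_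
    filter_upwards [expPi_pos d] with e he
    have hpe : Measurable (fun D' : ℕ → (Fin d → ℝ) × ℝ => (e, D')) := measurable_prodMk_left
    have h0 : Measurable (fun D' : ℕ → (Fin d → ℝ) × ℝ => ratioEst (cell x lam e) n D') :=
      (ratioEst_meas x lam n).comp hpe
    have hGe : Measurable (fun D' : ℕ → (Fin d → ℝ) × ℝ =>
        ENNReal.ofReal ((ratioEst (cell x lam e) n D' - Mc f μ x lam e) ^ 2)) :=
      ((h0.sub measurable_const).pow_const 2).ennreal_ofReal
    rw [lintegral_map hGe hDm]
    refine ((htv lam hl0 e he).2 n hn).trans (ENNReal.ofReal_le_ofReal ?_)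
    have hp := hpp lam hl0 e he
    obtain ⟨v1, v2⟩ := hH lam hlam e he
    have h5 : (∫ z in cell x lam e, f z)⁻¹ ≤ c⁻¹ * (lam ^ d * H e) := by
      calc _ ≤ (c * volume.real (cell x lam e))⁻¹ :=
            inv_anti₀ (by positivity) (cell_prob_lower f c hf hfc x lam e)
        _ = c⁻¹ * (volume.real (cell x lam e))⁻¹ := mul_inv _ _
        _ ≤ _ := by gcongr
    calc 12 * M / (n * ∫ z in cell x lam e, f z) = 12 * M / n * (∫ z in cell x lam e, f z)⁻¹ := by
          rw [div_mul_eq_div_div, div_eq_mul_inv]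
      _ ≤ 12 * M / n * (c⁻¹ * (lam ^ d * H e)) := by gcongr
      _ = _ := by ring
  have hitg : Integrable (fun ω => (ratioEst (cell x lam (E ω)) n (D ω) - Mc f μ x lam (E ω)) ^ 2) P := by
    refine ⟨(hG.comp (hE.prodMk hDm)).aestronglyMeasurable, ?_⟩
    rw [hasFiniteIntegral_iff_ofReal (Eventually.of_forall fun ω => sq_nonneg _)]
    exact hL.trans_lt ENNReal.ofReal_lt_top
  refine ⟨hitg, ?_⟩
  rw [← ofReal_integral_eq_lintegral_ofReal hitg (Eventually.of_forall fun ω => sq_nonneg _),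
    ENNReal.ofReal_le_ofReal_iff (by positivity)] at hL
  refine hL.trans ?_
  gcongr
  linarith

lemma forest_var {Ω : Type*} [MeasurableSpace Ω] (P : Measure Ω) [IsProbabilityMeasure P]
    {d : ℕ} (g : (Fin d × Bool → ℝ) → ℝ) (hg : Measurable g) (M : ℝ)
    (hM : ∀ e, (∀ p, 0 < e p) → |g e| ≤ M) (y : ℝ) (E : ℕ → Ω → Fin d × Bool → ℝ)
    (hEm : ∀ b, Measurable (E b)) (hEl : ∀ b, Measure.map (E b) P = expPi d)
    (hEi : ∀ b b', b ≠ b' → IndepFun (E b) (E b') P) (B : ℕ) (hB : 0 < B) :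
    Integrable (fun ω => ((B:ℝ)⁻¹ * ∑ b ∈ Finset.range B, g (E b ω) - ∫ e, g e ∂(expPi d)) ^ 2) P ∧
    ∫ ω, ((B:ℝ)⁻¹ * ∑ b ∈ Finset.range B, g (E b ω) - ∫ e, g e ∂(expPi d)) ^ 2 ∂P
      ≤ (∫ e, (g e - y) ^ 2 ∂(expPi d)) / B := by
  have hB' : (0:ℝ) < B := by exact_mod_cast hB
  have hgm : ∀ b, Measurable (fun ω => g (E b ω)) := fun b => hg.comp (hEm b)
  have hL : MemLp g 2 (expPi d) := by
    refine MemLp.of_bound hg.aestronglyMeasurable M ?_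
    filter_upwards [expPi_pos d] with e he using hM e he
  have hLb : ∀ b, MemLp (fun ω => g (E b ω)) 2 P := by
    intro b
    have := hL
    rw [← hEl b] at this
    exact this.comp_of_map (hEm b).aemeasurable
  have hitg : ∀ b, ∫ ω, g (E b ω) ∂P = ∫ e, g e ∂(expPi d) := by
    intro b
    rw [← hEl b, integral_map (hEm b).aemeasurable hg.aestronglyMeasurable]
  set Z : ℕ → Ω → ℝ := fun b ω => g (E b ω) with hZ
  have hmean : ∫ ω, (B:ℝ)⁻¹ * (∑ b ∈ Finset.range B, Z b) ω ∂P = ∫ e, g e ∂(expPi d) := by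
    rw [integral_const_mul]
    simp only [Finset.sum_apply]
    rw [integral_finsetSum _ fun b _ => (hLb b).integrable one_le_two]
    simp only [hZ, hitg]
    simp
    field_simp
  have hSL : MemLp (∑ b ∈ Finset.range B, Z b) 2 P := memLp_finsetSum' _ fun b _ => hLb b
  constructor
  · have h1 := (hSL.const_mul (B:ℝ)⁻¹).sub (memLp_const (p := 2) (μ := P) (∫ e, g e ∂(expPi d)))
    have := h1.integrable_sq
    refine this.congr (Eventually.of_forall fun ω => ?_)
    simp [hZ]
  · have hv : Var[fun ω => (B:ℝ)⁻¹ * (∑ b ∈ Finset.range B, Z b) ω; P]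
        = ∫ ω, ((B:ℝ)⁻¹ * ∑ b ∈ Finset.range B, g (E b ω) - ∫ e, g e ∂(expPi d)) ^ 2 ∂P := by
      rw [variance_eq_integral ((hSL.aestronglyMeasurable.aemeasurable).const_mul _), hmean]
      simp [hZ]
    rw [← hv, variance_const_mul, IndepFun.variance_sum (fun b _ => hLb b) (by
      intro b _ b' _ hbb
      exact (hEi b b' hbb).comp hg hg)]
    have h1 : ∀ b ∈ Finset.range B, Var[Z b; P] ≤ ∫ e, (g e - y) ^ 2 ∂(expPi d) := by
      intro b _
      rw [← variance_sub_const (hgm b).aestronglyMeasurable y]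
      refine (variance_le_expectation_sq ((hgm b).sub measurable_const).aestronglyMeasurable).trans ?_
      have hq : Measurable (fun e => (g e - y) ^ 2) := (hg.sub measurable_const).pow_const 2
      rw [← hEl b, integral_map (hEm b).aemeasurable hq.aestronglyMeasurable]
      simp
    calc (B:ℝ)⁻¹ ^ 2 * ∑ b ∈ Finset.range B, Var[Z b; P]
        ≤ (B:ℝ)⁻¹ ^ 2 * (B * ∫ e, (g e - y) ^ 2 ∂(expPi d)) := by
          gcongr
          refine (Finset.sum_le_card_nsmul _ _ _ h1).trans ?_
          simp
      _ = _ := by field_simp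

lemma risk_bound {Ω : Type*} [MeasurableSpace Ω] (P : Measure Ω) [IsProbabilityMeasure P]
    {J : ℕ} (w : Fin (J + 1) → ℝ) (θ m : Fin (J + 1) → ℕ → Ω → ℝ) (Em : Fin (J + 1) → ℝ) (y : ℝ)
    (B : ℕ) (hB : 0 < B) (A V : Fin (J + 1) → ℝ) (bias : ℝ)
    (hθi : ∀ r b, Integrable (fun ω => (θ r b ω - m r b ω) ^ 2) P)
    (hθ : ∀ r b, ∫ ω, (θ r b ω - m r b ω) ^ 2 ∂P ≤ A r)
    (hmi : ∀ r, Integrable (fun ω => ((B:ℝ)⁻¹ * ∑ b ∈ Finset.range B, m r b ω - Em r) ^ 2) P)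
    (hm : ∀ r, ∫ ω, ((B:ℝ)⁻¹ * ∑ b ∈ Finset.range B, m r b ω - Em r) ^ 2 ∂P ≤ V r)
    (hb : |(∑ r, w r * Em r) - y| ≤ bias) :
    ∫ ω, ((∑ r, w r * ((B:ℝ)⁻¹ * ∑ b ∈ Finset.range B, θ r b ω)) - y) ^ 2 ∂P
      ≤ 3 * ((∑ r, w r ^ 2) * (∑ r, A r) + (∑ r, w r ^ 2) * (∑ r, V r) + bias ^ 2) := by
  have hB' : (0:ℝ) < B := by exact_mod_cast hB
  set W := ∑ r, w r ^ 2 with hW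
  have hW0 : 0 ≤ W := Finset.sum_nonneg fun r _ => sq_nonneg _
  let G : Ω → ℝ := fun ω => 3 * (W * (∑ r, (B:ℝ)⁻¹ * ∑ b ∈ Finset.range B, (θ r b ω - m r b ω) ^ 2)
    + W * (∑ r, ((B:ℝ)⁻¹ * ∑ b ∈ Finset.range B, m r b ω - Em r) ^ 2) + bias ^ 2)
  have i1 : Integrable (fun ω => ∑ r, (B:ℝ)⁻¹ * ∑ b ∈ Finset.range B, (θ r b ω - m r b ω) ^ 2) P :=
    integrable_finsetSum _ fun r _ => (integrable_finsetSum _ fun b _ => hθi r b).const_mul _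
  have i2 : Integrable (fun ω => ∑ r, ((B:ℝ)⁻¹ * ∑ b ∈ Finset.range B, m r b ω - Em r) ^ 2) P :=
    integrable_finsetSum _ fun r _ => hmi r
  have i12 : Integrable (fun ω => W * (∑ r, (B:ℝ)⁻¹ * ∑ b ∈ Finset.range B, (θ r b ω - m r b ω) ^ 2)
    + W * (∑ r, ((B:ℝ)⁻¹ * ∑ b ∈ Finset.range B, m r b ω - Em r) ^ 2)) P :=
    (i1.const_mul W).add (i2.const_mul W)
  have hGi : Integrable G P := (i12.add (integrable_const _)).const_mul 3
  have hpt : ∀ ω, ((∑ r, w r * ((B:ℝ)⁻¹ * ∑ b ∈ Finset.range B, θ r b ω)) - y) ^ 2 ≤ G ω := by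
    intro ω
    set a1 := ∑ r, w r * ((B:ℝ)⁻¹ * ∑ b ∈ Finset.range B, (θ r b ω - m r b ω))
    set a2 := ∑ r, w r * ((B:ℝ)⁻¹ * ∑ b ∈ Finset.range B, m r b ω - Em r)
    set a3 := (∑ r, w r * Em r) - y
    have e : (∑ r, w r * ((B:ℝ)⁻¹ * ∑ b ∈ Finset.range B, θ r b ω)) - y = a1 + a2 + a3 := by
      have : a1 + a2 + a3 = (∑ r, (w r * ((B:ℝ)⁻¹ * ∑ b ∈ Finset.range B, (θ r b ω - m r b ω))
          + w r * ((B:ℝ)⁻¹ * ∑ b ∈ Finset.range B, m r b ω - Em r) + w r * Em r)) - y := by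
        rw [Finset.sum_add_distrib, Finset.sum_add_distrib]; ring
      rw [this]
      congr 1
      refine Finset.sum_congr rfl fun r _ => ?_
      rw [Finset.sum_sub_distrib]; ring
    have b1 : a1 ^ 2 ≤ W * (∑ r, (B:ℝ)⁻¹ * ∑ b ∈ Finset.range B, (θ r b ω - m r b ω) ^ 2) := by
      refine (Finset.sum_mul_sq_le_sq_mul_sq _ _ _).trans ?_
      refine mul_le_mul_of_nonneg_left (Finset.sum_le_sum fun r _ => ?_) hW0
      have := sq_sum_le_card_mul_sum_sq (s := Finset.range B) (f := fun b => θ r b ω - m r b ω)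
      rw [Finset.card_range] at this
      rw [mul_pow]
      calc (B:ℝ)⁻¹ ^ 2 * (∑ b ∈ Finset.range B, (θ r b ω - m r b ω)) ^ 2
          ≤ (B:ℝ)⁻¹ ^ 2 * (B * ∑ b ∈ Finset.range B, (θ r b ω - m r b ω) ^ 2) := by gcongr
        _ = _ := by field_simp
    have b2 : a2 ^ 2 ≤ W * (∑ r, ((B:ℝ)⁻¹ * ∑ b ∈ Finset.range B, m r b ω - Em r) ^ 2) :=
      Finset.sum_mul_sq_le_sq_mul_sq _ _ _
    have b3 : a3 ^ 2 ≤ bias ^ 2 := by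
      rw [← sq_abs a3]
      gcongr
    rw [e]
    simp only [G]
    nlinarith [sq_nonneg (a1 - a2), sq_nonneg (a1 - a3), sq_nonneg (a2 - a3)]
  refine (integral_mono_of_nonneg (Eventually.of_forall fun ω => sq_nonneg _) hGi
    (Eventually.of_forall hpt)).trans ?_
  simp only [G]
  rw [integral_const_mul, integral_add i12 (integrable_const _),
    integral_add (i1.const_mul W) (i2.const_mul W), integral_const_mul, integral_const_mul,
    integral_finsetSum _ fun r _ => (integrable_finsetSum _ fun b _ => hθi r b).const_mul _,
    integral_finsetSum _ fun r _ => hmi r]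
  simp only [integral_const, probReal_univ, one_smul]
  gcongr with r _ r _
  · rw [integral_const_mul, integral_finsetSum _ fun b _ => hθi r b]
    calc (B:ℝ)⁻¹ * ∑ b ∈ Finset.range B, ∫ ω, (θ r b ω - m r b ω) ^ 2 ∂P
        ≤ (B:ℝ)⁻¹ * (B * A r) := by
          gcongr
          refine (Finset.sum_le_card_nsmul _ _ _ fun b _ => hθ r b).trans ?_
          simp
      _ = A r := by field_simp
  · exact hm r

lemma cell_laws {Ω : Type*} [MeasurableSpace Ω] (P : Measure Ω) [IsProbabilityMeasure P]
    {d J : ℕ} (V : Fin (J + 1) × ℕ × Fin d × Bool → Ω → ℝ) (hV : iIndepFun V P)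
    (hE : ∀ p, IsExpOne P (V p)) (r : Fin (J + 1)) :
    (∀ b, Measurable (fun ω => fun q : Fin d × Bool => V (r, b, q) ω)) ∧
    (∀ b, Measure.map (fun ω => fun q : Fin d × Bool => V (r, b, q) ω) P = expPi d) ∧
    ∀ b b', b ≠ b' → IndepFun (fun ω => fun q : Fin d × Bool => V (r, b, q) ω)
      (fun ω => fun q : Fin d × Bool => V (r, b', q) ω) P := by
  refine ⟨fun b => measurable_pi_lambda _ fun q => (hE _).1, fun b => ?_, ?_⟩
  · have h := hV.precomp (g := fun q : ℕ × Fin d × Bool => (r, q)) (fun a b hab => by simpa using hab)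
    exact law_expPi P d (fun q : ℕ × Fin d × Bool => V (r, q)) h (fun p => hE _) b
  · intro b b' hbb
    let S : ℕ → Finset (Fin (J + 1) × ℕ × Fin d × Bool) := fun b =>
      Finset.univ.image (fun q : Fin d × Bool => (r, b, q))
    have hS : ∀ b q, (r, b, q) ∈ S b := fun b q => Finset.mem_image.2 ⟨q, Finset.mem_univ _, rfl⟩
    have hdis : Disjoint (S b) (S b') := by
      rw [Finset.disjoint_left]
      intro p hp hp'
      obtain ⟨q, _, rfl⟩ := Finset.mem_image.1 hp
      obtain ⟨q', _, h⟩ := Finset.mem_image.1 hp'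
      simp only [Prod.mk.injEq] at h
      exact hbb h.2.1.symm
    have h := hV.indepFun_finset (S b) (S b') hdis (fun p => (hE p).1)
    have hφ : ∀ b, Measurable (fun (g : ↥(S b) → ℝ) (q : Fin d × Bool) => g ⟨(r, b, q), hS b q⟩) :=
      fun b => measurable_pi_lambda _ fun q => measurable_pi_apply _
    exact h.comp (hφ b) (hφ b')

lemma forest_eq {Ω : Type*} {d : ℕ} (x : Fin d → ℝ) (lam : ℝ) (n B : ℕ)
    (X : ℕ → Ω → Fin d → ℝ) (Y : ℕ → Ω → ℝ) (Elo Ehi : ℕ → Ω → Fin d → ℝ) (ω : Ω) :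
    forestEst x lam n B X Y Elo Ehi ω = (B : ℝ)⁻¹ * ∑ b ∈ Finset.range B,
      ratioEst (cell x lam (fun q : Fin d × Bool => if q.2 then Ehi b ω q.1 else Elo b ω q.1)) n
        (fun i => (X i ω, Y i ω)) := by
  unfold forestEst ratioEst mN
  have h : ∀ b i, mInd x lam Elo Ehi X b i ω
      = (cell x lam (fun q : Fin d × Bool => if q.2 then Ehi b ω q.1 else Elo b ω q.1)).indicator
        (fun _ => (1:ℝ)) (X i ω) := by
    intro b i
    simp [mInd, Set.indicator, cell]
  simp only [h]

set_option maxHeartbeats 2000000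

lemma rate_facts (d : ℕ) (β : ℝ) (hβ : 1 ≤ β) (c₁ c₂ c N L Bv : ℝ) (hc₁ : 0 < c₁)
    (hc : 0 < c) (hN : 0 < N)
    (h1 : c₁ * N ^ ((1:ℝ) / (d + 2 * β)) ≤ L) (h2 : L ≤ c₂ * N ^ ((1:ℝ) / (d + 2 * β)))
    (h3 : c * N ^ ((2 * β - 2) / (d + 2 * β)) ≤ Bv) :
    L ^ d / N ≤ c₂ ^ d * (N ^ (-(β / (d + 2 * β)))) ^ 2 ∧
    L⁻¹ ^ 2 / Bv ≤ (c₁⁻¹ ^ 2 * c⁻¹) * (N ^ (-(β / (d + 2 * β)))) ^ 2 ∧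
    L⁻¹ ^ β ≤ c₁⁻¹ ^ β * N ^ (-(β / (d + 2 * β))) := by
  have hs : (0:ℝ) < d + 2 * β := by positivity
  set s : ℝ := d + 2 * β with hsd
  set p := N ^ ((1:ℝ) / s) with hp
  have hp0 : 0 < p := Real.rpow_pos_of_pos hN _
  have hL : 0 < L := lt_of_lt_of_le (by positivity) h1
  have hR2 : (N ^ (-(β / s))) ^ 2 = N ^ (-(2 * β / s)) := by
    rw [← Real.rpow_natCast, ← Real.rpow_mul hN.le]; congr 1; push_cast; ring
  have hLi : L⁻¹ ≤ c₁⁻¹ * p⁻¹ := by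
    rw [← mul_inv]; exact inv_anti₀ (by positivity) h1
  refine ⟨?_, ?_, ?_⟩
  · rw [hR2]
    have e : p ^ d / N = N ^ (-(2 * β / s)) := by
      rw [hp, ← Real.rpow_natCast, ← Real.rpow_mul hN.le]
      nth_rewrite 2 [← Real.rpow_one N]
      rw [← Real.rpow_sub hN]; congr 1; field_simp; rw [hsd]; ring
    calc L ^ d / N ≤ (c₂ * p) ^ d / N := by gcongr
      _ = c₂ ^ d * (p ^ d / N) := by rw [mul_pow]; ring
      _ = _ := by rw [e]
  · rw [hR2]
    have e : p⁻¹ ^ 2 * (N ^ ((2 * β - 2) / s))⁻¹ = N ^ (-(2 * β / s)) := by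
      rw [hp, ← Real.rpow_neg hN.le, ← Real.rpow_neg hN.le, ← Real.rpow_natCast,
        ← Real.rpow_mul hN.le, ← Real.rpow_add hN]
      congr 1; push_cast; field_simp; ring
    have hq : 0 < N ^ ((2 * β - 2) / s) := Real.rpow_pos_of_pos hN _
    have hB : Bv⁻¹ ≤ c⁻¹ * (N ^ ((2 * β - 2) / s))⁻¹ := by
      rw [← mul_inv]; exact inv_anti₀ (by positivity) h3
    have hBv : 0 < Bv := lt_of_lt_of_le (by positivity) h3
    calc L⁻¹ ^ 2 / Bv = L⁻¹ ^ 2 * Bv⁻¹ := by rw [div_eq_mul_inv]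
      _ ≤ (c₁⁻¹ * p⁻¹) ^ 2 * (c⁻¹ * (N ^ ((2 * β - 2) / s))⁻¹) := by gcongr
      _ = (c₁⁻¹ ^ 2 * c⁻¹) * (p⁻¹ ^ 2 * (N ^ ((2 * β - 2) / s))⁻¹) := by ring
      _ = _ := by rw [e]
  · have e : p⁻¹ ^ β = N ^ (-(β / s)) := by
      rw [hp, ← Real.rpow_neg hN.le, ← Real.rpow_mul hN.le]
      congr 1; field_simp
    calc L⁻¹ ^ β ≤ (c₁⁻¹ * p⁻¹) ^ β := by
          apply Real.rpow_le_rpow (by positivity) hLi (by linarith)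
      _ = _ := by rw [Real.mul_rpow (by positivity) (by positivity), e]

/-- Theorem 8: minimax optimality of the debiased Mondrian random forest
estimator. With `J ≥ ⌊⌊β⌋/2⌋`, `λ ≍ n^{1/(d+2β)}` and `B ≳ n^{(2β−2)/(d+2β)}`, the
debiased estimator attains the minimax-optimal pointwise rate
`E[(μ̂_d(x) − μ(x))²]^{1/2} ≲ n^{−β/(d+2β)}`. -/
theorem mondrian_forest_minimax
    {Ω : Type*} [MeasurableSpace Ω] (P : Measure Ω) [IsProbabilityMeasure P]
    (d : ℕ) (hd : 1 ≤ d) (β : ℝ) (hβ : 1 ≤ β)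
    -- Assumption 1: the data
    (X : ℕ → Ω → Fin d → ℝ) (Y : ℕ → Ω → ℝ)
    (hXm : ∀ i, Measurable (X i)) (hYm : ∀ i, Measurable (Y i))
    (hiid : iIndepFun (fun i ω => (X i ω, Y i ω)) P)
    (hident : ∀ i, Measure.map (fun ω => (X i ω, Y i ω)) P
      = Measure.map (fun ω => (X 0 ω, Y 0 ω)) P)
    (f : (Fin d → ℝ) → ℝ)
    (hXd : ∀ i, Measure.map (X i) P = volume.withDensity fun z => ENNReal.ofReal (f z))
    (hf_pos : ∃ c > (0:ℝ), ∀ z ∈ unitBox d, c ≤ f z)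
    (hf_supp : ∀ z, z ∉ unitBox d → f z = 0)
    (hf_hol : IsHolderOn β f)
    (μreg : (Fin d → ℝ) → ℝ)
    (hμ : ∀ i, P[Y i|MeasurableSpace.comap (X i) inferInstance]
      =ᵐ[P] fun ω => μreg (X i ω))
    (hμ_hol : IsHolderOn β μreg)
    (hY2 : ∃ M : ℝ, ∀ i, ∀ᵐ ω ∂P,
      (P[fun ω' => (Y i ω') ^ 2|MeasurableSpace.comap (X i) inferInstance]) ω ≤ M)
    (σ2 : (Fin d → ℝ) → ℝ)
    (hσ : ∀ i, P[fun ω' => (Y i ω' - μreg (X i ω')) ^ 2|MeasurableSpace.comap (X i) inferInstance]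
      =ᵐ[P] fun ω => σ2 (X i ω))
    (hσ_lip : ∃ L : ℝ, ∀ z ∈ unitBox d, ∀ z' ∈ unitBox d, |σ2 z - σ2 z'| ≤ L * l2dist z z')
    (hσ_pos : ∃ c > (0:ℝ), ∀ z ∈ unitBox d, c ≤ σ2 z)
    -- Assumption 2: the design point, the lifetimes and the forest sizes
    (x : Fin d → ℝ) (hx : ∀ j, x j ∈ Set.Ioo (0:ℝ) 1)
    (lam : ℕ → ℝ) (hlam_pos : ∀ n, 0 < lam n)
    (hlam1 : Tendsto (fun n : ℕ => lam n ^ d / n) atTop (𝓝 0))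
    (hlam2 : ∃ c₁ > (0:ℝ), ∃ c₂ > (0:ℝ), ∀ᶠ n : ℕ in atTop,
      c₁ * Real.log n ≤ Real.log (lam n) ∧ Real.log (lam n) ≤ c₂ * Real.log n)
    (Bn : ℕ → ℕ)
    (hBn : ∃ ξ ∈ Set.Ioo (0:ℝ) 1, ∃ c₁ > (0:ℝ), ∃ c₂ > (0:ℝ), ∀ᶠ n : ℕ in atTop,
      c₁ * (n : ℝ) ^ ξ ≤ (Bn n : ℝ) ∧ (Bn n : ℝ) ≤ c₂ * (n : ℝ) ^ ξ)
    -- the debiasing parameters: distinct positive scales a_r and weights ω_r solving the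
    -- debiasing linear system
    (J : ℕ) (a : Fin (J + 1) → ℝ) (ha_pos : ∀ r, 0 < a r) (ha_inj : Function.Injective a)
    (w : Fin (J + 1) → ℝ) (hw1 : ∑ r, w r = 1)
    (hw2 : ∀ s : ℕ, 1 ≤ s → s ≤ J → ∑ r, w r / a r ^ (2 * s) = 0)
    -- the J+1 mutually independent forests: for each sample size n and each 0 ≤ r ≤ J,
    -- i.i.d. Mondrian cells at x with lifetime a_r * lam n, independent of the data
    (Elo Ehi : ℕ → Fin (J + 1) → ℕ → Ω → Fin d → ℝ)
    (hexp : ∀ n r b j, IsExpOne P (fun ω => Elo n r b ω j) ∧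
      IsExpOne P (fun ω => Ehi n r b ω j))
    (hindepE : ∀ n, iIndepFun
      (fun p : Fin (J + 1) × ℕ × Fin d × Bool => fun ω =>
        if p.2.2.2 then Ehi n p.1 p.2.1 ω p.2.2.1 else Elo n p.1 p.2.1 ω p.2.2.1) P)
    (hindepXT : ∀ n, IndepFun
      (fun ω => fun p : Fin (J + 1) × ℕ × Fin d × Bool =>
        if p.2.2.2 then Ehi n p.1 p.2.1 ω p.2.2.1 else Elo n p.1 p.2.1 ω p.2.2.1)
      (fun ω => fun i : ℕ => (X i ω, Y i ω)) P)

    (hJ : flbeta β / 2 ≤ J)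
    (hlam_rate : ∃ c₁ > (0:ℝ), ∃ c₂ > (0:ℝ), ∀ᶠ n : ℕ in atTop,
      c₁ * (n : ℝ) ^ ((1:ℝ) / (d + 2 * β)) ≤ lam n ∧
        lam n ≤ c₂ * (n : ℝ) ^ ((1:ℝ) / (d + 2 * β)))
    (hBn_low : ∃ c > (0:ℝ), ∀ᶠ n : ℕ in atTop,
      c * (n : ℝ) ^ ((2 * β - 2) / (d + 2 * β)) ≤ (Bn n : ℝ)) :
    ∃ C > (0:ℝ), ∀ᶠ n : ℕ in atTop,
      Real.sqrt (∫ ω,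
          ((∑ r, w r * forestEst x (a r * lam n) n (Bn n) X Y (Elo n r) (Ehi n r) ω)
            - μreg x) ^ 2 ∂P)
        ≤ C * (n : ℝ) ^ (-(β / (d + 2 * β))) := by
  have hfc := holder_cont f hf_hol
  have hμc := holder_cont μreg hμ_hol
  obtain ⟨M, hM⟩ := hY2
  have hdata := fun i => data_facts P (X i) (Y i) (hXm i) (hYm i) f (hXd i) hf_pos hf_supp hfc
    μreg (hμ i) hμc M (hM i) σ2 (hσ i) hσ_pos
  obtain ⟨cf0, hcf0, hcf⟩ := id hf_pos
  obtain ⟨hMb, K1, hK1, htree⟩ := tree_noise P X Y hXm hYm hiid (fun i => (hdata i).1) f μreg cf0 M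
    hcf0 hcf hfc hμc (fun i => (hdata i).2) x hx
  obtain ⟨c, K2, hK2, hc0, hcodd, hbias⟩ := bias_single hβ f μreg hf_hol hμ_hol hf_pos x hx
    (Real.sqrt M) hMb (fun l _ => Mc_meas f μreg hfc hμc x l)
  obtain ⟨K3, hK3, hdeb⟩ := bias_debiased f μreg x a w ha_pos hw1 hw2 hJ c K2 hK2 hc0 hcodd
    (fun l hl => (hbias l hl).1)
  obtain ⟨c₁, hc₁, c₂, hc₂, hrate⟩ := hlam_rate
  obtain ⟨cB, hcB, hBlow⟩ := hBn_low
  have hs : (0:ℝ) < d + 2 * β := by positivity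
  set W : ℝ := ∑ r, w r ^ 2 with hW
  have hW0 : 0 ≤ W := Finset.sum_nonneg fun r _ => sq_nonneg _
  set Q : ℝ := 3 * (W * (∑ r, K1 * a r ^ d * c₂ ^ d)
    + W * (∑ r, K2 * (a r)⁻¹ ^ 2 * (c₁⁻¹ ^ 2 * cB⁻¹)) + (K3 * c₁⁻¹ ^ β) ^ 2) with hQ
  have hlamT : Tendsto lam atTop atTop := by
    have h1 : Tendsto (fun n : ℕ => c₁ * (n : ℝ) ^ ((1:ℝ) / (d + 2 * β))) atTop atTop :=
      ((tendsto_rpow_atTop (by positivity)).comp tendsto_natCast_atTop_atTop).const_mul_atTop hc₁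
    exact tendsto_atTop_mono' _ (hrate.mono fun n h => h.1) h1
  have hbig : ∀ᶠ n : ℕ in atTop, ∀ r, 1 ≤ a r * lam n := by
    rw [eventually_all]
    intro r
    exact (hlamT.const_mul_atTop (ha_pos r)).eventually_ge_atTop 1
  have hQ0 : 0 ≤ Q := by
    have h1 : 0 ≤ ∑ r, K1 * a r ^ d * c₂ ^ d := Finset.sum_nonneg fun r _ => by
      have := ha_pos r; positivity
    have h2 : 0 ≤ ∑ r, K2 * (a r)⁻¹ ^ 2 * (c₁⁻¹ ^ 2 * cB⁻¹) := Finset.sum_nonneg fun r _ => by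
      have := ha_pos r; positivity
    positivity
  refine ⟨Real.sqrt Q + 1, by positivity, ?_⟩
  filter_upwards [hrate, hBlow, hbig, eventually_gt_atTop 0] with n hr hBl hbg hn
  have hN : (0:ℝ) < n := by exact_mod_cast hn
  have hBpos : (0:ℝ) < Bn n := lt_of_lt_of_le (by positivity) hBl
  have hBpos' : 0 < Bn n := by exact_mod_cast hBpos
  obtain ⟨f1, f2, f3⟩ := rate_facts d β hβ c₁ c₂ cB n (lam n) (Bn n) hc₁ hcB hN hr.1 hr.2 hBl
  set R : ℝ := (n:ℝ) ^ (-(β / (d + 2 * β))) with hR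
  have hR0 : 0 < R := Real.rpow_pos_of_pos hN _
  let V : Fin (J + 1) × ℕ × Fin d × Bool → Ω → ℝ := fun p ω =>
    if p.2.2.2 then Ehi n p.1 p.2.1 ω p.2.2.1 else Elo n p.1 p.2.1 ω p.2.2.1
  have hVE : ∀ p, IsExpOne P (V p) := by
    rintro ⟨r, b, j, t⟩
    cases t
    · simpa [V] using (hexp n r b j).1
    · simpa [V] using (hexp n r b j).2
  have hlaws := fun r => cell_laws P V (hindepE n) hVE r
  have hXT : ∀ r b, IndepFun (fun ω => fun q : Fin d × Bool => V (r, b, q) ω)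
      (fun ω i => (X i ω, Y i ω)) P := by
    intro r b
    have hm : Measurable (fun (g : Fin (J + 1) × ℕ × Fin d × Bool → ℝ) (q : Fin d × Bool) =>
      g (r, b, q)) := measurable_pi_lambda _ fun q => measurable_pi_apply _
    exact (hindepXT n).comp hm measurable_id
  have hlp := hlam_pos n
  have key := risk_bound P w
    (fun r b ω => ratioEst (cell x (a r * lam n) (fun q => V (r, b, q) ω)) n
      (fun i => (X i ω, Y i ω)))
    (fun r b ω => Mc f μreg x (a r * lam n) (fun q => V (r, b, q) ω))
    (fun r => ∫ e, Mc f μreg x (a r * lam n) e ∂(expPi d)) (μreg x) (Bn n) hBpos'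
    (fun r => K1 * (a r * lam n) ^ d / n)
    (fun r => (K2 * (a r * lam n)⁻¹ ^ 2) / Bn n) (K3 * (lam n)⁻¹ ^ β)
    (fun r b => (htree _ (hbg r) n hn _ ((hlaws r).1 b) ((hlaws r).2.1 b) (hXT r b)).1)
    (fun r b => (htree _ (hbg r) n hn _ ((hlaws r).1 b) ((hlaws r).2.1 b) (hXT r b)).2)
    (fun r => (forest_var P _ (Mc_meas f μreg hfc hμc x (a r * lam n)) (Real.sqrt M)
      (hMb _ (mul_pos (ha_pos r) hlp)) (μreg x) _ (hlaws r).1 (hlaws r).2.1 (hlaws r).2.2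
      (Bn n) hBpos').1)
    (fun r => (forest_var P _ (Mc_meas f μreg hfc hμc x (a r * lam n)) (Real.sqrt M)
      (hMb _ (mul_pos (ha_pos r) hlp)) (μreg x) _ (hlaws r).1 (hlaws r).2.1 (hlaws r).2.2
      (Bn n) hBpos').2.trans
        (by gcongr; exact (hbias _ (mul_pos (ha_pos r) hlp)).2.2))
    (hdeb _ hlp)
  have heq : ∫ ω, ((∑ r, w r * forestEst x (a r * lam n) n (Bn n) X Y (Elo n r) (Ehi n r) ω)
            - μreg x) ^ 2 ∂P = ∫ ω, ((∑ r, w r * (((Bn n : ℕ) : ℝ)⁻¹ * ∑ b ∈ Finset.range (Bn n),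
      ratioEst (cell x (a r * lam n) (fun q => V (r, b, q) ω)) n
      (fun i => (X i ω, Y i ω)))) - μreg x) ^ 2 ∂P := by
    simp only [forest_eq, V]
  have hA : ∑ r, K1 * (a r * lam n) ^ d / n ≤ (∑ r, K1 * a r ^ d * c₂ ^ d) * R ^ 2 := by
    rw [Finset.sum_mul]
    refine Finset.sum_le_sum fun r _ => ?_
    have := ha_pos r
    calc K1 * (a r * lam n) ^ d / n = K1 * a r ^ d * (lam n ^ d / n) := by rw [mul_pow]; ring
      _ ≤ K1 * a r ^ d * (c₂ ^ d * R ^ 2) := by gcongr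
      _ = _ := by ring
  have hVs : ∑ r, (K2 * (a r * lam n)⁻¹ ^ 2) / Bn n
      ≤ (∑ r, K2 * (a r)⁻¹ ^ 2 * (c₁⁻¹ ^ 2 * cB⁻¹)) * R ^ 2 := by
    rw [Finset.sum_mul]
    refine Finset.sum_le_sum fun r _ => ?_
    have := ha_pos r
    calc (K2 * (a r * lam n)⁻¹ ^ 2) / Bn n = K2 * (a r)⁻¹ ^ 2 * ((lam n)⁻¹ ^ 2 / Bn n) := by
          rw [mul_inv, mul_pow]; ring
      _ ≤ K2 * (a r)⁻¹ ^ 2 * ((c₁⁻¹ ^ 2 * cB⁻¹) * R ^ 2) := by gcongr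
      _ = _ := by ring
  have hbs : (K3 * (lam n)⁻¹ ^ β) ^ 2 ≤ (K3 * c₁⁻¹ ^ β) ^ 2 * R ^ 2 := by
    calc (K3 * (lam n)⁻¹ ^ β) ^ 2 ≤ (K3 * (c₁⁻¹ ^ β * R)) ^ 2 := by gcongr
      _ = _ := by ring
  have hfin : ∫ ω, ((∑ r, w r * forestEst x (a r * lam n) n (Bn n) X Y (Elo n r) (Ehi n r) ω)
            - μreg x) ^ 2 ∂P ≤ Q * R ^ 2 := by
    rw [heq]
    refine key.trans ?_
    have e1 := mul_le_mul_of_nonneg_left hA hW0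
    have e2 := mul_le_mul_of_nonneg_left hVs hW0
    rw [hQ]
    nlinarith [e1, e2, hbs]
  calc _ ≤ Real.sqrt (Q * R ^ 2) := Real.sqrt_le_sqrt hfin
    _ = Real.sqrt Q * R := by rw [Real.sqrt_mul hQ0, Real.sqrt_sq hR0.le]
    _ ≤ (Real.sqrt Q + 1) * R := by nlinarith
end
end

section
/- Let d ≥ 1 be an integer, λ > 0, n ≥ 1, x ∈ (0,1)^d, and let T(x) be a Mondrian cell at x with lifetime λ. Then E[ min(1, 1/(n |T(x)|)) ] ≥ λ^d / (λ^d + 2^d n), and consequently E[ min(1, 1/(n |T(x)|)²) ] ≥ ( λ^d / (λ^d + 2^d n) )². -/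
open MeasureTheory ProbabilityTheory Filter
open scoped ENNReal NNReal Topology Classical

noncomputable section

/-- The `j`-th side length of the Mondrian cell at `x` with lifetime `lam` generated by the
lower exponentials `lo` and the upper exponentials `hi`. -/
def mondrianSide {d : ℕ} (x : Fin d → ℝ) (lam : ℝ) (lo hi : Fin d → ℝ) (j : Fin d) : ℝ :=
  min (lo j / lam) (x j) + min (hi j / lam) (1 - x j)

/-- The volume `|T(x)|` of the Mondrian cell at `x`. -/
def mondrianVol {d : ℕ} (x : Fin d → ℝ) (lam : ℝ) (lo hi : Fin d → ℝ) : ℝ :=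
  ∏ j, mondrianSide x lam lo hi j

lemma expOne_aux {Ω : Type*} [MeasurableSpace Ω] (P : Measure Ω) [IsProbabilityMeasure P]
    (E : Ω → ℝ) (h : IsExpOne P E) :
    (∀ᵐ ω ∂P, 0 < E ω) ∧ Integrable E P ∧ ∫ ω, E ω ∂P = 1 := by
  obtain ⟨hm, ht⟩ := h
  have hpos : ∀ᵐ ω ∂P, 0 < E ω := by
    have h0 := ht 0 le_rfl
    simp only [neg_zero, Real.exp_zero, ENNReal.ofReal_one] at h0
    exact (prob_compl_eq_zero_iff (measurableSet_lt measurable_const hm)).2 h0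
  have hnn : 0 ≤ᵐ[P] E := hpos.mono fun ω h => h.le
  have hl : ∫⁻ ω, ENNReal.ofReal (E ω) ∂P = 1 := by
    rw [lintegral_eq_lintegral_meas_lt P hnn hm.aemeasurable,
      setLIntegral_congr_fun measurableSet_Ioi (fun t (h : 0 < t) => ht t h.le),
      ← ofReal_integral_eq_lintegral_ofReal (integrableOn_exp_neg_Ioi 0)
        (Eventually.of_forall fun t => (Real.exp_pos _).le),
      integral_exp_neg_Ioi_zero, ENNReal.ofReal_one]
  refine ⟨hpos, ⟨hm.aestronglyMeasurable, ?_⟩, ?_⟩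
  · rw [hasFiniteIntegral_iff_ofReal hnn, hl]; exact ENNReal.one_lt_top
  · rw [integral_eq_lintegral_of_nonneg_ae hnn hm.aestronglyMeasurable, hl]; rfl

/-- lower bounds on inverse moments of the volume of a Mondrian cell.
`E[min(1, 1/(n|T(x)|))] ≥ λ^d/(λ^d + 2^d n)`, and consequently
`E[min(1, 1/(n|T(x)|)²)] ≥ (λ^d/(λ^d + 2^d n))²`. -/
theorem mondrian_inverse_volume_moment_lower
    {Ω : Type*} [MeasurableSpace Ω] (P : Measure Ω) [IsProbabilityMeasure P]
    (d : ℕ) (hd : 1 ≤ d) (lam : ℝ) (hlam : 0 < lam) (n : ℕ) (hn : 1 ≤ n)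
    (x : Fin d → ℝ) (hx : ∀ j, x j ∈ Set.Ioo (0:ℝ) 1)
    (Elo Ehi : Ω → Fin d → ℝ)
    (hexp : ∀ j, IsExpOne P (fun ω => Elo ω j) ∧ IsExpOne P (fun ω => Ehi ω j))
    (hindep : iIndepFun
      (fun p : Fin d × Bool => fun ω => if p.2 then Ehi ω p.1 else Elo ω p.1) P) :
    lam ^ d / (lam ^ d + 2 ^ d * n)
      ≤ (∫ ω, min 1 (1 / ((n : ℝ) * mondrianVol x lam (Elo ω) (Ehi ω))) ∂P) ∧
    (lam ^ d / (lam ^ d + 2 ^ d * n)) ^ 2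
      ≤ (∫ ω, min 1 (1 / ((n : ℝ) * mondrianVol x lam (Elo ω) (Ehi ω)) ^ 2) ∂P) := by
  set Z : Fin d × Bool → Ω → ℝ :=
    fun p : Fin d × Bool => fun ω => if p.2 then Ehi ω p.1 else Elo ω p.1 with hZ
  have hZexp : ∀ p, IsExpOne P (Z p) := by
    rintro ⟨j, b⟩
    cases b
    · simpa [hZ] using (hexp j).1
    · simpa [hZ] using (hexp j).2
  set c : Fin d × Bool → ℝ := fun p => if p.2 then 1 - x p.1 else x p.1 with hc
  have hcpos : ∀ p, 0 < c p := by
    rintro ⟨j, b⟩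
    have := hx j
    cases b
    · simpa [hc] using this.1
    · simpa [hc] using this.2
  set Y : Fin d × Bool → Ω → ℝ := fun p ω => min (Z p ω / lam) (c p) with hY
  have hYm : ∀ p, Measurable (Y p) := fun p => ((hZexp p).1.div_const lam).min measurable_const
  have hae : ∀ᵐ ω ∂P, ∀ p, 0 < Z p ω :=
    ae_all_iff.2 fun p => (expOne_aux P _ (hZexp p)).1
  have hYpos : ∀ᵐ ω ∂P, ∀ p, 0 < Y p ω := hae.mono fun ω h p =>
    lt_min (div_pos (h p) hlam) (hcpos p)
  have hYint : ∀ p, Integrable (Y p) P := fun p =>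
    ((expOne_aux P _ (hZexp p)).2.1.div_const lam).inf (integrable_const (c p))
  have hYle : ∀ p, ∫ ω, Y p ω ∂P ≤ 1 / lam := fun p => by
    have h := expOne_aux P _ (hZexp p)
    calc ∫ ω, Y p ω ∂P ≤ ∫ ω, Z p ω / lam ∂P :=
          integral_mono (hYint p) (h.2.1.div_const lam) fun ω => min_le_left _ _
      _ = 1 / lam := by rw [integral_div, h.2.2]
  have hY0 : ∀ p, 0 ≤ ∫ ω, Y p ω ∂P := fun p =>
    integral_nonneg_of_ae (hYpos.mono fun ω h => (h p).le)
  have hYind : iIndepFun Y P :=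
    hindep.comp (fun p (z : ℝ) => min (z / lam) (c p)) fun p => by fun_prop
  have hV : ∀ ω, mondrianVol x lam (Elo ω) (Ehi ω) = ∑ f : Fin d → Bool, ∏ j, Y (j, f j) ω := by
    intro ω
    have h1 : ∀ j, mondrianSide x lam (Elo ω) (Ehi ω) j = ∑ b : Bool, Y (j, b) ω := by
      intro j
      simp [mondrianSide, hY, hZ, hc, add_comm]
    simp only [mondrianVol, h1]
    rw [Finset.prod_univ_sum, Fintype.piFinset_univ]
  set V : Ω → ℝ := fun ω => mondrianVol x lam (Elo ω) (Ehi ω) with hVdef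
  have hVeq : V = fun ω => ∑ f : Fin d → Bool, ∏ j, Y (j, f j) ω := funext hV
  have hind : ∀ f : Fin d → Bool, iIndepFun (fun j => Y (j, f j)) P := fun f =>
    hYind.precomp (g := fun j => (j, f j)) fun a b h => (Prod.mk.inj h).1
  have hprodpos : ∀ᵐ ω ∂P, ∀ f : Fin d → Bool, 0 < ∏ j, Y (j, f j) ω :=
    hYpos.mono fun ω h f => Finset.prod_pos fun j _ => h _
  have hprodint : ∀ f : Fin d → Bool, Integrable (fun ω => ∏ j, Y (j, f j) ω) P := by
    intro f
    refine Integrable.of_bound (C := ∏ j, c (j, f j))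
      (Finset.measurable_prod _ fun j _ => hYm _).aestronglyMeasurable ?_
    filter_upwards [hYpos] with ω h
    rw [Real.norm_of_nonneg (Finset.prod_nonneg fun j _ => (h _).le)]
    exact Finset.prod_le_prod (fun j _ => (h _).le) fun j _ => min_le_right _ _
  have hVint : Integrable V P := by
    rw [hVeq]; exact integrable_finsetSum _ fun f _ => hprodint f
  have hVpos : ∀ᵐ ω ∂P, 0 < V ω := by
    filter_upwards [hprodpos] with ω h
    rw [hVeq]
    exact Finset.sum_pos (fun f _ => h f) Finset.univ_nonempty
  have hVle : ∫ ω, V ω ∂P ≤ 2 ^ d / lam ^ d := by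
    rw [hVeq, integral_finsetSum _ fun f _ => hprodint f]
    calc ∑ f : Fin d → Bool, ∫ ω, ∏ j, Y (j, f j) ω ∂P
        ≤ ∑ f : Fin d → Bool, (1 / lam) ^ d := by
          refine Finset.sum_le_sum fun f _ => ?_
          rw [(hind f).integral_fun_prod_eq_prod_integral
            fun j => (hYm _).aestronglyMeasurable]
          calc ∏ j, ∫ ω, Y (j, f j) ω ∂P ≤ ∏ j : Fin d, (1 / lam) :=
                Finset.prod_le_prod (fun j _ => hY0 _) fun j _ => hYle _
            _ = (1 / lam) ^ d := by simp
      _ = 2 ^ d / lam ^ d := by simp [div_eq_mul_inv]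
  have hVm : Measurable V := by
    rw [hVeq]
    exact Finset.measurable_sum _ fun f _ => Finset.measurable_prod _ fun j _ => hYm _
  have hn0 : (0 : ℝ) < n := by exact_mod_cast hn
  set a : ℝ := lam ^ d / (lam ^ d + 2 ^ d * n) with ha
  have hlamd : 0 < lam ^ d := pow_pos hlam d
  have ha0 : 0 < a := by positivity
  have hainv : a * (1 + n * (2 ^ d / lam ^ d)) = 1 := by
    rw [ha]; field_simp
  set W : Ω → ℝ := fun ω => min 1 (1 / ((n : ℝ) * V ω)) with hW
  have hWm : Measurable W := by
    exact measurable_const.min (measurable_const.div (measurable_const.mul hVm))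
  have hWb : ∀ᵐ ω ∂P, 0 ≤ W ω ∧ W ω ≤ 1 := by
    filter_upwards [hVpos] with ω h
    exact ⟨le_min zero_le_one (by positivity), min_le_left _ _⟩
  have hWint : Integrable W P := by
    refine Integrable.of_bound (C := 1) hWm.aestronglyMeasurable ?_
    filter_upwards [hWb] with ω h
    rw [Real.norm_of_nonneg h.1]; exact h.2
  have hW2int : Integrable (fun ω => W ω ^ 2) P := by
    refine Integrable.of_bound (C := 1) (hWm.pow_const 2).aestronglyMeasurable ?_
    filter_upwards [hWb] with ω h
    rw [Real.norm_of_nonneg (sq_nonneg _)]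
    exact pow_le_one₀ h.1 h.2
  have h1 : a ≤ ∫ ω, W ω ∂P := by
    have hlow : ∫ ω, (2 * a - a ^ 2 * (1 + n * V ω)) ∂P ≤ ∫ ω, W ω ∂P := by
      refine integral_mono_ae ?_ hWint ?_
      · exact (integrable_const _).sub (((integrable_const _).add (hVint.const_mul _)).const_mul _)
      · filter_upwards [hVpos] with ω h
        have hy : 0 < (n : ℝ) * V ω := by positivity
        have hk : 2 * a - a ^ 2 * (1 + n * V ω) ≤ 1 / (1 + n * V ω) := by
          rw [le_div_iff₀ (by positivity)]
          nlinarith [sq_nonneg (a * (1 + n * V ω) - 1)]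
        refine hk.trans (le_min ?_ ?_)
        · rw [div_le_one (by positivity)]; linarith
        · exact one_div_le_one_div_of_le hy (by linarith)
    have heq : ∫ ω, (2 * a - a ^ 2 * (1 + n * V ω)) ∂P
        = 2 * a - a ^ 2 * (1 + n * ∫ ω, V ω ∂P) := by
      have hI : Integrable (fun ω => a ^ 2 * (1 + n * V ω)) P :=
        ((integrable_const _).add (hVint.const_mul _)).const_mul _
      rw [integral_sub (integrable_const _) hI, integral_const_mul (a ^ 2),
        integral_add (integrable_const _) (hVint.const_mul _), integral_const_mul (n : ℝ)]
      simp
    have h3 : a ^ 2 * (1 + n * ∫ ω, V ω ∂P) ≤ a ^ 2 * (1 + n * (2 ^ d / lam ^ d)) := by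
      gcongr
    have h4 : a ^ 2 * (1 + n * (2 ^ d / lam ^ d)) = a := by
      rw [sq, mul_assoc, hainv, mul_one]
    linarith
  refine ⟨h1, ?_⟩
  have h2 : ∫ ω, min 1 (1 / ((n : ℝ) * V ω) ^ 2) ∂P = ∫ ω, W ω ^ 2 ∂P := by
    refine integral_congr_ae ?_
    filter_upwards [hVpos] with ω h
    have hy : 0 < 1 / ((n : ℝ) * V ω) := by positivity
    have e : 1 / ((n : ℝ) * V ω) ^ 2 = (1 / ((n : ℝ) * V ω)) ^ 2 := by rw [div_pow, one_pow]
    simp only [hW, e]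
    rcases le_total 1 (1 / ((n : ℝ) * V ω)) with h' | h'
    · rw [min_eq_left h', min_eq_left (one_le_pow₀ h'), one_pow]
    · rw [min_eq_right h', min_eq_right (pow_le_one₀ hy.le h')]
  rw [h2]
  have h5 : ∫ ω, (2 * a * W ω - a ^ 2) ∂P ≤ ∫ ω, W ω ^ 2 ∂P := by
    refine integral_mono ((hWint.const_mul _).sub (integrable_const _)) hW2int fun ω => ?_
    change 2 * a * W ω - a ^ 2 ≤ W ω ^ 2
    nlinarith [sq_nonneg (W ω - a)]
  rw [integral_sub (hWint.const_mul _) (integrable_const _), integral_const_mul] at h5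
  simp only [integral_const, probReal_univ, one_smul] at h5
  nlinarith
end
end
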